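/- arXiv:2105.12914 — 2 statements merged into one kernel-verified Lean document; each statement's English description precedes it below -/
import Mathlib

section
/- Let S be a compact convex subset of R^d, let P_n be a Poisson process with intensity n on S, and fix k ≥ 1. Then there is a constant c > 0 such that E[β_k(R(P_n,r))] = O(n Λ^k e^{−cΛ}), where Λ = ω_d n r^d. In particular, for any ε > 0, if Λ = ((1+ε)/c) log n then with high probability β_k(R(P_n,r)) = 0. -/
/-!
STATEMENT 8: For the random Vietoris–Rips complex on a compact convex `S ⊂ ℝ^d`
(Poisson process with intensity `n`, uniform on `S`), `E[β_k(R(P_n,r))] = O(n Λ^k e^{-cΛ})`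
for some `c > 0`; in particular if `Λ = ((1+ε)/c) log n` then `β_k = 0` w.h.p.
-/

open Filter

section SimplicialHomology

variable {V : Type*}

/-- The `k`-dimensional faces (simplexes with `k+1` vertices) of a simplicial complex,
given as the finite set of its faces. -/
abbrev Faces [DecidableEq V] (K : Finset (Finset V)) (k : ℕ) : Type _ :=
  {σ : Finset V // σ ∈ K ∧ σ.card = k + 1}

/-- The matrix of the simplicial boundary map from `(k+1)`-chains to `k`-chains:
the entry at `(τ, σ)` is `(-1)^i` if `τ ⊆ σ` and the vertex of `σ` missing from `τ`
is the `i`-th vertex of `σ` in increasing order, and `0` otherwise. -/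
noncomputable def bdryMat (R : Type*) [CommRing R] [Fintype V] [LinearOrder V]
    (K : Finset (Finset V)) (k : ℕ) : Matrix (Faces K k) (Faces K (k + 1)) R :=
  fun τ σ =>
    if τ.1 ⊆ σ.1 then
      ∑ v ∈ σ.1 \ τ.1, (-1 : R) ^ (σ.1.filter (fun u => u < v)).card
    else 0

/-- The simplicial boundary map from `(k+1)`-chains to `k`-chains. -/
noncomputable def bdry (R : Type*) [CommRing R] [Fintype V] [LinearOrder V]
    (K : Finset (Finset V)) (k : ℕ) :
    ((Faces K (k + 1)) → R) →ₗ[R] ((Faces K k) → R) :=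
  (bdryMat R K k).mulVecLin

/-- The augmentation map on `0`-chains (sum of coefficients), used for reduced homology. -/
noncomputable def augment (R : Type*) [CommRing R] [Fintype V] [LinearOrder V]
    (K : Finset (Finset V)) : ((Faces K 0) → R) →ₗ[R] (Unit → R) :=
  (Matrix.of fun (_ : Unit) (_ : Faces K 0) => (1 : R)).mulVecLin

/-- The submodule of (reduced) `k`-cycles of the complex `K` with coefficients in `R`. -/
noncomputable def cycleSubmodule (R : Type*) [CommRing R] [Fintype V] [LinearOrder V]
    (K : Finset (Finset V)) : (k : ℕ) → Submodule R ((Faces K k) → R)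
  | 0 => LinearMap.ker (augment R K)
  | (j + 1) => LinearMap.ker (bdry R K j)

/-- The `k`-th (reduced) simplicial homology of the complex `K` with coefficients in the
ring `R`: the quotient of the `k`-cycles by the `k`-boundaries. -/
abbrev homologyModule (R : Type*) [CommRing R] [Fintype V] [LinearOrder V]
    (K : Finset (Finset V)) (k : ℕ) :=
  ↥(cycleSubmodule R K k) ⧸
    (Submodule.comap (cycleSubmodule R K k).subtype (LinearMap.range (bdry R K k)))

/-- The `k`-th (reduced) Betti number of the complex `K`: the dimension of its `k`-th
(reduced) homology with rational coefficients. -/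
noncomputable def bettiNumber [Fintype V] [LinearOrder V]
    (K : Finset (Finset V)) (k : ℕ) : ℕ :=
  Module.finrank ℚ (homologyModule ℚ K k)

end SimplicialHomology

/-- The volume `ω_d` of the unit ball in `ℝ^d`. -/
noncomputable def unitBallVol (d : ℕ) : ℝ :=
  (MeasureTheory.volume (Metric.ball (0 : EuclideanSpace ℝ (Fin d)) 1)).toReal

/-- The uniform probability measure on a subset `S` of `ℝ^d`. -/
noncomputable def uniformOn {d : ℕ} (S : Set (EuclideanSpace ℝ (Fin d))) :
    MeasureTheory.Measure (EuclideanSpace ℝ (Fin d)) :=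
  (MeasureTheory.volume S)⁻¹ • MeasureTheory.volume.restrict S

/-- The probability of the event `A` for a homogeneous Poisson point process with intensity `n`
on `S ⊂ ℝ^d`: the number of points is Poisson with mean `n`, and given that there are `m`
points they are i.i.d. uniform on `S`. -/
noncomputable def poissonProbOn {d : ℕ} (S : Set (EuclideanSpace ℝ (Fin d))) (n : ℕ)
    (A : ∀ m : ℕ, (Fin m → EuclideanSpace ℝ (Fin d)) → Prop) : ℝ :=
  ∑' m : ℕ, (Real.exp (-(n : ℝ)) * (n : ℝ) ^ m / Nat.factorial m) *
    ((MeasureTheory.Measure.pi fun _ : Fin m => uniformOn S)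
      {x : Fin m → EuclideanSpace ℝ (Fin d) | A m x}).toReal

/-- The expectation of the functional `f` of the point configuration, for a homogeneous
Poisson point process with intensity `n` on `S ⊂ ℝ^d`. -/
noncomputable def poissonExpOn {d : ℕ} (S : Set (EuclideanSpace ℝ (Fin d))) (n : ℕ)
    (f : ∀ m : ℕ, (Fin m → EuclideanSpace ℝ (Fin d)) → ℝ) : ℝ :=
  ∑' m : ℕ, (Real.exp (-(n : ℝ)) * (n : ℝ) ^ m / Nat.factorial m) *
    ∫ x : Fin m → EuclideanSpace ℝ (Fin d), f m x
      ∂(MeasureTheory.Measure.pi fun _ : Fin m => uniformOn S)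

/-- The Vietoris–Rips complex of the point configuration `x` at scale `r`: a nonempty finite
set of (indices of) points spans a simplex iff all pairwise distances are at most `r`. -/
noncomputable def ripsComplexE {d m : ℕ} (x : Fin m → EuclideanSpace ℝ (Fin d)) (r : ℝ) :
    Finset (Finset (Fin m)) := by
  classical
  exact (Finset.univ : Finset (Fin m)).powerset.filter
    (fun σ => σ.Nonempty ∧ ∀ i ∈ σ, ∀ j ∈ σ, dist (x i) (x j) ≤ r)

section PairingBound

variable {V : Type*} [Fintype V] [LinearOrder V]

theorem bdry_single (K : Finset (Finset V)) (l : ℕ) (σ : Faces K (l + 1)) (τ : Faces K l) :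
    bdry ℚ K l (Pi.single σ 1) τ = bdryMat ℚ K l τ σ := by
  simp [bdry]

theorem bdryMat_eq_zero_of_not_subset {K : Finset (Finset V)} {l : ℕ} {τ : Faces K l}
    {σ : Faces K (l + 1)} (h : ¬ τ.1 ⊆ σ.1) : bdryMat ℚ K l τ σ = 0 := by
  simp [bdryMat, h]

theorem bdryMat_of_eq_erase {K : Finset (Finset V)} {l : ℕ} {τ : Faces K l}
    {σ : Faces K (l + 1)} {v : V} (hv : v ∈ σ.1) (h : τ.1 = σ.1.erase v) :
    bdryMat ℚ K l τ σ = (-1) ^ (σ.1.filter (fun u => u < v)).card := by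
  have h1 : σ.1 \ τ.1 = {v} := by
    rw [h, Finset.sdiff_erase hv, Finset.sdiff_self]; simp
  have h2 : τ.1 ⊆ σ.1 := h ▸ Finset.erase_subset _ _
  simp [bdryMat, h2, h1]

omit [Fintype V] in
theorem exists_eq_erase_of_subset {K : Finset (Finset V)} {l : ℕ} {τ : Faces K l}
    {σ : Faces K (l + 1)} (h : τ.1 ⊆ σ.1) : ∃ v ∈ σ.1, τ.1 = σ.1.erase v := by
  have hc : (σ.1 \ τ.1).card = 1 := by
    rw [Finset.card_sdiff_of_subset h, σ.2.2, τ.2.2]; omega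
  obtain ⟨v, hv⟩ := Finset.card_eq_one.1 hc
  have hvm : v ∈ σ.1 \ τ.1 := by simp [hv]
  refine ⟨v, (Finset.mem_sdiff.1 hvm).1, ?_⟩
  rw [← Finset.sdiff_singleton_eq_erase, ← hv, Finset.sdiff_sdiff_eq_self h]

theorem bdry_bdry {K : Finset (Finset V)}
    (hK : ∀ σ ∈ K, ∀ τ ⊆ σ, τ.Nonempty → τ ∈ K) (l : ℕ) :
    (bdry ℚ K l).comp (bdry ℚ K (l + 1)) = 0 := by
  have hmul : bdryMat ℚ K l * bdryMat ℚ K (l + 1) = 0 := by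
    ext ρ σ
    rw [Matrix.mul_apply, Matrix.zero_apply]
    by_cases hρσ : ρ.1 ⊆ σ.1
    swap
    · refine Finset.sum_eq_zero fun τ _ => ?_
      by_cases h1 : ρ.1 ⊆ τ.1
      · rw [bdryMat_eq_zero_of_not_subset (τ := τ) (fun h2 => hρσ (h1.trans h2)), mul_zero]
      · rw [bdryMat_eq_zero_of_not_subset h1, zero_mul]
    have hc : (σ.1 \ ρ.1).card = 2 := by
      rw [Finset.card_sdiff_of_subset hρσ, σ.2.2, ρ.2.2]; omega
    obtain ⟨a, b, hab, hs⟩ : ∃ a b, a < b ∧ σ.1 \ ρ.1 = {a, b} := by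
      obtain ⟨a, b, hne, hs⟩ := Finset.card_eq_two.1 hc
      rcases lt_or_gt_of_ne hne with h | h
      · exact ⟨a, b, h, hs⟩
      · exact ⟨b, a, h, by rw [hs, Finset.pair_comm]⟩
    have ha : a ∈ σ.1 \ ρ.1 := by simp [hs]
    have hb : b ∈ σ.1 \ ρ.1 := by simp [hs]
    rw [Finset.mem_sdiff] at ha hb
    have hmem : ∀ c ∈ σ.1, σ.1.erase c ∈ K ∧ (σ.1.erase c).card = l + 1 + 1 := by
      intro c hcσ
      have h1 : (σ.1.erase c).card = l + 1 + 1 := by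
        rw [Finset.card_erase_of_mem hcσ, σ.2.2]; omega
      exact ⟨hK _ σ.2.1 _ (Finset.erase_subset _ _) (Finset.card_pos.1 (by omega)), h1⟩
    let A : Faces K (l + 1) := ⟨σ.1.erase a, hmem a ha.1⟩
    let B : Faces K (l + 1) := ⟨σ.1.erase b, hmem b hb.1⟩
    have hAB : A ≠ B := by
      intro h
      have h1 : b ∈ σ.1.erase a := Finset.mem_erase.2 ⟨hab.ne', hb.1⟩
      rw [show σ.1.erase a = σ.1.erase b from congrArg Subtype.val h] at h1
      simp at h1
    have hρ : ρ.1 = (σ.1.erase a).erase b := by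
      have : ρ.1 = σ.1 \ {a, b} := by rw [← hs, Finset.sdiff_sdiff_eq_self hρσ]
      rw [this]; ext c; simp only [Finset.mem_sdiff, Finset.mem_insert, Finset.mem_singleton,
        Finset.mem_erase]; tauto
    have hρ' : ρ.1 = (σ.1.erase b).erase a := by rw [hρ, Finset.erase_right_comm]
    rw [Finset.sum_eq_add A B hAB]
    · rw [bdryMat_of_eq_erase (τ := ρ) (σ := A) (v := b)
          (Finset.mem_erase.2 ⟨hab.ne', hb.1⟩) hρ,
        bdryMat_of_eq_erase (τ := ρ) (σ := B) (v := a)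
          (Finset.mem_erase.2 ⟨hab.ne, ha.1⟩) hρ',
        bdryMat_of_eq_erase (τ := A) (σ := σ) ha.1 rfl,
        bdryMat_of_eq_erase (τ := B) (σ := σ) hb.1 rfl]
      have e1 : (B.1.filter (fun u => u < a)) = σ.1.filter (fun u => u < a) := by
        ext c; simp only [B, Finset.mem_filter, Finset.mem_erase]
        constructor
        · tauto
        · rintro ⟨h1, h2⟩; exact ⟨⟨(h2.trans hab).ne, h1⟩, h2⟩
      have e2 : (σ.1.filter (fun u => u < b)).card = (A.1.filter (fun u => u < b)).card + 1 := by
        have : A.1.filter (fun u => u < b) = (σ.1.filter (fun u => u < b)).erase a := by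
          ext c; simp only [A, Finset.mem_filter, Finset.mem_erase]; tauto
        rw [this, Finset.card_erase_add_one (Finset.mem_filter.2 ⟨ha.1, hab⟩)]
      rw [e1, e2]; ring
    · intro τ _ hτ
      by_cases h2 : τ.1 ⊆ σ.1
      swap
      · rw [bdryMat_eq_zero_of_not_subset h2, mul_zero]
      by_cases h1 : ρ.1 ⊆ τ.1
      swap
      · rw [bdryMat_eq_zero_of_not_subset h1, zero_mul]
      exfalso
      obtain ⟨v, hv, hτv⟩ := exists_eq_erase_of_subset h2
      have hvρ : v ∉ ρ.1 := fun h => by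
        have := h1 h; rw [hτv] at this; simp at this
      have : v ∈ ({a, b} : Finset V) := hs ▸ Finset.mem_sdiff.2 ⟨hv, hvρ⟩
      simp only [Finset.mem_insert, Finset.mem_singleton] at this
      rcases this with rfl | rfl
      · exact hτ.1 (Subtype.ext hτv)
      · exact hτ.2 (Subtype.ext hτv)
    · simp
    · simp
  rw [bdry, bdry, ← Matrix.mulVecLin_mul, hmul, Matrix.mulVecLin_zero]

variable {L : Type*} [LinearOrder L]

/-- The vertices that come before every vertex of `σ` in the order induced by `h` and that
span a face of `K` together with `σ`. -/
def lowerExtensions (K : Finset (Finset V)) (h : V → L) (σ : Finset V) : Finset V :=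
  Finset.univ.filter fun v => (∀ u ∈ σ, h v < h u) ∧ insert v σ ∈ K

theorem mem_lowerExtensions {K : Finset (Finset V)} {h : V → L} {σ : Finset V} {v : V} :
    v ∈ lowerExtensions K h σ ↔ (∀ u ∈ σ, h v < h u) ∧ insert v σ ∈ K := by
  simp [lowerExtensions]

/-- The faces left unmatched when every face is matched with its extension by the
first possible earlier vertex. -/
def IsCriticalFace (K : Finset (Finset V)) (h : V → L) (σ : Finset V) : Prop :=
  lowerExtensions K h σ = ∅ ∧
    ∃ v ∈ σ, (∀ u ∈ σ, h v ≤ h u) ∧ ∃ w, h w < h v ∧ insert w (σ.erase v) ∈ K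

/-- The number of faces admitting an extension by an earlier vertex is at most the rank of
the boundary map. -/
theorem card_extendable_le_finrank_range_bdry {K : Finset (Finset V)}
    {h : V → L} (l : ℕ) (m : Finset V → V)
    (hm : ∀ σ, (lowerExtensions K h σ).Nonempty →
      m σ ∈ lowerExtensions K h σ ∧ ∀ v ∈ lowerExtensions K h σ, h (m σ) ≤ h v) :
    Fintype.card {σ : Faces K l // (lowerExtensions K h σ.1).Nonempty} ≤
      Module.finrank ℚ (LinearMap.range (bdry ℚ K l)) := by
  classical
  have hnot : ∀ σ : {σ : Faces K l // (lowerExtensions K h σ.1).Nonempty}, m σ.1.1 ∉ σ.1.1 :=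
    fun σ hmem => lt_irrefl _ ((mem_lowerExtensions.1 (hm _ σ.2).1).1 _ hmem)
  let up : {σ : Faces K l // (lowerExtensions K h σ.1).Nonempty} → Faces K (l + 1) := fun σ =>
    ⟨insert (m σ.1.1) σ.1.1, (mem_lowerExtensions.1 (hm _ σ.2).1).2, by
      rw [Finset.card_insert_of_notMem (hnot σ), σ.1.2.2]⟩
  have hlt : ∀ σ τ : {σ : Faces K l // (lowerExtensions K h σ.1).Nonempty},
      bdryMat ℚ K l τ.1 (up σ) ≠ 0 → τ ≠ σ → h (m τ.1.1) < h (m σ.1.1) := by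
    intro σ τ hne hτσ
    have hsub : τ.1.1 ⊆ insert (m σ.1.1) σ.1.1 := by
      by_contra hcon
      exact hne (bdryMat_eq_zero_of_not_subset hcon)
    have hmem : m σ.1.1 ∈ τ.1.1 := by
      by_contra hcon
      have h1 : τ.1.1 ⊆ σ.1.1 := (Finset.subset_insert_iff_of_notMem hcon).1 hsub
      exact hτσ (Subtype.ext (Subtype.ext (Finset.eq_of_subset_of_card_le h1
        (by rw [σ.1.2.2, τ.1.2.2]))))
    exact (mem_lowerExtensions.1 (hm _ τ.2).1).1 _ hmem
  have hdiag : ∀ σ, bdryMat ℚ K l σ.1 (up σ) ≠ 0 := by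
    intro σ
    rw [bdryMat_of_eq_erase (v := m σ.1.1) (Finset.mem_insert_self _ _)
      (Finset.erase_insert (hnot σ)).symm]
    exact pow_ne_zero _ (by norm_num)
  have hli : LinearIndependent ℚ (fun σ => bdry ℚ K l (Pi.single (up σ) 1)) := by
    rw [Fintype.linearIndependent_iff]
    intro g hg
    by_contra! hcon
    obtain ⟨σ₀, hσ₀⟩ := hcon
    obtain ⟨σ, hσ, hmax⟩ := Finset.exists_max_image (Finset.univ.filter fun σ => g σ ≠ 0)
      (fun σ => h (m σ.1.1)) ⟨σ₀, by simpa using hσ₀⟩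
    have hσ' : g σ ≠ 0 := by simpa using hσ
    have hev := congrFun hg σ.1
    simp only [Finset.sum_apply, Pi.smul_apply, bdry_single, smul_eq_mul, Pi.zero_apply] at hev
    rw [Finset.sum_eq_single σ] at hev
    · exact (mul_ne_zero hσ' (hdiag σ)) hev
    · intro σ' _ hne
      by_cases hg' : g σ' = 0
      · rw [hg', zero_mul]
      by_cases hM : bdryMat ℚ K l σ.1 (up σ') = 0
      · rw [hM, mul_zero]
      exact absurd (hlt σ' σ hM hne.symm) (not_lt.2 (hmax σ' (by simpa using hg')))
    · simp
  rw [← finrank_span_eq_card hli]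
  refine Submodule.finrank_mono (Submodule.span_le.2 ?_)
  rintro _ ⟨σ, rfl⟩
  exact ⟨_, rfl⟩

/-- The Betti numbers are bounded by the numbers of critical faces. -/
theorem bettiNumber_le_card_criticalFaces {K : Finset (Finset V)}
    (hK : ∀ σ ∈ K, ∀ τ ⊆ σ, τ.Nonempty → τ ∈ K) {h : V → L} (hh : Function.Injective h) (j : ℕ)
    [Fintype {σ : Faces K (j + 1) // IsCriticalFace K h σ.1}] :
    bettiNumber K (j + 1) ≤ Fintype.card {σ : Faces K (j + 1) // IsCriticalFace K h σ.1} := by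
  classical
  rcases isEmpty_or_nonempty V with hV | hV
  · have : IsEmpty (Faces K (j + 1)) := by
      refine ⟨fun σ => ?_⟩
      have := σ.2.2
      rw [Finset.eq_empty_of_isEmpty σ.1] at this
      simp at this
    rw [bettiNumber, Module.finrank_zero_of_subsingleton]
    exact Nat.zero_le _
  have hex : ∀ σ : Finset V, ∃ v : V, (lowerExtensions K h σ).Nonempty →
      v ∈ lowerExtensions K h σ ∧ ∀ u ∈ lowerExtensions K h σ, h v ≤ h u := by
    intro σ
    by_cases hσ : (lowerExtensions K h σ).Nonempty
    · obtain ⟨v, hv, hmin⟩ := Finset.exists_min_image _ h hσ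
      exact ⟨v, fun _ => ⟨hv, hmin⟩⟩
    · exact ⟨hV.some, fun h => absurd h hσ⟩
  choose m hm using hex
  have hr := card_extendable_le_finrank_range_bdry (K := K) (h := h) (j + 1) m hm
  have hr' := card_extendable_le_finrank_range_bdry (K := K) (h := h) j m hm
  have hle : LinearMap.range (bdry ℚ K (j + 1)) ≤ cycleSubmodule ℚ K (j + 1) :=
    LinearMap.range_le_ker_iff.2 (bdry_bdry hK j)
  have hq := Submodule.finrank_quotient_add_finrank
    (Submodule.comap (cycleSubmodule ℚ K (j + 1)).subtype (LinearMap.range (bdry ℚ K (j + 1))))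
  rw [(Submodule.comapSubtypeEquivOfLe hle).finrank_eq] at hq
  have hrn := LinearMap.finrank_range_add_finrank_ker (bdry ℚ K j)
  rw [Module.finrank_fintype_fun_eq_card] at hrn
  have hZ : Module.finrank ℚ (cycleSubmodule ℚ K (j + 1)) =
    Module.finrank ℚ (LinearMap.ker (bdry ℚ K j)) := rfl
  have hmatch : ∀ σ : Faces K (j + 1), ¬ (lowerExtensions K h σ.1).Nonempty →
      IsCriticalFace K h σ.1 ∨ ∃ τ : {τ : Faces K j // (lowerExtensions K h τ.1).Nonempty},
        insert (m τ.1.1) τ.1.1 = σ.1 := by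
    intro σ hσ
    have hne : σ.1.Nonempty := Finset.card_pos.1 (by rw [σ.2.2]; omega)
    obtain ⟨v, hv, hmin⟩ := Finset.exists_min_image σ.1 h hne
    have hc : (σ.1.erase v).card = j + 1 := by
      rw [Finset.card_erase_of_mem hv, σ.2.2]; omega
    have hτK : σ.1.erase v ∈ K :=
      hK _ σ.2.1 _ (Finset.erase_subset _ _) (Finset.card_pos.1 (by omega))
    have hvext : v ∈ lowerExtensions K h (σ.1.erase v) := by
      refine mem_lowerExtensions.2 ⟨fun u hu => ?_, ?_⟩
      · rw [Finset.mem_erase] at hu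
        exact lt_of_le_of_ne (hmin u hu.2) (fun hc => hu.1 (hh hc).symm)
      · rw [Finset.insert_erase hv]; exact σ.2.1
    obtain ⟨h1, h2⟩ := hm _ ⟨v, hvext⟩
    by_cases hmv : m (σ.1.erase v) = v
    · refine Or.inr ⟨⟨⟨σ.1.erase v, hτK, hc⟩, ⟨v, hvext⟩⟩, ?_⟩
      change insert (m (σ.1.erase v)) (σ.1.erase v) = σ.1
      rw [hmv, Finset.insert_erase hv]
    · refine Or.inl ⟨Finset.not_nonempty_iff_eq_empty.1 hσ, v, hv, hmin, m (σ.1.erase v), ?_,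
        (mem_lowerExtensions.1 h1).2⟩
      exact lt_of_le_of_ne (h2 v hvext) (fun hc => hmv (hh hc))
  have hcount : Fintype.card {σ : Faces K (j + 1) // ¬ (lowerExtensions K h σ.1).Nonempty} ≤
      Fintype.card ({σ : Faces K (j + 1) // IsCriticalFace K h σ.1} ⊕
        {τ : Faces K j // (lowerExtensions K h τ.1).Nonempty}) := by
    have hg : ∀ σ : {σ : Faces K (j + 1) // ¬ (lowerExtensions K h σ.1).Nonempty},
        ∃ s : {σ : Faces K (j + 1) // IsCriticalFace K h σ.1} ⊕
          {τ : Faces K j // (lowerExtensions K h τ.1).Nonempty},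
          Sum.elim (fun s => s.1.1) (fun τ => insert (m τ.1.1) τ.1.1) s = σ.1.1 := by
      intro σ
      rcases hmatch σ.1 σ.2 with hs | ⟨τ, hτ⟩
      · exact ⟨Sum.inl ⟨σ.1, hs⟩, rfl⟩
      · exact ⟨Sum.inr τ, hτ⟩
    choose g hg using hg
    refine Fintype.card_le_of_injective g fun σ σ' he => ?_
    exact Subtype.ext (Subtype.ext (by rw [← hg σ, ← hg σ', he]))
  rw [Fintype.card_sum] at hcount
  have hsplit := Fintype.card_subtype_compl
    (fun σ : Faces K (j + 1) => (lowerExtensions K h σ.1).Nonempty)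
  have hsub := Fintype.card_subtype_le
    (fun σ : Faces K (j + 1) => (lowerExtensions K h σ.1).Nonempty)
  have hbetti : bettiNumber K (j + 1) +
    Module.finrank ℚ (LinearMap.range (bdry ℚ K (j + 1))) =
      Module.finrank ℚ (cycleSubmodule ℚ K (j + 1)) := hq
  omega

end PairingBound

section Geometry

variable {E : Type*} [NormedAddCommGroup E] [InnerProductSpace ℝ E]

theorem dist_quarter_sq (p y₀ y₁ : E) :
    dist (y₁ + (1 / 4 : ℝ) • (y₀ - y₁)) p ^ 2 =
      3 / 4 * dist y₁ p ^ 2 + 1 / 4 * dist y₀ p ^ 2 - 3 / 16 * dist y₀ y₁ ^ 2 := by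
  have h1 : y₁ + (1 / 4 : ℝ) • (y₀ - y₁) - p = (3 / 4 : ℝ) • (y₁ - p) + (1 / 4 : ℝ) • (y₀ - p) := by
    module
  have h2 : y₀ - y₁ = (y₀ - p) - (y₁ - p) := by abel
  simp only [dist_eq_norm]
  rw [h1, h2]
  generalize y₁ - p = v
  generalize y₀ - p = u
  rw [norm_add_sq_real, norm_sub_sq_real, norm_smul, norm_smul, inner_smul_left,
    inner_smul_right, real_inner_comm]
  norm_num
  ring

/-- The point at a quarter of the way from `y₁` to `y₀`, moved towards `o` by a distance
comparable to `r`. -/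
noncomputable def pocketCenter (o : E) (r : ℝ) (y₀ y₁ : E) : E :=
  (1 - r / (32 * dist y₁ o)) • (y₁ + (1 / 4 : ℝ) • (y₀ - y₁)) + (r / (32 * dist y₁ o)) • o

theorem dist_quarter_le {o y₀ y₁ : E} (h01 : dist y₀ o ≤ dist y₁ o) :
    dist (y₁ + (1 / 4 : ℝ) • (y₀ - y₁)) o ≤ dist y₁ o := by
  refine le_of_sq_le_sq ?_ dist_nonneg
  rw [dist_quarter_sq]
  nlinarith [sq_nonneg (dist y₀ y₁), dist_nonneg (x := y₀) (y := o)]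

/-- Every point of the pocket is a convex combination of the quarter point and of a point `b`
close to `o`. -/
theorem exists_eq_of_mem_pocket {o : E} {ρ R r : ℝ}
    (hρ : 0 < ρ) (hρR : ρ ≤ R) (hr : 0 ≤ r) {y₀ y₁ : E} (hR : dist y₁ o ≤ R)
    (h01 : dist y₀ o ≤ dist y₁ o) (hfar : r < dist y₀ y₁)
    {z : E} (hz : z ∈ Metric.ball (pocketCenter o r y₀ y₁) (ρ / (32 * R) * r)) :
    ∃ b : E, dist b o < ρ ∧ dist b o < dist y₁ o ∧
      0 < r / (32 * dist y₁ o) ∧ r / (32 * dist y₁ o) ≤ 1 ∧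
      z = (1 - r / (32 * dist y₁ o)) • (y₁ + (1 / 4 : ℝ) • (y₀ - y₁)) +
        (r / (32 * dist y₁ o)) • b := by
  have hr0 : 0 < r := by
    rcases hr.eq_or_lt with h | h
    · rw [← h] at hz; simp at hz
    · exact h
  have htri := dist_triangle_right y₀ y₁ o
  have hL : 0 < dist y₁ o := by linarith
  set D := dist y₁ o with hD
  set s := r / (32 * D) with hs
  have hs0 : 0 < s := by positivity
  have hR0 : 0 < R := by linarith
  have hs1 : s ≤ 1 := by rw [hs, div_le_one (by positivity)]; linarith
  have hsD : s * D = r / 32 := by rw [hs]; field_simp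
  have hzlt : ‖z - pocketCenter o r y₀ y₁‖ < ρ / (32 * R) * r := by
    rw [← dist_eq_norm]; exact hz
  have hb : dist (o + s⁻¹ • (z - pocketCenter o r y₀ y₁)) o = s⁻¹ * ‖z - pocketCenter o r y₀ y₁‖ := by
    rw [dist_eq_norm, add_sub_cancel_left, norm_smul, Real.norm_of_nonneg (by positivity)]
  have key : ∀ t : ℝ, ρ / (32 * R) * r ≤ s * t →
      dist (o + s⁻¹ • (z - pocketCenter o r y₀ y₁)) o < t := by
    intro t ht
    rw [hb, inv_mul_lt_iff₀ hs0]
    exact hzlt.trans_le ht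
  refine ⟨o + s⁻¹ • (z - pocketCenter o r y₀ y₁), key _ ?_, key _ ?_, hs0, hs1, ?_⟩
  · have : ρ / (32 * R) * r = r / (32 * R) * ρ := by ring
    rw [this, hs]
    gcongr
  · rw [hsD]
    have : ρ / (32 * R) * r = (ρ / R) * (r / 32) := by field_simp
    rw [this]
    exact mul_le_of_le_one_left (by positivity) ((div_le_one hR0).2 hρR)
  · have : s • (o + s⁻¹ • (z - pocketCenter o r y₀ y₁)) =
        s • o + (z - pocketCenter o r y₀ y₁) := by
      rw [smul_add, smul_inv_smul₀ hs0.ne']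
    rw [this, pocketCenter, ← hD, ← hs]
    abel

theorem pocket_subset {S : Set E} (hS : Convex ℝ S) {o : E} {ρ R r : ℝ}
    (hρ : 0 < ρ) (hρR : ρ ≤ R) (hball : Metric.ball o ρ ⊆ S) (hr : 0 ≤ r) {y₀ y₁ : E}
    (hy₀ : y₀ ∈ S) (hy₁ : y₁ ∈ S) (hR : dist y₁ o ≤ R)
    (h01 : dist y₀ o ≤ dist y₁ o) (hfar : r < dist y₀ y₁) :
    Metric.ball (pocketCenter o r y₀ y₁) (ρ / (32 * R) * r) ⊆ S := by
  intro z hz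
  obtain ⟨b, hb, -, hs0, hs1, rfl⟩ := exists_eq_of_mem_pocket hρ hρR hr hR h01 hfar hz
  refine hS ?_ (hball hb) (by linarith) hs0.le (by ring)
  have : y₁ + (1 / 4 : ℝ) • (y₀ - y₁) = (3 / 4 : ℝ) • y₁ + (1 / 4 : ℝ) • y₀ := by module
  rw [this]
  exact hS hy₁ hy₀ (by norm_num) (by norm_num) (by norm_num)

theorem dist_lt_of_mem_pocket {o : E} {ρ R r : ℝ}
    (hρ : 0 < ρ) (hρR : ρ ≤ R) (hr : 0 ≤ r) {y₀ y₁ : E} (hR : dist y₁ o ≤ R)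
    (h01 : dist y₀ o ≤ dist y₁ o) (hfar : r < dist y₀ y₁)
    {z : E} (hz : z ∈ Metric.ball (pocketCenter o r y₀ y₁) (ρ / (32 * R) * r)) :
    dist z o < dist y₁ o := by
  obtain ⟨b, -, hb, hs0, hs1, rfl⟩ := exists_eq_of_mem_pocket hρ hρR hr hR h01 hfar hz
  set s := r / (32 * dist y₁ o)
  set q := y₁ + (1 / 4 : ℝ) • (y₀ - y₁) with hq
  have hqo : dist q o ≤ dist y₁ o := dist_quarter_le h01
  have h1 : (1 - s) • q + s • b - o = (1 - s) • (q - o) + s • (b - o) := by module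
  rw [dist_eq_norm, h1]
  calc ‖(1 - s) • (q - o) + s • (b - o)‖ ≤ (1 - s) * dist q o + s * dist b o := by
        refine (norm_add_le _ _).trans ?_
        rw [norm_smul, norm_smul, Real.norm_of_nonneg hs0.le,
          Real.norm_of_nonneg (by linarith), dist_eq_norm, dist_eq_norm]
    _ < (1 - s) * dist y₁ o + s * dist y₁ o :=
        add_lt_add_of_le_of_lt (mul_le_mul_of_nonneg_left hqo (by linarith))
          (mul_lt_mul_of_pos_left hb hs0)
    _ = dist y₁ o := by ring

theorem dist_le_of_mem_pocket {o : E} {ρ R r : ℝ}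
    (hρ : 0 < ρ) (hρR : ρ ≤ R) (hr : 0 ≤ r) {y₀ y₁ p : E} (hR : dist y₁ o ≤ R)
    (h01 : dist y₀ o ≤ dist y₁ o) (hfar : r < dist y₀ y₁)
    (h0p : dist y₀ p ≤ r) (h1p : dist y₁ p ≤ r)
    {z : E} (hz : z ∈ Metric.ball (pocketCenter o r y₀ y₁) (ρ / (32 * R) * r)) :
    dist z p ≤ r ∧ dist z y₁ ≤ r := by
  obtain ⟨b, -, hb, hs0, hs1, rfl⟩ := exists_eq_of_mem_pocket hρ hρR hr hR h01 hfar hz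
  have hD : 0 < dist y₁ o := dist_nonneg.trans_lt hb
  have hsD : r / (32 * dist y₁ o) * dist y₁ o = r / 32 := by field_simp
  set s := r / (32 * dist y₁ o)
  set q := y₁ + (1 / 4 : ℝ) • (y₀ - y₁) with hq
  have hqo : dist q o ≤ dist y₁ o := dist_quarter_le h01
  have hzq : dist ((1 - s) • q + s • b) q ≤ r / 16 := by
    have h1 : (1 - s) • q + s • b - q = s • (b - q) := by module
    rw [dist_eq_norm, h1, norm_smul, Real.norm_of_nonneg hs0.le, ← dist_eq_norm]
    have h2 : dist b q ≤ 2 * dist y₁ o := by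
      linarith [dist_triangle_right b q o]
    nlinarith
  have hqp : dist q p ≤ 15 / 16 * r := by
    refine le_of_sq_le_sq ?_ (by positivity)
    rw [dist_quarter_sq]
    nlinarith [dist_nonneg (x := y₀) (y := p), dist_nonneg (x := y₁) (y := p)]
  have hqy : dist q y₁ ≤ r / 2 := by
    have h1 : q - y₁ = (1 / 4 : ℝ) • (y₀ - y₁) := by rw [hq]; abel
    rw [dist_eq_norm, h1, norm_smul, ← dist_eq_norm, Real.norm_of_nonneg (by norm_num)]
    linarith [dist_triangle_right y₀ y₁ p]
  exact ⟨by linarith [dist_triangle ((1 - s) • q + s • b) q p],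
    by linarith [dist_triangle ((1 - s) • q + s • b) q y₁]⟩

end Geometry

section Rips

variable {d m : ℕ}

theorem mem_ripsComplexE {x : Fin m → EuclideanSpace ℝ (Fin d)} {r : ℝ} {σ : Finset (Fin m)} :
    σ ∈ ripsComplexE x r ↔ σ.Nonempty ∧ ∀ i ∈ σ, ∀ j ∈ σ, dist (x i) (x j) ≤ r := by
  simp [ripsComplexE]

/-- The configurations `(y₀, …, y_{j+2})` in which `y₀` and `y₁` lie in `S` at distance more
than `r`, `y₁` is no closer to `o` than `y₀`, and all points are within `r` of `y₂`. -/
def obstructionSet (S : Set (EuclideanSpace ℝ (Fin d))) (o : EuclideanSpace ℝ (Fin d)) (r : ℝ)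
    (j : ℕ) : Set (Fin (j + 3) → EuclideanSpace ℝ (Fin d)) :=
  {y | y 0 ∈ S ∧ y 1 ∈ S ∧ dist (y 0) o ≤ dist (y 1) o ∧ r < dist (y 0) (y 1) ∧
    ∀ i, dist (y i) (y 2) ≤ r}

/-- The tuples of points that form an obstruction and leave their pocket empty. -/
def emptyPocketSet (S : Set (EuclideanSpace ℝ (Fin d))) (o : EuclideanSpace ℝ (Fin d)) (a r : ℝ)
    {j : ℕ} (e : Fin (j + 3) ↪ Fin m) : Set (Fin m → EuclideanSpace ℝ (Fin d)) :=
  {x | x ∘ e ∈ obstructionSet S o r j ∧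
    ∀ i ∉ Set.range e, x i ∉ Metric.ball (pocketCenter o r (x (e 0)) (x (e 1))) (a * r)}

theorem exists_embedding_of_isCriticalFace {S : Set (EuclideanSpace ℝ (Fin d))}
    {o : EuclideanSpace ℝ (Fin d)} {ρ R r : ℝ}
    (hρ : 0 < ρ) (hρR : ρ ≤ R) (hr : 0 ≤ r) (hR : ∀ y ∈ S, dist y o ≤ R)
    {x : Fin m → EuclideanSpace ℝ (Fin d)} (hx : ∀ i, x i ∈ S) {j : ℕ}
    (σ : Faces (ripsComplexE x r) (j + 1))
    (hσ : IsCriticalFace (ripsComplexE x r) (fun i => toLex (dist (x i) o, i)) σ.1) :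
    ∃ e : Fin (j + 3) ↪ Fin m, x ∈ emptyPocketSet S o (ρ / (32 * R)) r e ∧
      σ.1 = Finset.univ.image (fun i : Fin (j + 2) => e i.succ) := by
  classical
  obtain ⟨hlow, v, hv, hmin, w, hwv, hw⟩ := hσ
  have hc : (σ.1.erase v).card = j + 1 := by
    rw [Finset.card_erase_of_mem hv, σ.2.2]; omega
  have hwmin : ∀ u ∈ σ.1, toLex (dist (x w) o, w) < toLex (dist (x u) o, u) :=
    fun u hu => hwv.trans_le (hmin u hu)
  have hwσ : w ∉ σ.1 := fun h => lt_irrefl _ (hwmin w h)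
  have hdle : ∀ i j : Fin m, toLex (dist (x i) o, i) ≤ toLex (dist (x j) o, j) →
      dist (x i) o ≤ dist (x j) o := by
    intro i j hij
    rcases Prod.Lex.toLex_le_toLex.1 hij with h | h
    · exact h.le
    · exact h.1.le
  have hσd := (mem_ripsComplexE.1 σ.2.1).2
  have hwd := (mem_ripsComplexE.1 hw).2
  have hwd' : ∀ u ∈ σ.1, u ≠ v → dist (x w) (x u) ≤ r := fun u hu huv =>
    hwd w (Finset.mem_insert_self _ _) u
      (Finset.mem_insert_of_mem (Finset.mem_erase.2 ⟨huv, hu⟩))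
  have h01 : dist (x w) o ≤ dist (x v) o := hdle _ _ hwv.le
  have hnoext : ∀ i, (∀ u ∈ σ.1, toLex (dist (x i) o, i) < toLex (dist (x u) o, u)) →
      ¬ ∀ u ∈ σ.1, dist (x i) (x u) ≤ r := by
    intro i hi hd
    have : i ∈ lowerExtensions (ripsComplexE x r) (fun i => toLex (dist (x i) o, i)) σ.1 := by
      refine mem_lowerExtensions.2 ⟨hi, mem_ripsComplexE.2 ⟨Finset.insert_nonempty _ _, ?_⟩⟩
      intro a ha b hb
      rcases Finset.mem_insert.1 ha with ha | ha <;> rcases Finset.mem_insert.1 hb with hb | hb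
      · rw [ha, hb, dist_self]; exact hr
      · rw [ha]; exact hd b hb
      · rw [hb, dist_comm]; exact hd a ha
      · exact hσd a ha b hb
    rw [hlow] at this
    simp at this
  have hfar : r < dist (x w) (x v) := by
    by_contra hcon
    refine hnoext w hwmin fun u hu => ?_
    by_cases huv : u = v
    · rw [huv]; exact not_lt.1 hcon
    · exact hwd' u hu huv
  let g := (σ.1.erase v).orderEmbOfFin hc
  have hg : ∀ i, g i ≠ v ∧ g i ∈ σ.1 := fun i =>
    Finset.mem_erase.1 (Finset.orderEmbOfFin_mem (σ.1.erase v) hc i)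
  have hinj : Function.Injective (Fin.cons w (Fin.cons v g) : Fin (j + 3) → Fin m) := by
    refine Fin.cons_injective_iff.2 ⟨?_, Fin.cons_injective_iff.2 ⟨?_, g.injective⟩⟩
    · rintro ⟨i, hi⟩
      refine hwσ ?_
      rw [← hi]
      refine Fin.cases ?_ (fun i => ?_) i
      · exact hv
      · exact (hg i).2
    · rintro ⟨i, hi⟩
      exact (hg i).1 hi
  let e : Fin (j + 3) ↪ Fin m := ⟨Fin.cons w (Fin.cons v g), hinj⟩
  have he0 : e 0 = w := rfl
  have he1 : e 1 = v := rfl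
  have himg : σ.1 = Finset.univ.image (fun i : Fin (j + 2) => e i.succ) := by
    symm
    refine Finset.eq_of_subset_of_card_le ?_ ?_
    · intro a ha
      obtain ⟨i, -, rfl⟩ := Finset.mem_image.1 ha
      refine Fin.cases ?_ (fun i => ?_) i
      · exact hv
      · exact (hg i).2
    · have hsucc : Function.Injective (fun i : Fin (j + 2) => e i.succ) :=
        e.injective.comp (Fin.succ_injective _)
      rw [Finset.card_image_of_injective _ hsucc, σ.2.2]
      simp
  refine ⟨e, ⟨⟨hx _, hx _, h01, hfar, fun i => ?_⟩, fun i _ hi => ?_⟩, himg⟩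
  · change dist (x (e i)) (x (g 0)) ≤ r
    refine Fin.cases ?_ (fun i => ?_) i
    · exact hwd' _ (hg 0).2 (hg 0).1
    · exact hσd _ (by rw [himg]; exact Finset.mem_image_of_mem _ (Finset.mem_univ i)) _ (hg 0).2
  · rw [he0, he1] at hi
    have hlt := dist_lt_of_mem_pocket hρ hρR hr (hR _ (hx v)) h01 hfar hi
    refine hnoext i (fun u hu => ?_) fun u hu => ?_
    · exact Prod.Lex.toLex_lt_toLex.2 (Or.inl (hlt.trans_le (hdle _ _ (hmin u hu))))
    · by_cases huv : u = v
      · rw [huv]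
        exact (dist_le_of_mem_pocket hρ hρR hr (hR _ (hx v)) h01 hfar (hwd' _ (hg 0).2 (hg 0).1)
          (hσd _ hv _ (hg 0).2) hi).2
      · exact (dist_le_of_mem_pocket hρ hρR hr (hR _ (hx v)) h01 hfar (hwd' _ hu huv)
          (hσd _ hv _ hu) hi).1

open Classical in
theorem bettiNumber_ripsComplexE_le {S : Set (EuclideanSpace ℝ (Fin d))}
    {o : EuclideanSpace ℝ (Fin d)} {ρ R r : ℝ}
    (hρ : 0 < ρ) (hρR : ρ ≤ R) (hr : 0 ≤ r) (hR : ∀ y ∈ S, dist y o ≤ R)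
    {x : Fin m → EuclideanSpace ℝ (Fin d)} (hx : ∀ i, x i ∈ S) (j : ℕ) :
    (bettiNumber (ripsComplexE x r) (j + 1) : ℝ) ≤
      ∑ e : Fin (j + 3) ↪ Fin m, (emptyPocketSet S o (ρ / (32 * R)) r e).indicator (fun _ => (1 : ℝ)) x := by
  have hK : ∀ σ ∈ ripsComplexE x r, ∀ τ ⊆ σ, τ.Nonempty → τ ∈ ripsComplexE x r :=
    fun σ hσ τ hτ hne => mem_ripsComplexE.2 ⟨hne, fun i hi j hj =>
      (mem_ripsComplexE.1 hσ).2 i (hτ hi) j (hτ hj)⟩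
  have hinj : Function.Injective (fun i : Fin m => toLex (dist (x i) o, i)) := fun i j hij => by
    simpa using congrArg (fun p => (ofLex p).2) hij
  have h1 := bettiNumber_le_card_criticalFaces hK hinj j
  choose g hg using fun σ : {σ : Faces (ripsComplexE x r) (j + 1) //
    IsCriticalFace (ripsComplexE x r) (fun i => toLex (dist (x i) o, i)) σ.1} =>
      exists_embedding_of_isCriticalFace hρ hρR hr hR hx σ.1 σ.2
  have h2 : Fintype.card {σ : Faces (ripsComplexE x r) (j + 1) //
      IsCriticalFace (ripsComplexE x r) (fun i => toLex (dist (x i) o, i)) σ.1} ≤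
      Fintype.card {e : Fin (j + 3) ↪ Fin m // x ∈ emptyPocketSet S o (ρ / (32 * R)) r e} := by
    refine Fintype.card_le_of_injective (fun σ => ⟨g σ, (hg σ).1⟩) fun σ τ h => ?_
    have h' : g σ = g τ := congrArg Subtype.val h
    exact Subtype.ext (Subtype.ext (by rw [(hg σ).2, (hg τ).2, h']))
  have h3 : ∑ e : Fin (j + 3) ↪ Fin m,
      (emptyPocketSet S o (ρ / (32 * R)) r e).indicator (fun _ => (1 : ℝ)) x =
      Fintype.card {e : Fin (j + 3) ↪ Fin m // x ∈ emptyPocketSet S o (ρ / (32 * R)) r e} := by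
    simp only [Set.indicator_apply]
    rw [Finset.sum_boole, Fintype.card_subtype]
  rw [h3]
  exact_mod_cast h1.trans h2

end Rips

section PoissonBounds

open MeasureTheory

theorem pi_restrict_measure_le {ι E : Type*} [Fintype ι] [MeasurableSpace E] (μ : Measure E)
    [IsProbabilityMeasure μ] (p : ι → Prop) [DecidablePred p] {A : Set ({i // p i} → E)}
    (hA : MeasurableSet A) {G : Set (({i // p i} → E) × E)} (hG : MeasurableSet G)
    {q : ENNReal} (hq : ∀ y ∈ A, μ {z | (y, z) ∈ G} ≤ q) :
    Measure.pi (fun _ : ι => μ) {x | (fun i : {i // p i} => x i) ∈ A ∧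
        ∀ i, ¬ p i → ((fun i : {i // p i} => x i), x i) ∈ G} ≤
      Measure.pi (fun _ : {i // p i} => μ) A * q ^ Fintype.card {i // ¬ p i} := by
  let T : Set (({i // p i} → E) × ({i // ¬ p i} → E)) :=
    {w | w.1 ∈ A ∧ ∀ i, (w.1, w.2 i) ∈ G}
  have hT : MeasurableSet T := by
    have : T = Prod.fst ⁻¹' A ∩ ⋂ i, (fun w : ({i // p i} → E) × ({i // ¬ p i} → E) =>
        (w.1, w.2 i)) ⁻¹' G := by
      ext w; simp [T]
    rw [this]
    exact (measurable_fst hA).inter (MeasurableSet.iInter fun i =>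
      (measurable_fst.prodMk ((measurable_pi_apply i).comp measurable_snd)) hG)
  have hmp := measurePreserving_piEquivPiSubtypeProd (fun _ : ι => μ) p
  have hpre : {x | (fun i : {i // p i} => x i) ∈ A ∧
        ∀ i, ¬ p i → ((fun i : {i // p i} => x i), x i) ∈ G} =
      (MeasurableEquiv.piEquivPiSubtypeProd (fun _ : ι => E) p) ⁻¹' T := by
    ext x
    simp only [T, Set.mem_preimage, Set.mem_ofPred_eq, Subtype.forall]
    rfl
  rw [hpre, hmp.measure_preimage hT.nullMeasurableSet, Measure.prod_apply hT]
  have hle : ∀ y, Measure.pi (fun _ : {i // ¬ p i} => μ) (Prod.mk y ⁻¹' T) ≤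
      A.indicator (fun _ => q ^ Fintype.card {i // ¬ p i}) y := by
    intro y
    by_cases hy : y ∈ A
    · have : Prod.mk y ⁻¹' T = Set.univ.pi fun _ => {z | (y, z) ∈ G} := by
        ext w; simp [T, hy]
      rw [this, Measure.pi_pi, Set.indicator_of_mem hy]
      calc ∏ _i : {i // ¬ p i}, μ {z | (y, z) ∈ G} ≤ ∏ _i : {i // ¬ p i}, q :=
            Finset.prod_le_prod' fun _ _ => hq y hy
        _ = _ := by simp
    · have : Prod.mk y ⁻¹' T = ∅ := by
        ext w; simp [T, hy]
      rw [this, measure_empty]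
      exact zero_le
  refine (lintegral_mono hle).trans ?_
  rw [lintegral_indicator hA, setLIntegral_const, mul_comm]

variable {d : ℕ} {S : Set (EuclideanSpace ℝ (Fin d))}

theorem isProbabilityMeasure_uniformOn (hS : IsCompact S) (hSpos : 0 < volume S) :
    IsProbabilityMeasure (uniformOn S) := by
  refine ⟨?_⟩
  rw [uniformOn, Measure.smul_apply, Measure.restrict_apply_univ, smul_eq_mul,
    ENNReal.inv_mul_cancel hSpos.ne' hS.measure_lt_top.ne]

theorem volume_ball_eq_unitBallVol (y : EuclideanSpace ℝ (Fin d)) (hd : 1 ≤ d) {r : ℝ}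
    (hr : 0 ≤ r) : volume (Metric.ball y r) = ENNReal.ofReal (unitBallVol d * r ^ d) := by
  have : Nonempty (Fin d) := ⟨⟨0, hd⟩⟩
  rw [Measure.addHaar_ball volume y hr, unitBallVol, mul_comm,
    ENNReal.ofReal_mul ENNReal.toReal_nonneg, ENNReal.ofReal_toReal measure_ball_lt_top.ne]
  simp

theorem uniformOn_closedBall_le (hd : 1 ≤ d) (hS : IsCompact S) (hSpos : 0 < volume S)
    (y : EuclideanSpace ℝ (Fin d)) {r : ℝ} (hr : 0 ≤ r) :
    uniformOn S (Metric.closedBall y r) ≤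
      ENNReal.ofReal (unitBallVol d * r ^ d / (volume S).toReal) := by
  have hV : 0 < (volume S).toReal := ENNReal.toReal_pos hSpos.ne' hS.measure_lt_top.ne
  have : Nonempty (Fin d) := ⟨⟨0, hd⟩⟩
  rw [ENNReal.ofReal_div_of_pos hV, ENNReal.ofReal_toReal hS.measure_lt_top.ne,
    ← volume_ball_eq_unitBallVol y hd hr, uniformOn, Measure.smul_apply, smul_eq_mul,
    ENNReal.div_eq_inv_mul, ← Measure.addHaar_closedBall_eq_addHaar_ball]
  gcongr
  exact Measure.restrict_le_self

theorem uniformOn_compl_ball (hd : 1 ≤ d) (hS : IsCompact S) (hSpos : 0 < volume S)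
    {y : EuclideanSpace ℝ (Fin d)} {r : ℝ} (hr : 0 ≤ r) (hsub : Metric.ball y r ⊆ S) :
    unitBallVol d * r ^ d / (volume S).toReal ≤ 1 ∧
    uniformOn S (Metric.ball y r)ᶜ =
      ENNReal.ofReal (1 - unitBallVol d * r ^ d / (volume S).toReal) := by
  have := isProbabilityMeasure_uniformOn hS hSpos
  have hV : 0 < (volume S).toReal := ENNReal.toReal_pos hSpos.ne' hS.measure_lt_top.ne
  have hω : 0 ≤ unitBallVol d := ENNReal.toReal_nonneg
  have h1 : uniformOn S (Metric.ball y r) =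
      ENNReal.ofReal (unitBallVol d * r ^ d / (volume S).toReal) := by
    rw [ENNReal.ofReal_div_of_pos hV, ENNReal.ofReal_toReal hS.measure_lt_top.ne,
      ← volume_ball_eq_unitBallVol y hd hr, uniformOn, Measure.smul_apply, smul_eq_mul,
      ENNReal.div_eq_inv_mul, Measure.restrict_apply measurableSet_ball,
      Set.inter_eq_left.2 hsub]
  constructor
  · have h2 : uniformOn S (Metric.ball y r) ≤ 1 := prob_le_one
    rw [h1] at h2
    exact ENNReal.ofReal_le_one.1 h2
  · rw [prob_compl_eq_one_sub measurableSet_ball, h1, ENNReal.ofReal_sub _ (by positivity),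
      ENNReal.ofReal_one]

theorem ae_pi_uniformOn_mem (hS : IsCompact S) (hSpos : 0 < volume S) (m : ℕ) :
    ∀ᵐ x ∂(Measure.pi fun _ : Fin m => uniformOn S), ∀ i, x i ∈ S := by
  have := isProbabilityMeasure_uniformOn hS hSpos
  refine ae_all_iff.2 fun i => ?_
  have h1 : ∀ᵐ y ∂(uniformOn S), y ∈ S :=
    (Measure.ae_smul_measure (ae_restrict_mem hS.measurableSet) _)
  exact (Measure.tendsto_eval_ae_ae (μ := fun _ : Fin m => uniformOn S) (i := i)).eventually h1

theorem measurable_pocketCenter {α : Type*} [MeasurableSpace α] (o : EuclideanSpace ℝ (Fin d))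
    (r : ℝ) {f g : α → EuclideanSpace ℝ (Fin d)} (hf : Measurable f) (hg : Measurable g) :
    Measurable fun a => pocketCenter o r (f a) (g a) := by
  unfold pocketCenter
  have h1 : Measurable fun a => r / (32 * dist (g a) o) := by fun_prop
  exact ((measurable_const.sub h1).smul (by fun_prop)).add (h1.smul measurable_const)

theorem measurableSet_obstructionSet (hS : IsCompact S) (o : EuclideanSpace ℝ (Fin d)) (r : ℝ)
    (j : ℕ) : MeasurableSet (obstructionSet S o r j) := by
  have hm := hS.measurableSet
  have h : obstructionSet S o r j = (fun y => y 0) ⁻¹' S ∩ ((fun y => y 1) ⁻¹' S ∩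
      ({y | dist (y 0) o ≤ dist (y 1) o} ∩ ({y | r < dist (y 0) (y 1)} ∩
        ⋂ i, {y | dist (y i) (y 2) ≤ r}))) := by
    ext y; simp [obstructionSet]
  have hd : ∀ i l, Measurable fun y : Fin (j + 3) → EuclideanSpace ℝ (Fin d) =>
      dist (y i) (y l) := fun i l => (measurable_pi_apply i).dist (measurable_pi_apply l)
  have ho : ∀ i, Measurable fun y : Fin (j + 3) → EuclideanSpace ℝ (Fin d) =>
      dist (y i) o := fun i => (measurable_pi_apply i).dist measurable_const
  rw [h]
  exact ((measurable_pi_apply 0) hm).inter (((measurable_pi_apply 1) hm).inter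
    ((measurableSet_le (ho 0) (ho 1)).inter ((measurableSet_lt measurable_const (hd 0 1)).inter
      (MeasurableSet.iInter fun i => measurableSet_le (hd i 2) measurable_const))))

theorem measurableSet_emptyPocketSet (hS : IsCompact S) (o : EuclideanSpace ℝ (Fin d))
    (a r : ℝ) {j m : ℕ} (e : Fin (j + 3) ↪ Fin m) :
    MeasurableSet (emptyPocketSet S o a r e) := by
  have h : emptyPocketSet S o a r e = (fun x => x ∘ e) ⁻¹' obstructionSet S o r j ∩
      ⋂ i, ⋂ _ : i ∉ Set.range e,
        {x | dist (x i) (pocketCenter o r (x (e 0)) (x (e 1))) < a * r}ᶜ := by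
    ext x; simp [emptyPocketSet]
  have hcomp : Measurable fun x : Fin m → EuclideanSpace ℝ (Fin d) => x ∘ e :=
    measurable_pi_lambda _ fun i => measurable_pi_apply (e i)
  have hc : Measurable fun x : Fin m → EuclideanSpace ℝ (Fin d) =>
      pocketCenter o r (x (e 0)) (x (e 1)) :=
    measurable_pocketCenter o r (measurable_pi_apply (e 0)) (measurable_pi_apply (e 1))
  rw [h]
  exact (hcomp (measurableSet_obstructionSet hS o r j)).inter
    (MeasurableSet.iInter fun i => MeasurableSet.iInter fun _ =>
      (measurableSet_lt ((measurable_pi_apply i).dist hc) measurable_const).compl)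

/-- The probability that a given tuple of sample points is an obstruction with empty pocket. -/
theorem pi_emptyPocketSet_le (hd : 1 ≤ d) (hS : IsCompact S) (hSpos : 0 < volume S)
    (hconv : Convex ℝ S) {o : EuclideanSpace ℝ (Fin d)} {ρ R r : ℝ}
    (hρ : 0 < ρ) (hρR : ρ ≤ R) (hball : Metric.ball o ρ ⊆ S) (hr : 0 ≤ r)
    (hR : ∀ y ∈ S, dist y o ≤ R) {j m : ℕ} (e : Fin (j + 3) ↪ Fin m) :
    Measure.pi (fun _ : Fin m => uniformOn S) (emptyPocketSet S o (ρ / (32 * R)) r e) ≤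
        ENNReal.ofReal ((unitBallVol d * r ^ d / (volume S).toReal) ^ (j + 2) *
          (1 - unitBallVol d * (ρ / (32 * R) * r) ^ d / (volume S).toReal) ^ (m - (j + 3))) ∧
      (emptyPocketSet S o (ρ / (32 * R)) r e = ∅ ∨
        unitBallVol d * (ρ / (32 * R) * r) ^ d / (volume S).toReal ≤ 1) := by
  classical
  have := isProbabilityMeasure_uniformOn hS hSpos
  have hR0 : 0 < R := by linarith
  have hω : 0 ≤ unitBallVol d := ENNReal.toReal_nonneg
  have hpocket : ∀ y ∈ obstructionSet S o r j,
      unitBallVol d * (ρ / (32 * R) * r) ^ d / (volume S).toReal ≤ 1 ∧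
      uniformOn S (Metric.ball (pocketCenter o r (y 0) (y 1)) (ρ / (32 * R) * r))ᶜ =
        ENNReal.ofReal (1 - unitBallVol d * (ρ / (32 * R) * r) ^ d / (volume S).toReal) := by
    rintro y ⟨h0, h1, h01, hfar, -⟩
    exact uniformOn_compl_ball hd hS hSpos (by positivity)
      (pocket_subset hconv hρ hρR hball hr h0 h1 (hR _ h1) h01 hfar)
  rcases Set.eq_empty_or_nonempty (obstructionSet S o r j) with hemp | ⟨y, hy⟩
  · have : emptyPocketSet S o (ρ / (32 * R)) r e = ∅ := by
      ext x; simp [emptyPocketSet, hemp]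
    rw [this, measure_empty]
    exact ⟨zero_le, Or.inl rfl⟩
  refine ⟨?_, Or.inr (hpocket y hy).1⟩
  have hp := (hpocket y hy).1
  rw [ENNReal.ofReal_mul (by positivity), ENNReal.ofReal_pow (by positivity),
    ENNReal.ofReal_pow (by linarith)]
  let p : Fin m → Prop := fun i => i ∈ Set.range e
  let f : ({i // p i} → EuclideanSpace ℝ (Fin d)) → Fin (j + 3) → EuclideanSpace ℝ (Fin d) :=
    fun w i => w ⟨e i, i, rfl⟩
  have hf : Measurable f := measurable_pi_lambda _ fun i => measurable_pi_apply _
  let G : Set (({i // p i} → EuclideanSpace ℝ (Fin d)) × EuclideanSpace ℝ (Fin d)) :=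
    {w | dist w.2 (pocketCenter o r (f w.1 0) (f w.1 1)) < ρ / (32 * R) * r}ᶜ
  have hG : MeasurableSet G := by
    have hc : Measurable fun w : ({i // p i} → EuclideanSpace ℝ (Fin d)) ×
        EuclideanSpace ℝ (Fin d) => pocketCenter o r (f w.1 0) (f w.1 1) :=
      measurable_pocketCenter o r (measurable_pi_iff.1 (hf.comp measurable_fst) 0)
        (measurable_pi_iff.1 (hf.comp measurable_fst) 1)
    exact (measurableSet_lt (measurable_snd.dist hc) measurable_const).compl
  have h1 := pi_restrict_measure_le (uniformOn S) p (A := f ⁻¹' obstructionSet S o r j)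
    (hf (measurableSet_obstructionSet hS o r j)) hG
    (fun w hw => (hpocket (f w) hw).2.le)
  have hcard : ∀ _ : Fintype {i // p i}, Fintype.card {i // p i} = j + 3 := by
    intro _
    rw [← Fintype.card_congr (Equiv.ofInjective e e.injective), Fintype.card_fin]
  rw [Fintype.card_subtype_compl, hcard, Fintype.card_fin] at h1
  refine le_trans (measure_mono ?_) (h1.trans (mul_le_mul_left ?_ _))
  · rintro x ⟨hx, hx'⟩
    exact ⟨hx, fun i hi => hx' i hi⟩
  let _ : Fintype {i // p i} := Subtype.fintype p
  let c : {i // p i} := ⟨e 2, 2, rfl⟩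
  let p' : {i // p i} → Prop := fun i => i = c
  let G' : Set (({i // p' i} → EuclideanSpace ℝ (Fin d)) × EuclideanSpace ℝ (Fin d)) :=
    {w | dist w.2 (w.1 ⟨c, rfl⟩) ≤ r}
  have hG' : MeasurableSet G' := by
    exact measurableSet_le (measurable_snd.dist ((measurable_pi_apply _).comp measurable_fst))
      measurable_const
  have h2 := pi_restrict_measure_le (uniformOn S) p' MeasurableSet.univ hG'
    (fun w _ => uniformOn_closedBall_le hd hS hSpos (w ⟨c, rfl⟩) hr)
  have hcard' : Fintype.card {i // p' i} = 1 := Fintype.card_subtype_eq c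
  rw [Fintype.card_subtype_compl, hcard, hcard', measure_univ, one_mul] at h2
  refine le_trans (measure_mono ?_) h2
  rintro w ⟨-, -, -, -, hw⟩
  refine ⟨Set.mem_univ _, ?_⟩
  rintro ⟨_, i, rfl⟩ -
  exact hw i

end PoissonBounds

section PoissonSums

open MeasureTheory

variable {d : ℕ} {S : Set (EuclideanSpace ℝ (Fin d))}

theorem hasSum_poisson_descFactorial (n K : ℕ) (Q b : ℝ) :
    HasSum (fun m : ℕ => (Real.exp (-(n : ℝ)) * (n : ℝ) ^ m / Nat.factorial m) *
      ((m.descFactorial K : ℝ) * (Q * b ^ (m - K))))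
      ((n : ℝ) ^ K * Q * Real.exp (-(n * (1 - b)))) := by
  have hexp : HasSum (fun i : ℕ => (n * b : ℝ) ^ i / Nat.factorial i) (Real.exp (n * b)) := by
    rw [Real.exp_eq_exp_ℝ]
    exact NormedSpace.expSeries_div_hasSum_exp (n * b : ℝ)
  rw [← (add_left_injective K).hasSum_iff]
  · have h1 := hexp.mul_left ((n : ℝ) ^ K * Q * Real.exp (-(n : ℝ)))
    have h2 : (n : ℝ) ^ K * Q * Real.exp (-(n : ℝ)) * Real.exp (n * b) =
        (n : ℝ) ^ K * Q * Real.exp (-(n * (1 - b))) := by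
      rw [mul_assoc, ← Real.exp_add]; ring_nf
    rw [h2] at h1
    refine h1.congr_fun fun i => ?_
    have h3 : (Nat.factorial i : ℝ) * ((i + K).descFactorial K : ℝ) =
        (Nat.factorial (i + K) : ℝ) := by
      have := Nat.factorial_mul_descFactorial (Nat.le_add_left K i)
      rw [Nat.add_sub_cancel] at this
      exact_mod_cast this
    have h4 : (Nat.factorial i : ℝ) ≠ 0 := by positivity
    have h5 : (Nat.factorial (i + K) : ℝ) ≠ 0 := by positivity
    have h6 : ((i + K).descFactorial K : ℝ) = Nat.factorial (i + K) / Nat.factorial i := by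
      rw [← h3]; field_simp
    simp only [Function.comp, Nat.add_sub_cancel]
    rw [h6, mul_pow, pow_add]
    field_simp
  · intro m hm
    have : m < K := by
      by_contra hcon
      exact hm ⟨m - K, Nat.sub_add_cancel (not_lt.1 hcon)⟩
    rw [Nat.descFactorial_of_lt this]
    simp

theorem hasSum_poisson_weights (n : ℕ) :
    HasSum (fun m : ℕ => Real.exp (-(n : ℝ)) * (n : ℝ) ^ m / Nat.factorial m) 1 := by
  simpa using hasSum_poisson_descFactorial n 0 1 1

theorem poissonExpOn_le {n : ℕ}
    {f g : ∀ m : ℕ, (Fin m → EuclideanSpace ℝ (Fin d)) → ℝ} {B : ℕ → ℝ} {s : ℝ}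
    (hf : ∀ m x, 0 ≤ f m x)
    (hg : ∀ m, Integrable (g m) (Measure.pi fun _ : Fin m => uniformOn S))
    (hfg : ∀ m, ∀ᵐ x ∂(Measure.pi fun _ : Fin m => uniformOn S), f m x ≤ g m x)
    (hB : ∀ m, ∫ x, g m x ∂(Measure.pi fun _ : Fin m => uniformOn S) ≤ B m)
    (hs : HasSum (fun m : ℕ => (Real.exp (-(n : ℝ)) * (n : ℝ) ^ m / Nat.factorial m) * B m) s) :
    poissonExpOn S n f ≤ s := by
  have hle : ∀ m : ℕ, (Real.exp (-(n : ℝ)) * (n : ℝ) ^ m / Nat.factorial m) *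
      ∫ x, f m x ∂(Measure.pi fun _ : Fin m => uniformOn S) ≤
      (Real.exp (-(n : ℝ)) * (n : ℝ) ^ m / Nat.factorial m) * B m := fun m =>
    mul_le_mul_of_nonneg_left ((integral_mono_of_nonneg (ae_of_all _ (hf m)) (hg m) (hfg m)).trans
      (hB m)) (by positivity)
  have hsum := Summable.of_nonneg_of_le
    (fun m => mul_nonneg (by positivity) (integral_nonneg (hf m))) hle hs.summable
  rw [poissonExpOn, ← hs.tsum_eq]
  exact hsum.tsum_le_tsum hle hs.summable

theorem poissonProbOn_eq_zero_mem_Icc (hS : IsCompact S) (hSpos : 0 < volume S) {n : ℕ}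
    {f : ∀ m : ℕ, (Fin m → EuclideanSpace ℝ (Fin d)) → ℕ}
    {g : ∀ m : ℕ, (Fin m → EuclideanSpace ℝ (Fin d)) → ℝ} {B : ℕ → ℝ} {s : ℝ}
    (hg0 : ∀ m x, 0 ≤ g m x)
    (hg : ∀ m, Integrable (g m) (Measure.pi fun _ : Fin m => uniformOn S))
    (hfg : ∀ m, ∀ᵐ x ∂(Measure.pi fun _ : Fin m => uniformOn S), (f m x : ℝ) ≤ g m x)
    (hB : ∀ m, ∫ x, g m x ∂(Measure.pi fun _ : Fin m => uniformOn S) ≤ B m)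
    (hs : HasSum (fun m : ℕ => (Real.exp (-(n : ℝ)) * (n : ℝ) ^ m / Nat.factorial m) * B m) s) :
    poissonProbOn S n (fun m x => f m x = 0) ∈ Set.Icc (1 - s) 1 := by
  have := isProbabilityMeasure_uniformOn hS hSpos
  have hle1 : ∀ m, (Real.exp (-(n : ℝ)) * (n : ℝ) ^ m / Nat.factorial m) *
      ((Measure.pi fun _ : Fin m => uniformOn S) {x | f m x = 0}).toReal ≤
      Real.exp (-(n : ℝ)) * (n : ℝ) ^ m / Nat.factorial m := fun m =>
    mul_le_of_le_one_right (by positivity) measureReal_le_one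
  have hge : ∀ m, 1 - B m ≤
      ((Measure.pi fun _ : Fin m => uniformOn S) {x | f m x = 0}).toReal := by
    intro m
    set μ := Measure.pi fun _ : Fin m => uniformOn S
    have h1 := mul_meas_ge_le_integral_of_nonneg (ae_of_all μ (hg0 m)) (hg m) 1
    have h2 : μ Set.univ ≤ μ ({x | f m x = 0} ∪ {x | 1 ≤ g m x}) := by
      refine measure_mono_ae ?_
      filter_upwards [hfg m] with x hx _
      by_cases h : f m x = 0
      · exact Or.inl h
      · exact Or.inr (le_trans (by exact_mod_cast Nat.one_le_iff_ne_zero.2 h) hx)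
    have h3 : μ.real Set.univ ≤ μ.real {x | f m x = 0} + μ.real {x | 1 ≤ g m x} :=
      (ENNReal.toReal_mono (measure_ne_top _ _) h2).trans (measureReal_union_le _ _)
    rw [probReal_univ] at h3
    have h4 : μ.real {x | f m x = 0} = (μ {x | f m x = 0}).toReal := rfl
    linarith [hB m]
  have hw := hasSum_poisson_weights n
  have hsum := Summable.of_nonneg_of_le (fun m => by positivity) hle1 hw.summable
  constructor
  · rw [poissonProbOn, ← (hw.sub hs).tsum_eq]
    refine (hw.sub hs).summable.tsum_le_tsum (fun m => ?_) hsum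
    rw [← mul_one_sub]
    exact mul_le_mul_of_nonneg_left (hge m) (by positivity)
  · rw [poissonProbOn, ← hw.tsum_eq]
    exact hsum.tsum_le_tsum hle1 hw.summable

open Classical in
theorem integral_sum_emptyPocketSet_le (hd : 1 ≤ d) (hS : IsCompact S) (hSpos : 0 < volume S)
    (hconv : Convex ℝ S) {o : EuclideanSpace ℝ (Fin d)} {ρ R r : ℝ}
    (hρ : 0 < ρ) (hρR : ρ ≤ R) (hball : Metric.ball o ρ ⊆ S) (hr : 0 ≤ r)
    (hR : ∀ y ∈ S, dist y o ≤ R) (j m : ℕ) :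
    Integrable (fun x => ∑ e : Fin (j + 3) ↪ Fin m,
        (emptyPocketSet S o (ρ / (32 * R)) r e).indicator (fun _ => (1 : ℝ)) x)
      (Measure.pi fun _ : Fin m => uniformOn S) ∧
    ∫ x, ∑ e : Fin (j + 3) ↪ Fin m,
        (emptyPocketSet S o (ρ / (32 * R)) r e).indicator (fun _ => (1 : ℝ)) x
      ∂(Measure.pi fun _ : Fin m => uniformOn S) ≤
    (m.descFactorial (j + 3) : ℝ) *
      ((if unitBallVol d * (ρ / (32 * R) * r) ^ d / (volume S).toReal ≤ 1 then
          (unitBallVol d * r ^ d / (volume S).toReal) ^ (j + 2) else 0) *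
        (1 - unitBallVol d * (ρ / (32 * R) * r) ^ d / (volume S).toReal) ^ (m - (j + 3))) := by
  have := isProbabilityMeasure_uniformOn hS hSpos
  have hω : 0 ≤ unitBallVol d := ENNReal.toReal_nonneg
  have hint : ∀ e : Fin (j + 3) ↪ Fin m, Integrable
      ((emptyPocketSet S o (ρ / (32 * R)) r e).indicator (fun _ => (1 : ℝ)))
      (Measure.pi fun _ : Fin m => uniformOn S) := fun e =>
    (integrable_const 1).indicator (measurableSet_emptyPocketSet hS o _ r e)
  refine ⟨integrable_finsetSum _ fun e _ => hint e, ?_⟩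
  rw [integral_finsetSum _ fun e _ => hint e]
  have hcard : Fintype.card (Fin (j + 3) ↪ Fin m) = m.descFactorial (j + 3) := by
    rw [Fintype.card_embedding_eq, Fintype.card_fin, Fintype.card_fin]
  rw [← hcard, ← nsmul_eq_mul]
  refine Finset.sum_le_card_nsmul _ _ _ fun e _ => ?_
  obtain ⟨h1, h2⟩ := pi_emptyPocketSet_le hd hS hSpos hconv hρ hρR hball hr hR e
  rw [integral_indicator (measurableSet_emptyPocketSet hS o _ r e), setIntegral_const,
    smul_eq_mul, mul_one]
  split_ifs with hp
  · exact ENNReal.toReal_le_of_le_ofReal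
      (mul_nonneg (by positivity) (pow_nonneg (by linarith) _)) h1
  · rw [h2.resolve_right hp]
    simp

end PoissonSums

theorem Convex.exists_ball_subset_of_volume_pos {d : ℕ} {S : Set (EuclideanSpace ℝ (Fin d))}
    (hconv : Convex ℝ S) (hpos : 0 < MeasureTheory.volume S) :
    ∃ o : EuclideanSpace ℝ (Fin d), ∃ ρ : ℝ, 0 < ρ ∧ Metric.ball o ρ ⊆ S := by
  by_contra! hcon
  have hint : interior S = ∅ := by
    ext o
    simp only [Set.mem_empty_iff_false, iff_false]
    intro ho
    obtain ⟨ρ, hρ, hsub⟩ := Metric.mem_nhds_iff.1 (mem_interior_iff_mem_nhds.1 ho)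
    exact hcon o ρ hρ hsub
  have h1 : S ⊆ frontier S := by
    rw [frontier, hint, Set.sdiff_empty]; exact subset_closure
  exact hpos.ne' (MeasureTheory.measure_mono_null h1 (hconv.addHaar_frontier _))

theorem poisson_bound_le {ω V a r : ℝ} (hω : 0 ≤ ω) (hV : 0 < V) (ha : 0 < a) (hr : 0 ≤ r)
    (n d j : ℕ) :
    (n : ℝ) ^ (j + 3) * (ω * r ^ d / V) ^ (j + 2) *
        Real.exp (-(n * (1 - (1 - ω * (a * r) ^ d / V)))) ≤
      ((1 / V) ^ (j + 2) / (a ^ d / (2 * V))) * n * (ω * n * r ^ d) ^ (j + 1) *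
        Real.exp (-(a ^ d / (2 * V)) * (ω * n * r ^ d)) := by
  set c := a ^ d / (2 * V) with hc
  set L := ω * n * r ^ d with hL
  have hc0 : 0 < c := by positivity
  have hL0 : 0 ≤ L := by positivity
  have h1 : (n : ℝ) * (1 - (1 - ω * (a * r) ^ d / V)) = c * L + c * L := by
    rw [hc, hL, mul_pow]; field_simp; ring
  have h2 : (n : ℝ) ^ (j + 3) * (ω * r ^ d / V) ^ (j + 2) =
      n * (1 / V) ^ (j + 2) * L ^ (j + 1) * L := by
    have : L * (1 / V) = n * (ω * r ^ d / V) := by rw [hL]; field_simp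
    calc (n : ℝ) ^ (j + 3) * (ω * r ^ d / V) ^ (j + 2)
        = n * (n * (ω * r ^ d / V)) ^ (j + 2) := by rw [mul_pow]; ring
      _ = _ := by rw [← this, mul_pow]; ring
  have h3 : L * Real.exp (-(c * L)) ≤ 1 / c := by
    rw [le_div_iff₀ hc0, Real.exp_neg, ← div_eq_mul_inv, div_mul_eq_mul_div,
      div_le_one (Real.exp_pos _)]
    linarith [Real.add_one_le_exp (c * L)]
  rw [h1, h2, neg_add, Real.exp_add, neg_mul]
  calc (n : ℝ) * (1 / V) ^ (j + 2) * L ^ (j + 1) * L *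
        (Real.exp (-(c * L)) * Real.exp (-(c * L)))
      = (n : ℝ) * (1 / V) ^ (j + 2) * L ^ (j + 1) * Real.exp (-(c * L)) *
        (L * Real.exp (-(c * L))) := by ring
    _ ≤ (n : ℝ) * (1 / V) ^ (j + 2) * L ^ (j + 1) * Real.exp (-(c * L)) * (1 / c) :=
        mul_le_mul_of_nonneg_left h3 (by positivity)
    _ = _ := by ring

theorem tendsto_mul_log_pow_mul_exp {C c ε : ℝ} (hε : 0 < ε) (k : ℕ) (hc : 0 < c) :
    Tendsto (fun n : ℕ => C * n * ((1 + ε) / c * Real.log n) ^ k *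
      Real.exp (-c * ((1 + ε) / c * Real.log n))) atTop (nhds 0) := by
  have h1 : Tendsto (fun n : ℕ => ε * Real.log n) atTop atTop :=
    (Real.tendsto_log_atTop.comp tendsto_natCast_atTop_atTop).const_mul_atTop hε
  have h2 := ((Real.tendsto_pow_mul_exp_neg_atTop_nhds_zero k).comp h1).const_mul
    (C * ((1 + ε) / (c * ε)) ^ k)
  rw [mul_zero] at h2
  refine h2.congr' ?_
  filter_upwards [eventually_ge_atTop 1] with n hn
  have hn0 : (0 : ℝ) < n := by exact_mod_cast hn
  have h3 : -c * ((1 + ε) / c * Real.log n) = -(ε * Real.log n) - Real.log n := by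
    field_simp; ring
  rw [h3, Real.exp_sub, Real.exp_log hn0]
  have h4 : (1 + ε) / c * Real.log n = ((1 + ε) / (c * ε)) * (ε * Real.log n) := by
    field_simp
  rw [h4, mul_pow]
  simp only [Function.comp]
  field_simp

theorem rips_expected_betti_decay (d k : ℕ) (hd : 1 ≤ d) (hk : 1 ≤ k)
    (S : Set (EuclideanSpace ℝ (Fin d))) (hScompact : IsCompact S) (hSconvex : Convex ℝ S)
    (hSpos : 0 < MeasureTheory.volume S) :
    ∃ c : ℝ, 0 < c ∧
      (∃ C : ℝ, 0 < C ∧ ∀ r : ℕ → ℝ, (∀ n, 0 ≤ r n) →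
        ∀ᶠ n : ℕ in atTop,
          poissonExpOn S n (fun m x => (bettiNumber (ripsComplexE x (r n)) k : ℝ)) ≤
            C * n * (unitBallVol d * n * r n ^ d) ^ k *
              Real.exp (-c * (unitBallVol d * n * r n ^ d))) ∧
      (∀ ε : ℝ, 0 < ε → ∀ r : ℕ → ℝ, (∀ n, 0 ≤ r n) →
        (∀ n : ℕ, unitBallVol d * n * r n ^ d = ((1 + ε) / c) * Real.log n) →
        Tendsto (fun n => poissonProbOn S n
            (fun m x => bettiNumber (ripsComplexE x (r n)) k = 0)) atTop (nhds 1)) := by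
  obtain ⟨o, ρ, hρ, hball⟩ := hSconvex.exists_ball_subset_of_volume_pos hSpos
  obtain ⟨R₀, hR₀⟩ := hScompact.isBounded.subset_closedBall o
  obtain ⟨R, hρR, hR⟩ : ∃ R, ρ ≤ R ∧ ∀ y ∈ S, dist y o ≤ R :=
    ⟨max ρ R₀, le_max_left _ _, fun y hy => (hR₀ hy).trans (le_max_right _ _)⟩
  obtain ⟨j, rfl⟩ : ∃ j, k = j + 1 := ⟨k - 1, by omega⟩
  have hR0 : 0 < R := hρ.trans_le hρR
  have hV : 0 < (MeasureTheory.volume S).toReal :=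
    ENNReal.toReal_pos hSpos.ne' hScompact.measure_lt_top.ne
  have hω : 0 ≤ unitBallVol d := ENNReal.toReal_nonneg
  set V := (MeasureTheory.volume S).toReal with hVdef
  have ha : 0 < ρ / (32 * R) := by positivity
  set a := ρ / (32 * R) with hadef
  have hc : 0 < a ^ d / (2 * V) := by positivity
  set C := (1 / V) ^ (j + 2) / (a ^ d / (2 * V)) with hC
  let Q : ℝ → ℝ := fun r =>
    if unitBallVol d * (a * r) ^ d / V ≤ 1 then (unitBallVol d * r ^ d / V) ^ (j + 2) else 0
  have hQ : ∀ r : ℝ, 0 ≤ r → ∀ n : ℕ, (n : ℝ) ^ (j + 3) * Q r *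
      Real.exp (-(n * (1 - (1 - unitBallVol d * (a * r) ^ d / V)))) ≤
      C * n * (unitBallVol d * n * r ^ d) ^ (j + 1) *
        Real.exp (-(a ^ d / (2 * V)) * (unitBallVol d * n * r ^ d)) := by
    intro r hr n
    refine le_trans ?_ (poisson_bound_le hω hV ha hr n d j)
    gcongr
    simp only [Q]
    split_ifs
    · exact le_rfl
    · positivity
  have hcount := fun (r : ℝ) (hr : 0 ≤ r) m => integral_sum_emptyPocketSet_le hd hScompact hSpos
    hSconvex hρ hρR hball hr hR j m
  have hbetti : ∀ r : ℝ, 0 ≤ r → ∀ m,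
      ∀ᵐ x ∂(MeasureTheory.Measure.pi fun _ : Fin m => uniformOn S),
        (bettiNumber (ripsComplexE x r) (j + 1) : ℝ) ≤
          ∑ e : Fin (j + 3) ↪ Fin m, (emptyPocketSet S o a r e).indicator (fun _ => (1 : ℝ)) x :=
    fun r hr m => (ae_pi_uniformOn_mem hScompact hSpos m).mono fun x hx =>
      bettiNumber_ripsComplexE_le hρ hρR hr hR hx j
  have hsum := fun (r : ℝ) (n : ℕ) => hasSum_poisson_descFactorial n (j + 3) (Q r)
    (1 - unitBallVol d * (a * r) ^ d / V)
  refine ⟨a ^ d / (2 * V), hc, ⟨C, by positivity, fun r hr => Eventually.of_forall fun n => ?_⟩,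
    fun ε hε r hr hΛ => ?_⟩
  · refine le_trans ?_ (hQ (r n) (hr n) n)
    exact poissonExpOn_le (fun m x => Nat.cast_nonneg _) (fun m => (hcount _ (hr n) m).1)
      (hbetti _ (hr n)) (fun m => (hcount _ (hr n) m).2) (hsum _ n)
  · have hmem := fun n => poissonProbOn_eq_zero_mem_Icc hScompact hSpos
      (fun m x => Finset.sum_nonneg fun e _ => Set.indicator_nonneg (fun _ _ => zero_le_one) x)
      (fun m => (hcount _ (hr n) m).1) (hbetti _ (hr n)) (fun m => (hcount _ (hr n) m).2)
      (hsum _ n)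
    have hlim := (tendsto_mul_log_pow_mul_exp (C := C) hε (j + 1) hc).const_sub 1
    rw [sub_zero] at hlim
    refine tendsto_of_tendsto_of_tendsto_of_le_of_le hlim tendsto_const_nhds
      (fun n => ?_) (fun n => (hmem n).2)
    refine le_trans ?_ (hmem n).1
    have := hQ (r n) (hr n) n
    rw [hΛ n] at this
    exact sub_le_sub_left this 1
end

section
/- Fix k ≥ 1 and let X ~ X(n,p) be the random flag complex with n^{−1/k} ≪ p ≪ n^{−1/(k+1)} (i.e., p n^{1/k} → ∞ and p n^{1/(k+1)} → 0). Then (β_k(X) − E[β_k(X)]) / √(Var(β_k(X))) converges in distribution, as n → ∞, to a standard normal random variable N(0,1). -/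
/-!
STATEMENT 18: Central limit theorem for the Betti number `β_k` of the random flag complex
`X(n,p)` in the regime `n^{-1/k} ≪ p ≪ n^{-1/(k+1)}`.
-/

open Filter

/-- The probability, under the Erdős–Rényi measure `G(n,p)` (each of the `n.choose 2`
possible edges present independently with probability `p`), of the event `A`. -/
noncomputable def erProb (n : ℕ) (p : ℝ) (A : SimpleGraph (Fin n) → Prop) : ℝ := by
  classical
  exact ∑ G : SimpleGraph (Fin n),
    if A G then p ^ G.edgeSet.ncard * (1 - p) ^ (n.choose 2 - G.edgeSet.ncard) else 0

/-- The expectation, under the Erdős–Rényi measure `G(n,p)`, of the functional `f`. -/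
noncomputable def erExp (n : ℕ) (p : ℝ) (f : SimpleGraph (Fin n) → ℝ) : ℝ := by
  classical
  exact ∑ G : SimpleGraph (Fin n),
    f G * (p ^ G.edgeSet.ncard * (1 - p) ^ (n.choose 2 - G.edgeSet.ncard))

/-- The flag (clique) complex of a graph: its faces are the nonempty cliques. -/
noncomputable def flagComplex {n : ℕ} (G : SimpleGraph (Fin n)) : Finset (Finset (Fin n)) := by
  classical
  exact (Finset.univ : Finset (Fin n)).powerset.filter
    (fun σ => σ.Nonempty ∧ G.IsClique (σ : Set (Fin n)))

/-- The cumulative distribution function of the standard normal distribution `N(0,1)`. -/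
noncomputable def stdNormalCDF (t : ℝ) : ℝ :=
  (∫ x in Set.Iic t, Real.exp (-(x ^ 2) / 2)) / Real.sqrt (2 * Real.pi)

section BernoulliExpectation

variable {α : Type*}

/-- The expectation of `f S`, where `S` is the random subset of `E` containing each element
independently with probability `p`. -/
noncomputable def bexp (p : ℝ) (E : Finset α) (f : Finset α → ℝ) : ℝ :=
  ∑ S ∈ E.powerset, f S * (p ^ S.card * (1 - p) ^ (E.card - S.card))

variable {p : ℝ} {E : Finset α} {f g : Finset α → ℝ}

theorem bexp_congr (h : ∀ S ⊆ E, f S = g S) : bexp p E f = bexp p E g :=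
  Finset.sum_congr rfl fun S hS => by rw [h S (Finset.mem_powerset.1 hS)]

theorem bexp_mono (h0 : 0 ≤ p) (h1 : p ≤ 1) (h : ∀ S ⊆ E, f S ≤ g S) :
    bexp p E f ≤ bexp p E g := by
  refine Finset.sum_le_sum fun S hS => mul_le_mul_of_nonneg_right (h S (Finset.mem_powerset.1 hS)) ?_
  have := sub_nonneg.2 h1
  positivity

theorem bexp_add : bexp p E (fun S => f S + g S) = bexp p E f + bexp p E g := by
  simp only [bexp, add_mul, Finset.sum_add_distrib]

theorem bexp_sub : bexp p E (fun S => f S - g S) = bexp p E f - bexp p E g := by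
  simp only [bexp, sub_mul, Finset.sum_sub_distrib]

theorem bexp_const_mul (c : ℝ) : bexp p E (fun S => c * f S) = c * bexp p E f := by
  simp only [bexp, mul_assoc, Finset.mul_sum]

theorem bexp_sum {ι : Type*} (s : Finset ι) (F : ι → Finset α → ℝ) :
    bexp p E (fun S => ∑ i ∈ s, F i S) = ∑ i ∈ s, bexp p E (F i) := by
  simp only [bexp, Finset.sum_mul]
  exact Finset.sum_comm

@[simp] theorem bexp_const (c : ℝ) : bexp p E (fun _ => c) = c := by
  simp only [bexp, ← Finset.mul_sum, Finset.sum_pow_mul_eq_add_pow]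
  simp

theorem bexp_nonneg (h0 : 0 ≤ p) (h1 : p ≤ 1) (h : ∀ S ⊆ E, 0 ≤ f S) : 0 ≤ bexp p E f := by
  simpa using bexp_mono (p := p) (E := E) (f := fun _ => 0) h0 h1 h

theorem bexp_sq_sub_const (c : ℝ) :
    bexp p E (fun S => (f S - c) ^ 2) =
      bexp p E (fun S => f S ^ 2) - 2 * c * bexp p E f + c ^ 2 := by
  have : (fun S => (f S - c) ^ 2) = fun S => (f S ^ 2 - (2 * c) * f S) + c ^ 2 := by
    funext S; ring
  rw [this, bexp_add, bexp_sub, bexp_const_mul, bexp_const]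

theorem bexp_sq_sub_mean :
    bexp p E (fun S => (f S - bexp p E f) ^ 2) =
      bexp p E (fun S => f S ^ 2) - bexp p E f ^ 2 := by
  rw [bexp_sq_sub_const]; ring

/-- A second moment bound for a nonnegative `D` dominated by a concentrated `F`. -/
theorem bexp_sq_le_of_le (h0 : 0 ≤ p) (h1 : p ≤ 1) {D F : Finset α → ℝ} {μ : ℝ}
    (hD : ∀ S ⊆ E, 0 ≤ D S) (hDF : ∀ S ⊆ E, D S ≤ F S) :
    bexp p E (fun S => D S ^ 2) ≤
      2 * μ * bexp p E D + 4 * bexp p E (fun S => (F S - μ) ^ 2) := by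
  rw [← bexp_const_mul, ← bexp_const_mul, ← bexp_add]
  refine bexp_mono h0 h1 fun S hS => ?_
  have a := hD S hS
  have b := hDF S hS
  by_cases hc : D S ≤ 2 * μ
  · nlinarith [sq_nonneg (F S - μ)]
  · push Not at hc
    nlinarith [sq_nonneg (F S - μ), sq_nonneg (D S - μ), mul_nonneg a (sub_nonneg.2 hc.le), mul_nonneg a (sub_nonneg.2 b)]

variable [DecidableEq α]

/-- The discrete derivative of `f` at `S` in the direction of the element `e`. -/
def ddiff (f : Finset α → ℝ) (e : α) (S : Finset α) : ℝ :=
  f (insert e S) - f (S.erase e)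

theorem bexp_insert {a : α} (ha : a ∉ E) :
    bexp p (insert a E) f = bexp p E (fun S => (1 - p) * f S + p * f (insert a S)) := by
  rw [bexp, Finset.sum_powerset_insert ha, bexp, ← Finset.sum_add_distrib]
  refine Finset.sum_congr rfl fun S hS => ?_
  have hS' := Finset.mem_powerset.1 hS
  have haS : a ∉ S := fun h => ha (hS' h)
  have hc := Finset.card_le_card hS'
  rw [Finset.card_insert_of_notMem ha, Finset.card_insert_of_notMem haS,
    show E.card + 1 - S.card = E.card - S.card + 1 by omega,
    show E.card + 1 - (S.card + 1) = E.card - S.card by omega]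
  ring

/-- The Efron–Stein inequality for functions of a Bernoulli random subset. -/
theorem bexp_sq_sub_sq_le (h0 : 0 ≤ p) (h1 : p ≤ 1) (E : Finset α) (f : Finset α → ℝ) :
    bexp p E (fun S => f S ^ 2) - bexp p E f ^ 2 ≤
      ∑ e ∈ E, p * (1 - p) * bexp p E (fun S => ddiff f e S ^ 2) := by
  induction E using Finset.induction_on generalizing f with
  | empty => simp [bexp]
  | insert a E ha ih =>
    have hq := sub_nonneg.2 h1
    have ih' := ih (fun S => (1 - p) * f S + p * f (insert a S))
    rw [Finset.sum_insert ha, bexp_insert ha, bexp_insert ha]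
    have key : bexp p E (fun S => (1 - p) * f S ^ 2 + p * f (insert a S) ^ 2) =
        bexp p E (fun S => ((1 - p) * f S + p * f (insert a S)) ^ 2) +
        p * (1 - p) * bexp p (insert a E) (fun S => ddiff f a S ^ 2) := by
      rw [bexp_insert ha, ← bexp_const_mul, ← bexp_add]
      refine bexp_congr fun S hS => ?_
      have haS : a ∉ S := fun h => ha (hS h)
      simp only [ddiff, Finset.insert_idem, Finset.erase_insert haS,
        Finset.erase_eq_of_notMem haS]
      ring
    have hle : ∀ e ∈ E, p * (1 - p) *
          bexp p E (fun S => ddiff (fun S => (1 - p) * f S + p * f (insert a S)) e S ^ 2) ≤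
        p * (1 - p) * bexp p (insert a E) (fun S => ddiff f e S ^ 2) := by
      intro e he
      refine mul_le_mul_of_nonneg_left ?_ (mul_nonneg h0 hq)
      rw [bexp_insert ha]
      refine bexp_mono h0 h1 fun S hS => ?_
      have hae : a ≠ e := fun h => ha (h ▸ he)
      simp only [ddiff]
      rw [Finset.insert_comm e a S, Finset.erase_insert_of_ne hae]
      nlinarith [mul_nonneg (mul_nonneg h0 hq)
        (sq_nonneg ((f (insert e S) - f (S.erase e)) -
          (f (insert a (insert e S)) - f (insert a (S.erase e)))))]
    have := Finset.sum_le_sum hle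
    linarith

/-- A Bernoulli random subset of `E` contains `A ⊆ E` with probability `p ^ #A`. -/
theorem bexp_indicator_subset (E A : Finset α) (h : A ⊆ E) :
    bexp p E (fun S => if A ⊆ S then 1 else 0) = p ^ A.card := by
  induction E using Finset.induction_on generalizing A with
  | empty => simp [bexp, Finset.subset_empty.1 h]
  | insert a E ha ih =>
    rw [bexp_insert ha]
    by_cases haA : a ∈ A
    · have hA' : A.erase a ⊆ E := Finset.subset_insert_iff.1 h
      rw [bexp_congr (g := fun S => p * if A.erase a ⊆ S then 1 else 0), bexp_const_mul, ih _ hA',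
        ← Finset.card_erase_add_one haA, pow_succ, mul_comm]
      intro S hS
      have : ¬ A ⊆ S := fun hh => ha (hS (hh haA))
      simp [this, Finset.subset_insert_iff]
    · have hA' : A ⊆ E := (Finset.subset_insert_iff_of_notMem haA).1 h
      rw [← ih A hA']
      refine bexp_congr fun S hS => ?_
      simp only [Finset.subset_insert_iff_of_notMem haA]
      ring

/-- The event `e ∈ S` is independent of functions that do not look at `e`. -/
theorem bexp_mem_mul {e : α} (he : e ∈ E) (hf : ∀ S, f (insert e S) = f S) :
    bexp p E (fun S => if e ∈ S then f S else 0) = p * bexp p E f := by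
  rw [← Finset.insert_erase he, bexp_insert (Finset.notMem_erase e E),
    bexp_insert (Finset.notMem_erase e E), ← bexp_const_mul]
  refine bexp_congr fun S hS => ?_
  have heS : e ∉ S := fun h => (Finset.mem_erase.1 (hS h)).1 rfl
  simp only [heS, if_false, Finset.mem_insert_self, if_true, hf]
  ring

theorem ddiff_insert (f : Finset α → ℝ) (e : α) (S : Finset α) :
    ddiff f e (insert e S) = ddiff f e S := by
  simp [ddiff, Finset.erase_insert_eq_erase]

end BernoulliExpectation

section BoundaryRank

variable {V : Type*} [Fintype V] [LinearOrder V]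

/-- The boundary of the simplex `σ`, as a chain on all finite vertex sets. -/
noncomputable def bdryCol (σ τ : Finset V) : ℚ :=
  if τ ⊆ σ ∧ τ.card + 1 = σ.card then
    ∑ v ∈ σ \ τ, (-1 : ℚ) ^ (σ.filter (fun u => u < v)).card
  else 0

/-- A family of finite sets closed under taking nonempty subsets. -/
def DownClosed (K : Finset (Finset V)) : Prop :=
  ∀ σ ∈ K, ∀ τ ⊆ σ, τ.Nonempty → τ ∈ K

variable {K : Finset (Finset V)}

theorem finrank_range_bdry (hK : DownClosed K) (k : ℕ) :
    Module.finrank ℚ (LinearMap.range (bdry ℚ K k)) =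
      Module.finrank ℚ (Submodule.span ℚ (bdryCol '' {σ | σ ∈ K ∧ σ.card = k + 2})) := by
  have hinj : Function.Injective
      (Function.ExtendByZero.linearMap ℚ (Subtype.val : Faces K k → Finset V)) :=
    Function.extend_injective Subtype.val_injective (0 : Finset V → ℚ)
  rw [(Submodule.equivMapOfInjective _ hinj (LinearMap.range (bdry ℚ K k))).finrank_eq, bdry, Matrix.range_mulVecLin,
    Submodule.map_span, ← Set.range_comp]
  have hcol : (⇑(Function.ExtendByZero.linearMap ℚ (Subtype.val : Faces K k → Finset V)) ∘
      (bdryMat ℚ K k).col) = fun σ : Faces K (k + 1) => bdryCol σ.1 := by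
    funext σ τ
    have hσ := σ.2.2
    simp only [Function.comp_apply, Function.ExtendByZero.linearMap_apply]
    by_cases hτ : τ ∈ K ∧ τ.card = k + 1
    · have := Subtype.val_injective.extend_apply ((bdryMat ℚ K k).col σ) 0 (⟨τ, hτ⟩ : Faces K k)
      refine this.trans ?_
      have hc : τ.card + 1 = σ.1.card := by omega
      simp [Matrix.col_apply, bdryMat, bdryCol, hc]
    · rw [Function.extend_apply', bdryCol, if_neg]
      · rfl
      · rintro ⟨h1, h2⟩
        have : τ.card = k + 1 := by omega
        exact hτ ⟨hK _ σ.2.1 _ h1 (Finset.card_pos.1 (by omega)), this⟩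
      · rintro ⟨x, rfl⟩
        exact hτ x.2
  have himg : Set.range (fun σ : Faces K (k + 1) => bdryCol σ.1) =
      bdryCol '' {σ | σ ∈ K ∧ σ.card = k + 2} := by
    ext x
    constructor
    · rintro ⟨σ, rfl⟩
      exact ⟨σ.1, ⟨σ.2.1, σ.2.2⟩, rfl⟩
    · rintro ⟨σ, hσ, rfl⟩
      exact ⟨⟨σ, hσ.1, hσ.2⟩, rfl⟩
  rw [hcol, himg]

theorem bdryMat_mul_bdryMat (hK : DownClosed K) (k : ℕ) :
    bdryMat ℚ K k * bdryMat ℚ K (k + 1) = 0 := by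
  ext ρ σ
  rw [Matrix.mul_apply, Matrix.zero_apply]
  have hρ := ρ.2.2
  have hσ := σ.2.2
  by_cases hs : ρ.1 ⊆ σ.1
  swap
  · refine Finset.sum_eq_zero fun τ _ => ?_
    by_cases h1 : ρ.1 ⊆ τ.1
    · have : ¬ τ.1 ⊆ σ.1 := fun h => hs (h1.trans h)
      simp [bdryMat, this]
    · simp [bdryMat, h1]
  have hc : (σ.1 \ ρ.1).card = 2 := by rw [Finset.card_sdiff_of_subset hs]; omega
  obtain ⟨a, b, hab, hd⟩ : ∃ a b, a < b ∧ σ.1 \ ρ.1 = {a, b} := by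
    obtain ⟨a, b, hne, h⟩ := Finset.card_eq_two.1 hc
    rcases lt_or_gt_of_ne hne with h' | h'
    · exact ⟨a, b, h', h⟩
    · exact ⟨b, a, h', by rw [h, Finset.pair_comm]⟩
  have ha : a ∈ σ.1 ∧ a ∉ ρ.1 := by simpa using (Finset.ext_iff.1 hd a).2 (by simp)
  have hb : b ∈ σ.1 ∧ b ∉ ρ.1 := by simpa using (Finset.ext_iff.1 hd b).2 (by simp)
  have hmem : ∀ x, x ∈ σ.1 ↔ x ∈ ρ.1 ∨ x = a ∨ x = b := by
    intro x
    have := Finset.ext_iff.1 hd x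
    simp only [Finset.mem_sdiff, Finset.mem_insert, Finset.mem_singleton] at this
    constructor
    · intro h
      by_cases hx : x ∈ ρ.1
      · exact .inl hx
      · exact .inr (this.1 ⟨h, hx⟩)
    · rintro (h | rfl | rfl)
      exacts [hs h, ha.1, hb.1]
  have hface : ∀ x, x ∈ σ.1 → x ∉ ρ.1 → (insert x ρ.1 ∈ K ∧ (insert x ρ.1).card = k + 1 + 1) := by
    intro x hx hx'
    refine ⟨hK _ σ.2.1 _ (Finset.insert_subset hx hs) (Finset.insert_nonempty _ _), ?_⟩
    rw [Finset.card_insert_of_notMem hx', hρ]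
  let τa : Faces K (k + 1) := ⟨insert a ρ.1, hface a ha.1 ha.2⟩
  let τb : Faces K (k + 1) := ⟨insert b ρ.1, hface b hb.1 hb.2⟩
  have hne : τa ≠ τb := by
    intro h
    have h1 : insert a ρ.1 = insert b ρ.1 := congrArg Subtype.val h
    have : a ∈ insert b ρ.1 := h1 ▸ Finset.mem_insert_self a ρ.1
    rcases Finset.mem_insert.1 this with h | h
    exacts [hab.ne h, ha.2 h]
  have hsd : ∀ x y, x ≠ y → x ∉ ρ.1 → y ∉ ρ.1 → σ.1 \ ρ.1 = {x, y} →
      σ.1 \ insert x ρ.1 = {y} := by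
    intro x y hxy hx hy h
    ext z
    have := Finset.ext_iff.1 h z
    simp only [Finset.mem_sdiff, Finset.mem_insert, Finset.mem_singleton] at this ⊢
    constructor
    · rintro ⟨h1, h2⟩
      push Not at h2
      exact (this.1 ⟨h1, h2.2⟩).resolve_left h2.1
    · rintro rfl
      exact ⟨(this.2 (.inr rfl)).1, by
        push Not
        exact ⟨fun h => hxy h.symm, hy⟩⟩
  have hsd' : ∀ x, x ∉ ρ.1 → insert x ρ.1 \ ρ.1 = {x} := by
    intro x hx
    ext z
    simp only [Finset.mem_sdiff, Finset.mem_insert, Finset.mem_singleton]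
    constructor
    · rintro ⟨h | h, h2⟩
      exacts [h, absurd h h2]
    · rintro rfl
      exact ⟨.inl rfl, hx⟩
  rw [← Finset.sum_subset (Finset.subset_univ {τa, τb}), Finset.sum_pair hne]
  · have e1 : (insert a ρ.1).filter (· < a) = ρ.1.filter (· < a) := by
      rw [Finset.filter_insert, if_neg (lt_irrefl a)]
    have e2 : (insert b ρ.1).filter (· < b) = ρ.1.filter (· < b) := by
      rw [Finset.filter_insert, if_neg (lt_irrefl b)]
    have hσe : σ.1 = insert a (insert b ρ.1) := by
      ext x; rw [hmem]; simp only [Finset.mem_insert]; tauto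
    have e3 : σ.1.filter (· < a) = ρ.1.filter (· < a) := by
      rw [hσe, Finset.filter_insert, if_neg (lt_irrefl a), Finset.filter_insert,
        if_neg hab.not_gt]
    have e4 : (σ.1.filter (· < b)).card = (ρ.1.filter (· < b)).card + 1 := by
      rw [hσe, Finset.filter_insert, if_pos hab, e2, Finset.card_insert_of_notMem]
      simp [ha.2]
    simp only [bdryMat, τa, τb, Finset.subset_insert, if_true,
      hsd' a ha.2, hsd' b hb.2,
      hsd a b hab.ne ha.2 hb.2 hd, hsd b a hab.ne' hb.2 ha.2 (hd.trans (Finset.pair_comm a b)),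
      Finset.sum_singleton, Finset.insert_subset ha.1 hs, Finset.insert_subset hb.1 hs,
      e1, e2, e3, e4]
    ring
  · intro τ _ hτ
    by_contra hne0
    have h1 : ρ.1 ⊆ τ.1 := by
      by_contra h; exact hne0 (by simp [bdryMat, h])
    have h2 : τ.1 ⊆ σ.1 := by
      by_contra h; exact hne0 (by simp [bdryMat, h])
    have hc1 : (τ.1 \ ρ.1).card = 1 := by
      rw [Finset.card_sdiff_of_subset h1, τ.2.2, hρ]; omega
    obtain ⟨x, hx⟩ := Finset.card_eq_one.1 hc1
    have hx' : x ∈ τ.1 ∧ x ∉ ρ.1 := by simpa using (Finset.ext_iff.1 hx x).2 (by simp)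
    have hτx : τ.1 = insert x ρ.1 := by
      rw [← Finset.sdiff_union_of_subset h1, hx]; rfl
    apply hτ
    rcases (hmem x).1 (h2 hx'.1) with h | rfl | rfl
    · exact absurd h hx'.2
    · exact Finset.mem_insert.2 (.inl (Subtype.ext hτx))
    · exact Finset.mem_insert.2 (.inr (Finset.mem_singleton.2 (Subtype.ext hτx)))

theorem bettiNumber_succ_add (hK : DownClosed K) (k : ℕ) :
    bettiNumber K (k + 1) + Module.finrank ℚ (LinearMap.range (bdry ℚ K k)) +
      Module.finrank ℚ (LinearMap.range (bdry ℚ K (k + 1))) =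
      Fintype.card (Faces K (k + 1)) := by
  have hle : LinearMap.range (bdry ℚ K (k + 1)) ≤ cycleSubmodule ℚ K (k + 1) := by
    rintro _ ⟨x, rfl⟩
    change bdry ℚ K k (bdry ℚ K (k + 1) x) = 0
    simp only [bdry, Matrix.mulVecLin_apply, Matrix.mulVec_mulVec, bdryMat_mul_bdryMat hK,
      Matrix.zero_mulVec]
  have h1 := Submodule.finrank_quotient_add_finrank
    (Submodule.comap (cycleSubmodule ℚ K (k + 1)).subtype (LinearMap.range (bdry ℚ K (k + 1))))
  rw [(Submodule.comapSubtypeEquivOfLe hle).finrank_eq] at h1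
  have h2 := LinearMap.finrank_range_add_finrank_ker (bdry ℚ K k)
  rw [Module.finrank_fintype_fun_eq_card] at h2
  change bettiNumber K (k + 1) + _ = Module.finrank ℚ (LinearMap.ker (bdry ℚ K k)) at h1
  omega

theorem finrank_range_bdry_le (k : ℕ) :
    Module.finrank ℚ (LinearMap.range (bdry ℚ K k)) ≤ Fintype.card (Faces K k) :=
  (bdryMat ℚ K k).rank_le_card_height

end BoundaryRank

section SpanRank

variable {ι M : Type*} [AddCommGroup M] [Module ℚ M] (c : ι → M)

/-- The rank of the finite family of vectors `c i`, `i ∈ A`. -/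
noncomputable def spanRank (A : Finset ι) : ℕ :=
  Module.finrank ℚ (Submodule.span ℚ (c '' (A : Set ι)))

theorem spanRank_mono {A B : Finset ι} (h : A ⊆ B) : spanRank c A ≤ spanRank c B := by
  have : Module.Finite ℚ (Submodule.span ℚ (c '' (B : Set ι))) :=
    Module.Finite.span_of_finite ℚ ((B.finite_toSet).image c)
  exact Submodule.finrank_mono (Submodule.span_mono (Set.image_mono (by exact_mod_cast h)))

variable [DecidableEq ι]

theorem spanRank_le_add_card {A B : Finset ι} (h : A ⊆ B) :
    spanRank c B ≤ spanRank c A + (B \ A).card := by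
  have hB : (B : Set ι) = (A : Set ι) ∪ ((B \ A : Finset ι) : Set ι) := by
    rw [← Finset.coe_union, Finset.union_sdiff_of_subset h]
  have f1 : Module.Finite ℚ (Submodule.span ℚ (c '' (A : Set ι))) :=
    Module.Finite.span_of_finite ℚ ((A.finite_toSet).image c)
  have f2 : Module.Finite ℚ (Submodule.span ℚ (c '' ((B \ A : Finset ι) : Set ι))) :=
    Module.Finite.span_of_finite ℚ ((Finset.finite_toSet _).image c)
  classical
  rw [spanRank, hB, Set.image_union, Submodule.span_union]
  refine (Submodule.finrank_add_le_finrank_add_finrank _ _).trans (Nat.add_le_add_left ?_ _)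
  have := finrank_span_finset_le_card (R := ℚ) ((B \ A).image c)
  rw [Finset.coe_image] at this
  exact this.trans Finset.card_image_le

/-- There is a subfamily `T` of size the rank, each part of which bounds ranks from below. -/
theorem exists_basis_subset (A : Finset ι) :
    ∃ T ⊆ A, T.card = spanRank c A ∧ ∀ B ⊆ A, (T ∩ B).card ≤ spanRank c B := by
  obtain ⟨b, hbA, -, hspan, hli⟩ := exists_linearIndepOn_extension (K := ℚ) (v := c)
    (linearIndepOn_empty ℚ c) (Set.empty_subset (A : Set ι))
  have hfin : b.Finite := A.finite_toSet.subset hbA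
  have hcard : ∀ T : Finset ι, (T : Set ι) ⊆ b →
      Module.finrank ℚ (Submodule.span ℚ (c '' (T : Set ι))) = T.card := by
    intro T hT
    have h := hli.mono hT
    have := finrank_span_eq_card (R := ℚ) h
    rw [← Set.image_eq_range] at this
    exact this.trans (Fintype.card_coe T)
  refine ⟨hfin.toFinset, ?_, ?_, ?_⟩
  · intro x hx
    exact_mod_cast hbA ((Set.Finite.mem_toFinset hfin).1 hx)
  · rw [← hcard _ (by simp), spanRank]
    rw [Set.Finite.coe_toFinset, le_antisymm (Submodule.span_mono (Set.image_mono hbA)) (Submodule.span_le.2 hspan)]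
  · intro B hB
    rw [← hcard _ (by rw [Finset.coe_inter]; simp)]
    exact spanRank_mono c Finset.inter_subset_right

end SpanRank

section CliqueFamilies

variable {V : Type*} [LinearOrder V]

/-- The edges of the complete graph on `K`. -/
def cliqueEdges (K : Finset V) : Finset (Sym2 V) := K.sym2.filter fun e => ¬ e.IsDiag

theorem mem_cliqueEdges {K : Finset V} {e : Sym2 V} :
    e ∈ cliqueEdges K ↔ (∀ v ∈ e, v ∈ K) ∧ ¬ e.IsDiag := by
  simp [cliqueEdges, Finset.mem_sym2_iff]

theorem card_cliqueEdges (K : Finset V) : (cliqueEdges K).card = K.card.choose 2 := by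
  rw [← Sym2.card_image_offDiag]
  congr 1
  ext e
  induction e with
  | _ a b =>
    simp only [mem_cliqueEdges, Sym2.mem_iff, Finset.mem_image, Finset.mem_offDiag, Prod.exists,
      Sym2.mk_isDiag_iff]
    constructor
    · rintro ⟨h, hne⟩
      exact ⟨a, b, ⟨h a (.inl rfl), h b (.inr rfl), hne⟩, rfl⟩
    · rintro ⟨c, d, ⟨hc, hd, hne⟩, h⟩
      rcases Sym2.eq_iff.1 h with ⟨rfl, rfl⟩ | ⟨rfl, rfl⟩
      · exact ⟨by rintro v (rfl | rfl) <;> assumption, hne⟩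
      · exact ⟨by rintro v (rfl | rfl) <;> assumption, hne.symm⟩

theorem cliqueEdges_mono {K L : Finset V} (h : K ⊆ L) : cliqueEdges K ⊆ cliqueEdges L := by
  intro e he
  rw [mem_cliqueEdges] at he ⊢
  exact ⟨fun v hv => h (he.1 v hv), he.2⟩

theorem cliqueEdges_inter (K L : Finset V) :
    cliqueEdges K ∩ cliqueEdges L = cliqueEdges (K ∩ L) := by
  ext e
  simp only [Finset.mem_inter, mem_cliqueEdges]
  exact ⟨fun h => ⟨fun v hv => ⟨h.1.1 v hv, h.2.1 v hv⟩, h.1.2⟩,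
    fun h => ⟨⟨fun v hv => (h.1 v hv).1, h.2⟩, fun v hv => (h.1 v hv).2, h.2⟩⟩

theorem erase_subset_insert_self (e : Sym2 V) (S : Finset (Sym2 V)) : S.erase e ⊆ insert e S :=
  (Finset.erase_subset e S).trans (Finset.subset_insert e S)

variable [Fintype V]

/-- The `j`-element vertex sets spanning a clique in the graph with edge set `S`. -/
def cliqueSets (j : ℕ) (S : Finset (Sym2 V)) : Finset (Finset V) :=
  (Finset.univ.powersetCard j).filter fun K => cliqueEdges K ⊆ S

/-- The `j`-element vertex sets that contain both ends of `e`. -/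
def setsThrough (V : Type*) [Fintype V] [LinearOrder V] (j : ℕ) (e : Sym2 V) :
    Finset (Finset V) :=
  (Finset.univ.powersetCard j).filter fun K => e ∈ cliqueEdges K

/-- The `j`-element vertex sets through `e` spanning a clique once `e` is added to `S`. -/
def cliquesThrough (j : ℕ) (e : Sym2 V) (S : Finset (Sym2 V)) : Finset (Finset V) :=
  (setsThrough V j e).filter fun K => (cliqueEdges K).erase e ⊆ S

/-- The rank of the boundary operator on the `j`-vertex cliques of the graph `S`. -/
noncomputable def cliqueRank (j : ℕ) (S : Finset (Sym2 V)) : ℕ :=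
  spanRank bdryCol (cliqueSets j S)

theorem cliqueSets_mono (j : ℕ) {S T : Finset (Sym2 V)} (h : S ⊆ T) :
    cliqueSets j S ⊆ cliqueSets j T :=
  Finset.monotone_filter_right _ fun _ _ hK => hK.trans h

theorem cliqueSets_insert_sdiff (j : ℕ) (e : Sym2 V) (S : Finset (Sym2 V)) :
    cliqueSets j (insert e S) \ cliqueSets j (S.erase e) = cliquesThrough j e S := by
  ext K
  simp only [cliqueSets, cliquesThrough, setsThrough, Finset.mem_sdiff, Finset.mem_filter,
    Finset.subset_insert_iff]
  constructor
  · rintro ⟨⟨h1, h2⟩, h3⟩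
    refine ⟨⟨h1, ?_⟩, h2⟩
    by_contra he
    refine h3 ⟨h1, fun x hx => ?_⟩
    have hxe : x ≠ e := fun h => he (h ▸ hx)
    exact Finset.mem_erase.2 ⟨hxe, h2 (Finset.mem_erase.2 ⟨hxe, hx⟩)⟩
  · rintro ⟨⟨h1, h2⟩, h3⟩
    exact ⟨⟨h1, h3⟩, fun h => (Finset.mem_erase.1 (h.2 h2)).1 rfl⟩

theorem ddiff_card_cliqueSets (j : ℕ) (e : Sym2 V) (S : Finset (Sym2 V)) :
    ddiff (fun S => ((cliqueSets j S).card : ℝ)) e S = (cliquesThrough j e S).card := by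
  have h := cliqueSets_mono j (erase_subset_insert_self e S)
  rw [← cliqueSets_insert_sdiff, ddiff, Finset.card_sdiff_of_subset h,
    Nat.cast_sub (Finset.card_le_card h)]

theorem ddiff_cliqueRank_nonneg (j : ℕ) (e : Sym2 V) (S : Finset (Sym2 V)) :
    0 ≤ ddiff (fun S => (cliqueRank j S : ℝ)) e S := by
  rw [ddiff, sub_nonneg, Nat.cast_le]
  exact spanRank_mono _ (cliqueSets_mono j (erase_subset_insert_self e S))

theorem ddiff_cliqueRank_le (j : ℕ) (e : Sym2 V) (S : Finset (Sym2 V)) :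
    ddiff (fun S => (cliqueRank j S : ℝ)) e S ≤ (cliquesThrough j e S).card := by
  rw [ddiff, sub_le_iff_le_add', ← Nat.cast_add, Nat.cast_le, ← cliqueSets_insert_sdiff]
  exact spanRank_le_add_card _ (cliqueSets_mono j (erase_subset_insert_self e S))

/-- The total loss of rank over all single edge deletions is a bounded multiple of the rank. -/
theorem sum_ddiff_cliqueRank_le (j : ℕ) (S : Finset (Sym2 V)) :
    ∑ e ∈ S, ddiff (fun S => (cliqueRank j S : ℝ)) e S ≤ j.choose 2 * cliqueRank j S := by
  obtain ⟨T, hTA, hT, hB⟩ := exists_basis_subset bdryCol (cliqueSets j S)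
  have hT' : T.card = cliqueRank j S := hT
  have step : ∀ e ∈ S, ddiff (fun S => (cliqueRank j S : ℝ)) e S ≤
      ((T.filter fun K => e ∈ cliqueEdges K).card : ℝ) := by
    intro e he
    have h1 : (T ∩ cliqueSets j (S.erase e)).card ≤ cliqueRank j (S.erase e) :=
      hB _ (cliqueSets_mono j (Finset.erase_subset e S))
    have h2 : T.card ≤ (T.filter fun K => e ∈ cliqueEdges K).card +
        (T ∩ cliqueSets j (S.erase e)).card := by
      rw [← Finset.card_filter_add_card_filter_not (s := T) (fun K => e ∈ cliqueEdges K)]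
      refine Nat.add_le_add_left (Finset.card_le_card fun K hK => ?_) _
      rw [Finset.mem_filter] at hK
      have hK' := Finset.mem_filter.1 (hTA hK.1)
      refine Finset.mem_inter.2 ⟨hK.1, Finset.mem_filter.2 ⟨hK'.1, fun x hx => ?_⟩⟩
      exact Finset.mem_erase.2 ⟨fun h => hK.2 (h ▸ hx), hK'.2 hx⟩
    rw [ddiff, Finset.insert_eq_of_mem he, sub_le_iff_le_add, ← Nat.cast_add, Nat.cast_le]
    omega
  refine (Finset.sum_le_sum step).trans ?_
  rw [← Nat.cast_sum, ← Nat.cast_mul, Nat.cast_le, ← hT']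
  simp only [Finset.card_filter]
  rw [Finset.sum_comm, mul_comm, ← smul_eq_mul, ← Finset.sum_const]
  refine Finset.sum_le_sum fun K hK => ?_
  have hj : K.card = j := (Finset.mem_powersetCard.1 (Finset.mem_filter.1 (hTA hK)).1).2
  rw [← Finset.card_filter, ← hj, ← card_cliqueEdges]
  exact Finset.card_le_card fun x hx => (Finset.mem_filter.1 hx).2

end CliqueFamilies

section FlagBetti

variable {n : ℕ}

theorem mem_flagComplex_fromEdgeSet {S : Finset (Sym2 (Fin n))} {σ : Finset (Fin n)} :
    σ ∈ flagComplex (SimpleGraph.fromEdgeSet (S : Set (Sym2 (Fin n)))) ↔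
      σ.Nonempty ∧ cliqueEdges σ ⊆ S := by
  simp only [flagComplex, Finset.mem_filter, Finset.mem_powerset, Finset.subset_univ, true_and]
  refine and_congr_right fun _ => ?_
  rw [SimpleGraph.isClique_iff, Set.Pairwise]
  constructor
  · intro h e he
    induction e with
    | _ a b =>
      rw [mem_cliqueEdges] at he
      have := h (he.1 a (Sym2.mem_mk_left a b)) (he.1 b (Sym2.mem_mk_right a b)) he.2
      exact ((SimpleGraph.fromEdgeSet_adj _).1 this).1
  · intro h a ha b hb hab
    refine (SimpleGraph.fromEdgeSet_adj _).2 ⟨h (mem_cliqueEdges.2 ⟨?_, hab⟩), hab⟩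
    intro v hv
    rcases Sym2.mem_iff.1 hv with rfl | rfl <;> assumption

theorem downClosed_flagComplex (S : Finset (Sym2 (Fin n))) :
    DownClosed (flagComplex (SimpleGraph.fromEdgeSet (S : Set (Sym2 (Fin n))))) := by
  intro σ hσ τ hτ hne
  rw [mem_flagComplex_fromEdgeSet] at hσ ⊢
  exact ⟨hne, (cliqueEdges_mono hτ).trans hσ.2⟩

theorem mem_flagComplex_and_card {S : Finset (Sym2 (Fin n))} {σ : Finset (Fin n)} {k : ℕ} :
    (σ ∈ flagComplex (SimpleGraph.fromEdgeSet (S : Set (Sym2 (Fin n)))) ∧ σ.card = k + 1) ↔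
      σ ∈ cliqueSets (k + 1) S := by
  rw [mem_flagComplex_fromEdgeSet, cliqueSets, Finset.mem_filter, Finset.mem_powersetCard]
  constructor
  · rintro ⟨⟨-, h⟩, hc⟩
    exact ⟨⟨Finset.subset_univ _, hc⟩, h⟩
  · rintro ⟨⟨-, hc⟩, h⟩
    exact ⟨⟨Finset.card_pos.1 (by omega), h⟩, hc⟩

theorem card_faces_flagComplex (S : Finset (Sym2 (Fin n))) (k : ℕ) :
    Fintype.card (Faces (flagComplex (SimpleGraph.fromEdgeSet (S : Set (Sym2 (Fin n))))) k) =
      (cliqueSets (k + 1) S).card :=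
  Fintype.card_of_subtype _ fun _ => mem_flagComplex_and_card.symm

theorem finrank_range_bdry_flagComplex (S : Finset (Sym2 (Fin n))) (k : ℕ) :
    Module.finrank ℚ (LinearMap.range
      (bdry ℚ (flagComplex (SimpleGraph.fromEdgeSet (S : Set (Sym2 (Fin n))))) k)) =
      cliqueRank (k + 2) S := by
  have hset : {σ | σ ∈ flagComplex (SimpleGraph.fromEdgeSet (S : Set (Sym2 (Fin n)))) ∧
      σ.card = k + 2} = (cliqueSets (k + 2) S : Set (Finset (Fin n))) :=
    Set.ext fun _ => mem_flagComplex_and_card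
  rw [finrank_range_bdry (downClosed_flagComplex S), hset]
  rfl

theorem bettiNumber_flagComplex {k : ℕ} (hk : 1 ≤ k) (S : Finset (Sym2 (Fin n))) :
    (bettiNumber (flagComplex (SimpleGraph.fromEdgeSet (S : Set (Sym2 (Fin n))))) k : ℝ) =
      (cliqueSets (k + 1) S).card - cliqueRank (k + 1) S - cliqueRank (k + 2) S := by
  obtain ⟨k, rfl⟩ := Nat.exists_eq_add_of_le' hk
  have h := bettiNumber_succ_add (downClosed_flagComplex S) k
  rw [finrank_range_bdry_flagComplex, finrank_range_bdry_flagComplex, card_faces_flagComplex] at h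
  rw [← h]
  push_cast
  ring

theorem cliqueRank_le_card (S : Finset (Sym2 (Fin n))) (k : ℕ) :
    cliqueRank (k + 2) S ≤ (cliqueSets (k + 1) S).card := by
  rw [← finrank_range_bdry_flagComplex, ← card_faces_flagComplex]
  exact finrank_range_bdry_le k

end FlagBetti

section CliqueMoments

variable {n : ℕ}

/-- The edge set of the complete graph on `Fin n`. -/
abbrev allEdges (n : ℕ) : Finset (Sym2 (Fin n)) := cliqueEdges Finset.univ

theorem card_allEdges : (allEdges n).card = n.choose 2 := by
  rw [card_cliqueEdges, Finset.card_univ, Fintype.card_fin]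

theorem cliqueEdges_subset_allEdges (K : Finset (Fin n)) : cliqueEdges K ⊆ allEdges n :=
  cliqueEdges_mono (Finset.subset_univ K)

theorem mem_setsThrough {j : ℕ} {e : Sym2 (Fin n)} {K : Finset (Fin n)} :
    K ∈ setsThrough (Fin n) j e ↔ K.card = j ∧ e ∈ cliqueEdges K := by
  simp [setsThrough, Finset.mem_powersetCard]

theorem card_setsThrough {j : ℕ} {e : Sym2 (Fin n)} (he : e ∈ allEdges n) :
    (setsThrough (Fin n) (j + 2) e).card = (n - 2).choose j := by
  induction e with
  | _ a b =>
    have hab : a ≠ b := (mem_cliqueEdges.1 he).2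
    have hP : (Finset.univ \ {a, b} : Finset (Fin n)).card = n - 2 := by
      rw [Finset.card_sdiff_of_subset (Finset.subset_univ _), Finset.card_pair hab,
        Finset.card_univ, Fintype.card_fin]
    rw [← hP, ← Finset.card_powersetCard]
    have hmem : ∀ K : Finset (Fin n), s(a, b) ∈ cliqueEdges K ↔ {a, b} ⊆ K := by
      intro K
      rw [mem_cliqueEdges, Finset.insert_subset_iff, Finset.singleton_subset_iff]
      constructor
      · intro h
        exact ⟨h.1 a (Sym2.mem_mk_left a b), h.1 b (Sym2.mem_mk_right a b)⟩
      · rintro ⟨h1, h2⟩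
        refine ⟨fun v hv => ?_, hab⟩
        rcases Sym2.mem_iff.1 hv with rfl | rfl <;> assumption
    refine Finset.card_nbij' (fun K => K \ {a, b}) (fun K => K ∪ {a, b}) ?_ ?_ ?_ ?_
    · intro K hK
      have hK := mem_setsThrough.1 (Finset.mem_coe.1 hK)
      have hs := (hmem K).1 hK.2
      refine Finset.mem_coe.2 (Finset.mem_powersetCard.2
        ⟨Finset.sdiff_subset_sdiff (Finset.subset_univ K) subset_rfl, ?_⟩)
      rw [Finset.card_sdiff_of_subset hs, Finset.card_pair hab, hK.1, Nat.add_sub_cancel]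
    · intro K hK
      have hK := Finset.mem_powersetCard.1 (Finset.mem_coe.1 hK)
      have hd : Disjoint K {a, b} :=
        Finset.disjoint_of_subset_left hK.1 Finset.sdiff_disjoint
      refine Finset.mem_coe.2 (mem_setsThrough.2 ⟨?_, (hmem _).2 Finset.subset_union_right⟩)
      rw [Finset.card_union_of_disjoint hd, Finset.card_pair hab, hK.2]
    · intro K hK
      have hK := mem_setsThrough.1 (Finset.mem_coe.1 hK)
      exact Finset.sdiff_union_of_subset ((hmem K).1 hK.2)
    · intro K hK
      have hK := Finset.mem_powersetCard.1 (Finset.mem_coe.1 hK)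
      have hd : Disjoint K {a, b} :=
        Finset.disjoint_of_subset_left hK.1 Finset.sdiff_disjoint
      exact Finset.union_sdiff_cancel_right hd

theorem card_setsThrough_le {j : ℕ} {e : Sym2 (Fin n)} (he : e ∈ allEdges n) :
    (setsThrough (Fin n) (j + 2) e).card ≤ n ^ j := by
  rw [card_setsThrough he]
  exact (Nat.choose_le_pow _ _).trans (Nat.pow_le_pow_left (Nat.sub_le n 2) j)

theorem card_filter_inter_le (j m : ℕ) (K : Finset (Fin n)) (hK : K.card = j)
    (A : Finset (Finset (Fin n))) (hA : ∀ L ∈ A, L.card = j) :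
    (A.filter fun L => (K ∩ L).card = m).card ≤ 2 ^ j * n ^ (j - m) := by
  have h1 : (A.filter fun L => (K ∩ L).card = m).card ≤
      (K.powerset ×ˢ (Finset.univ : Finset (Fin n)).powersetCard (j - m)).card := by
    refine Finset.card_le_card_of_injOn (fun L => (K ∩ L, L \ K)) ?_ ?_
    · intro L hL
      have hL := Finset.mem_filter.1 (Finset.mem_coe.1 hL)
      refine Finset.mem_coe.2 (Finset.mem_product.2
        ⟨Finset.mem_powerset.2 Finset.inter_subset_left,
          Finset.mem_powersetCard.2 ⟨Finset.subset_univ _, ?_⟩⟩)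
      have := Finset.card_sdiff_add_card_inter L K
      rw [Finset.inter_comm, hL.2, hA L hL.1] at this
      change (L \ K).card = j - m
      omega
    · intro L _ L' _ h
      have h1 : K ∩ L = K ∩ L' := congrArg Prod.fst h
      have h2 : L \ K = L' \ K := congrArg Prod.snd h
      rw [← Finset.sdiff_union_inter L K, ← Finset.sdiff_union_inter L' K, h2,
        Finset.inter_comm L, Finset.inter_comm L', h1]
  refine h1.trans ?_
  rw [Finset.card_product, Finset.card_powerset, hK, Finset.card_powersetCard, Finset.card_univ,
    Fintype.card_fin]
  exact Nat.mul_le_mul_left _ (Nat.choose_le_pow _ _)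

theorem cast_card_cliquesThrough (j : ℕ) (e : Sym2 (Fin n)) (S : Finset (Sym2 (Fin n))) :
    ((cliquesThrough j e S).card : ℝ) =
      ∑ K ∈ setsThrough (Fin n) j e, if (cliqueEdges K).erase e ⊆ S then (1 : ℝ) else 0 := by
  rw [cliquesThrough, Finset.card_filter]
  push_cast
  rfl

theorem bexp_cliquesThrough (p : ℝ) (j : ℕ) (e : Sym2 (Fin n)) :
    bexp p (allEdges n) (fun S => ((cliquesThrough j e S).card : ℝ)) =
      (setsThrough (Fin n) j e).card * p ^ (j.choose 2 - 1) := by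
  simp only [cast_card_cliquesThrough]
  rw [bexp_sum, ← nsmul_eq_mul, ← Finset.sum_const]
  refine Finset.sum_congr rfl fun K hK => ?_
  rw [mem_setsThrough] at hK
  rw [bexp_indicator_subset _ _ ((Finset.erase_subset _ _).trans (cliqueEdges_subset_allEdges K)),
    Finset.card_erase_of_mem hK.2, card_cliqueEdges, hK.1]

theorem bexp_cliqueSets (p : ℝ) (j : ℕ) :
    bexp p (allEdges n) (fun S => ((cliqueSets j S).card : ℝ)) =
      n.choose j * p ^ j.choose 2 := by
  have h : ∀ S : Finset (Sym2 (Fin n)), ((cliqueSets j S).card : ℝ) =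
      ∑ K ∈ Finset.univ.powersetCard j, if cliqueEdges K ⊆ S then (1 : ℝ) else 0 := by
    intro S
    rw [cliqueSets, Finset.card_filter]
    push_cast
    rfl
  simp only [h]
  rw [bexp_sum, ← nsmul_eq_mul]
  have hc : n.choose j = (Finset.powersetCard j (Finset.univ : Finset (Fin n))).card := by
    rw [Finset.card_powersetCard, Finset.card_univ, Fintype.card_fin]
  rw [hc, ← Finset.sum_const]
  refine Finset.sum_congr rfl fun K hK => ?_
  rw [bexp_indicator_subset _ _ (cliqueEdges_subset_allEdges K), card_cliqueEdges,
    (Finset.mem_powersetCard.1 hK).2]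

/-- The number of edges of two complete graphs sharing the edge `e` and `m` vertices. -/
theorem card_erase_union_erase {j m : ℕ} {e : Sym2 (Fin n)} {K L : Finset (Fin n)}
    (hK : K ∈ setsThrough (Fin n) j e) (hL : L ∈ setsThrough (Fin n) j e)
    (hm : (K ∩ L).card = m) :
    ((cliqueEdges K).erase e ∪ (cliqueEdges L).erase e).card + 1 + m.choose 2 =
      2 * j.choose 2 := by
  rw [mem_setsThrough] at hK hL
  have h1 : (cliqueEdges K).erase e ∪ (cliqueEdges L).erase e =
      (cliqueEdges K ∪ cliqueEdges L).erase e := by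
    rw [Finset.erase_union_distrib]
  have h2 := Finset.card_union_add_card_inter (cliqueEdges K) (cliqueEdges L)
  rw [cliqueEdges_inter, card_cliqueEdges, card_cliqueEdges, card_cliqueEdges, hm, hK.1, hL.1]
    at h2
  rw [h1, Finset.card_erase_add_one (Finset.mem_union_left _ hK.2)]
  omega

theorem bexp_cliquesThrough_sq (p : ℝ) (j : ℕ) (e : Sym2 (Fin n)) :
    bexp p (allEdges n) (fun S => ((cliquesThrough j e S).card : ℝ) ^ 2) =
      ∑ K ∈ setsThrough (Fin n) j e, ∑ L ∈ setsThrough (Fin n) j e,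
        p ^ (2 * j.choose 2 - (K ∩ L).card.choose 2 - 1) := by
  have h : ∀ S : Finset (Sym2 (Fin n)), ((cliquesThrough j e S).card : ℝ) ^ 2 =
      ∑ K ∈ setsThrough (Fin n) j e, ∑ L ∈ setsThrough (Fin n) j e,
        if (cliqueEdges K).erase e ∪ (cliqueEdges L).erase e ⊆ S then (1 : ℝ) else 0 := by
    intro S
    rw [cast_card_cliquesThrough, sq, Finset.sum_mul_sum]
    refine Finset.sum_congr rfl fun K _ => Finset.sum_congr rfl fun L _ => ?_
    by_cases h1 : (cliqueEdges K).erase e ⊆ S <;> by_cases h2 : (cliqueEdges L).erase e ⊆ S <;>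
      simp [Finset.union_subset_iff, h1, h2]
  simp only [h]
  rw [bexp_sum]
  refine Finset.sum_congr rfl fun K hK => ?_
  rw [bexp_sum]
  refine Finset.sum_congr rfl fun L hL => ?_
  rw [bexp_indicator_subset]
  · have := card_erase_union_erase hK hL rfl
    congr 1
    omega
  · exact Finset.union_subset
      ((Finset.erase_subset _ _).trans (cliqueEdges_subset_allEdges K))
      ((Finset.erase_subset _ _).trans (cliqueEdges_subset_allEdges L))

theorem two_le_card_inter {j : ℕ} {e : Sym2 (Fin n)} {K L : Finset (Fin n)}
    (hK : K ∈ setsThrough (Fin n) j e) (hL : L ∈ setsThrough (Fin n) j e) :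
    2 ≤ (K ∩ L).card := by
  rw [mem_setsThrough] at hK hL
  have h : e ∈ cliqueEdges (K ∩ L) := by
    rw [← cliqueEdges_inter]; exact Finset.mem_inter.2 ⟨hK.2, hL.2⟩
  have h1 : 0 < (K ∩ L).card.choose 2 := by
    rw [← card_cliqueEdges]; exact Finset.card_pos.2 ⟨e, h⟩
  by_contra hlt
  rw [Nat.choose_eq_zero_of_lt (by omega)] at h1
  exact lt_irrefl _ h1

/-- Summing a nonnegative function of the intersection size over pairs of sets through `e`. -/
theorem sum_sum_inter_le {j : ℕ} {e : Sym2 (Fin n)} (he : e ∈ allEdges n) (φ : ℕ → ℝ)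
    (hφ : ∀ m, 0 ≤ φ m) :
    ∑ K ∈ setsThrough (Fin n) (j + 2) e, ∑ L ∈ setsThrough (Fin n) (j + 2) e,
        φ (K ∩ L).card ≤
      ∑ i ∈ Finset.range (j + 1), 2 ^ (j + 2) * (n : ℝ) ^ j * (n : ℝ) ^ (j - i) * φ (i + 2) := by
  have inner : ∀ K ∈ setsThrough (Fin n) (j + 2) e,
      ∑ L ∈ setsThrough (Fin n) (j + 2) e, φ (K ∩ L).card ≤
        ∑ i ∈ Finset.range (j + 1), 2 ^ (j + 2) * (n : ℝ) ^ (j - i) * φ (i + 2) := by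
    intro K hK
    have hmaps : ∀ L ∈ setsThrough (Fin n) (j + 2) e,
        (K ∩ L).card - 2 ∈ Finset.range (j + 1) := by
      intro L hL
      have h1 := Finset.card_le_card (Finset.inter_subset_left : K ∩ L ⊆ K)
      rw [(mem_setsThrough.1 hK).1] at h1
      exact Finset.mem_range.2 (by omega)
    rw [← Finset.sum_fiberwise_of_maps_to hmaps]
    refine Finset.sum_le_sum fun i hi => ?_
    have hfil : ∀ L ∈ (setsThrough (Fin n) (j + 2) e).filter (fun L => (K ∩ L).card - 2 = i),
        φ (K ∩ L).card = φ (i + 2) := by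
      intro L hL
      rw [Finset.mem_filter] at hL
      have := two_le_card_inter hK hL.1
      congr 1
      omega
    rw [Finset.sum_congr rfl hfil, Finset.sum_const, nsmul_eq_mul]
    refine mul_le_mul_of_nonneg_right ?_ (hφ _)
    have hle := card_filter_inter_le (j + 2) (i + 2) K (mem_setsThrough.1 hK).1
      (setsThrough (Fin n) (j + 2) e) (fun L hL => (mem_setsThrough.1 hL).1)
    rw [Nat.add_sub_add_right] at hle
    have hle' : (((setsThrough (Fin n) (j + 2) e).filter
        fun L => (K ∩ L).card = i + 2).card : ℝ) ≤ 2 ^ (j + 2) * (n : ℝ) ^ (j - i) := by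
      exact_mod_cast hle
    refine le_trans ?_ hle'
    rw [Nat.cast_le]
    refine Finset.card_le_card fun L hL => ?_
    rw [Finset.mem_filter] at hL ⊢
    have := two_le_card_inter hK hL.1
    exact ⟨hL.1, by omega⟩
  refine (Finset.sum_le_sum inner).trans ?_
  rw [Finset.sum_const, nsmul_eq_mul, Finset.mul_sum]
  refine Finset.sum_le_sum fun i _ => ?_
  have hc : ((setsThrough (Fin n) (j + 2) e).card : ℝ) ≤ (n : ℝ) ^ j := by
    exact_mod_cast card_setsThrough_le he
  have := hφ (i + 2)
  calc _ ≤ (n : ℝ) ^ j * (2 ^ (j + 2) * (n : ℝ) ^ (j - i) * φ (i + 2)) := by gcongr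
    _ = _ := by ring

end CliqueMoments

section CliqueMomentBounds

variable {n : ℕ}

theorem choose_two_le {i j : ℕ} (hij : i ≤ j) : (i + 2).choose 2 ≤ (j + 1) * i + 1 := by
  have h : 2 * (i + 2).choose 2 = (i + 2) * (i + 1) := by
    have := Nat.add_one_mul_choose_eq (i + 1) 1
    simp only [Nat.choose_one_right] at this
    linarith
  nlinarith [Nat.mul_le_mul_right i hij, Nat.le_mul_self i]

theorem choose_two_le_sq (j : ℕ) : (j + 2).choose 2 ≤ j * j + j + 1 := by
  have := choose_two_le (le_refl j)
  linarith

theorem choose_two_succ (j : ℕ) : (j + 3).choose 2 = (j + 2).choose 2 + (j + 2) := by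
  have := Nat.choose_succ_succ' (j + 2) 1
  change (j + 3).choose 2 = (j + 2).choose 1 + (j + 2).choose 2 at this
  rw [this, Nat.choose_one_right, add_comm]

/-- The square of the (order of the) expected number of `(j + 2)`-cliques through an edge. -/
noncomputable def meanSq (n : ℕ) (p : ℝ) (j : ℕ) : ℝ :=
  (n : ℝ) ^ (2 * j) * p ^ (2 * ((j + 2).choose 2 - 1))

theorem overlap_term_le {p : ℝ} (h0 : 0 ≤ p) (h1 : p ≤ 1) {i j : ℕ} (hij : i ≤ j) :
    (n : ℝ) ^ j * (n : ℝ) ^ (j - i) * p ^ (2 * (j + 2).choose 2 - (i + 2).choose 2 - 1) *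
      (n * p ^ (j + 1)) ^ i ≤ meanSq n p j := by
  have hc := choose_two_le hij
  have e1 : (n : ℝ) ^ j * (n : ℝ) ^ (j - i) *
      p ^ (2 * (j + 2).choose 2 - (i + 2).choose 2 - 1) * (n * p ^ (j + 1)) ^ i =
      (n : ℝ) ^ (j + (j - i) + i) *
        p ^ (2 * (j + 2).choose 2 - (i + 2).choose 2 - 1 + (j + 1) * i) := by
    rw [mul_pow, ← pow_mul, pow_add, pow_add, pow_add]; ring
  rw [e1, meanSq, show j + (j - i) + i = 2 * j by omega]
  refine mul_le_mul_of_nonneg_left (pow_le_pow_of_le_one h0 h1 (by omega)) (by positivity)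

theorem overlap_term_succ_le {p : ℝ} (h0 : 0 ≤ p) (h1 : p ≤ 1) {i j : ℕ} (hij : i ≤ j) :
    (n : ℝ) ^ (j + 1) * (n : ℝ) ^ (j + 1 - i) *
      p ^ (2 * (j + 3).choose 2 - (i + 2).choose 2 - 1) * (n * p ^ (j + 1)) ^ i ≤
      meanSq n p j * (n * p ^ (j + 2)) ^ 2 := by
  have hc := choose_two_le hij
  have e1 : (n : ℝ) ^ (j + 1) * (n : ℝ) ^ (j + 1 - i) *
      p ^ (2 * (j + 3).choose 2 - (i + 2).choose 2 - 1) * (n * p ^ (j + 1)) ^ i =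
      (n : ℝ) ^ (j + 1 + (j + 1 - i) + i) *
        p ^ (2 * (j + 3).choose 2 - (i + 2).choose 2 - 1 + (j + 1) * i) := by
    rw [mul_pow, ← pow_mul, pow_add, pow_add, pow_add]; ring
  have e2 : meanSq n p j * (n * p ^ (j + 2)) ^ 2 = (n : ℝ) ^ (2 * j + 2) *
      p ^ (2 * ((j + 2).choose 2 - 1) + (j + 2) * 2) := by
    rw [meanSq, mul_pow, ← pow_mul, pow_add, pow_add]; ring
  have := choose_two_succ j
  rw [e1, e2, show j + 1 + (j + 1 - i) + i = 2 * j + 2 by omega]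
  have hp : 0 < (j + 2).choose 2 := Nat.choose_pos (by omega)
  refine mul_le_mul_of_nonneg_left (pow_le_pow_of_le_one h0 h1 (by omega)) (by positivity)

theorem full_overlap_term_le {p : ℝ} (h0 : 0 ≤ p) (h1 : p ≤ 1) (j : ℕ) :
    (n : ℝ) ^ (j + 1) * (n : ℝ) ^ (j + 1 - (j + 1)) *
      p ^ (2 * (j + 3).choose 2 - (j + 1 + 2).choose 2 - 1) * (n * p ^ (j + 1)) ^ j ≤
      meanSq n p j * (n * p ^ (j + 2)) := by
  have hc := choose_two_le_sq j
  have e1 : (n : ℝ) ^ (j + 1) * (n : ℝ) ^ (j + 1 - (j + 1)) *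
      p ^ (2 * (j + 3).choose 2 - (j + 1 + 2).choose 2 - 1) * (n * p ^ (j + 1)) ^ j =
      (n : ℝ) ^ (2 * j + 1) *
        p ^ (2 * (j + 3).choose 2 - (j + 1 + 2).choose 2 - 1 + (j + 1) * j) := by
    rw [mul_pow, ← pow_mul, pow_add, Nat.sub_self]; ring
  have e2 : meanSq n p j * (n * p ^ (j + 2)) = (n : ℝ) ^ (2 * j + 1) *
      p ^ (2 * ((j + 2).choose 2 - 1) + (j + 2)) := by
    rw [meanSq, pow_add, pow_add]; ring
  have := choose_two_succ j
  rw [e1, e2, show j + 1 + 2 = j + 3 by omega]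
  have hp : 0 < (j + 2).choose 2 := Nat.choose_pos (by omega)
  have hj : (j + 1) * j = j * j + j := by ring
  refine mul_le_mul_of_nonneg_left (pow_le_pow_of_le_one h0 h1 (by omega)) (by positivity)

/-- The number of `(j + 2)`-cliques through a given edge is concentrated. -/
theorem bexp_cliquesThrough_sub_mean_sq_le {p : ℝ} (h0 : 0 ≤ p) (h1 : p ≤ 1) {j : ℕ}
    (hx : 1 ≤ n * p ^ (j + 1)) {e : Sym2 (Fin n)} (he : e ∈ allEdges n) :
    bexp p (allEdges n) (fun S => (((cliquesThrough (j + 2) e S).card : ℝ) -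
        (n - 2).choose j * p ^ ((j + 2).choose 2 - 1)) ^ 2) ≤
      (j + 1) * 2 ^ (j + 2) * (meanSq n p j / (n * p ^ (j + 1))) := by
  have hx0 : 0 < n * p ^ (j + 1) := by linarith
  let φ : ℕ → ℝ := fun m =>
    if m ≤ 2 then 0 else p ^ (2 * (j + 2).choose 2 - m.choose 2 - 1)
  have hφ : ∀ m, 0 ≤ φ m := by
    intro m
    simp only [φ]
    split_ifs
    · rfl
    · positivity
  have hmean := bexp_cliquesThrough p (j + 2) e
  rw [card_setsThrough he] at hmean
  rw [← hmean, bexp_sq_sub_mean, bexp_cliquesThrough_sq]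
  have h2 : ∑ K ∈ setsThrough (Fin n) (j + 2) e, ∑ L ∈ setsThrough (Fin n) (j + 2) e,
        p ^ (2 * (j + 2).choose 2 - (K ∩ L).card.choose 2 - 1) ≤
      (∑ K ∈ setsThrough (Fin n) (j + 2) e, ∑ L ∈ setsThrough (Fin n) (j + 2) e,
        φ (K ∩ L).card) +
      bexp p (allEdges n) (fun S => ((cliquesThrough (j + 2) e S).card : ℝ)) ^ 2 := by
    have h3 : bexp p (allEdges n) (fun S => ((cliquesThrough (j + 2) e S).card : ℝ)) ^ 2 =
        ∑ K ∈ setsThrough (Fin n) (j + 2) e, ∑ L ∈ setsThrough (Fin n) (j + 2) e,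
          p ^ (2 * ((j + 2).choose 2 - 1)) := by
      rw [bexp_cliquesThrough]
      simp only [Finset.sum_const, nsmul_eq_mul]
      ring
    rw [h3, ← Finset.sum_add_distrib]
    refine Finset.sum_le_sum fun K hK => ?_
    rw [← Finset.sum_add_distrib]
    refine Finset.sum_le_sum fun L hL => ?_
    have hKL := two_le_card_inter hK hL
    simp only [φ]
    split_ifs with hm
    · rw [show (K ∩ L).card = 2 by omega, zero_add]
      refine le_of_eq ?_
      congr 1
      simp only [Nat.choose_self]
      omega
    · have : 0 ≤ p ^ (2 * ((j + 2).choose 2 - 1)) := by positivity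
      linarith
  have h4 := sum_sum_inter_le (j := j) he φ hφ
  have h5 : ∑ i ∈ Finset.range (j + 1),
      2 ^ (j + 2) * (n : ℝ) ^ j * (n : ℝ) ^ (j - i) * φ (i + 2) ≤
      ∑ i ∈ Finset.range (j + 1), 2 ^ (j + 2) * (meanSq n p j / (n * p ^ (j + 1))) := by
    refine Finset.sum_le_sum fun i hi => ?_
    have hij : i ≤ j := by have := Finset.mem_range.1 hi; omega
    rw [mul_assoc, mul_assoc]
    refine mul_le_mul_of_nonneg_left ?_ (by positivity)
    have hQ : 0 ≤ meanSq n p j := by unfold meanSq; positivity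
    simp only [φ]
    split_ifs with hm
    · rw [mul_zero, mul_zero]; positivity
    · rw [le_div_iff₀ hx0, ← mul_assoc ((n : ℝ) ^ j)]
      exact (mul_le_mul_of_nonneg_left (le_self_pow₀ hx (by omega : i ≠ 0)) (by positivity)).trans
        (overlap_term_le h0 h1 hij)
  rw [Finset.sum_const, Finset.card_range, nsmul_eq_mul] at h5
  push_cast at h5
  linarith

/-- The second moment of the number of `(j + 3)`-cliques through a given edge is small. -/
theorem bexp_cliquesThrough_succ_sq_le {p : ℝ} (h0 : 0 ≤ p) (h1 : p ≤ 1) {j : ℕ}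
    (hx : 1 ≤ n * p ^ (j + 1)) (hy : n * p ^ (j + 2) ≤ 1) {e : Sym2 (Fin n)}
    (he : e ∈ allEdges n) :
    bexp p (allEdges n) (fun S => ((cliquesThrough (j + 3) e S).card : ℝ) ^ 2) ≤
      (j + 2) * 2 ^ (j + 3) * (meanSq n p j * (n * p ^ (j + 2))) := by
  have hQ : 0 ≤ meanSq n p j := by unfold meanSq; positivity
  have hy0 : 0 ≤ n * p ^ (j + 2) := by positivity
  rw [bexp_cliquesThrough_sq]
  refine (sum_sum_inter_le (j := j + 1) he
    (fun m => p ^ (2 * (j + 3).choose 2 - m.choose 2 - 1)) (fun m => by positivity)).trans ?_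
  have h5 : ∑ i ∈ Finset.range (j + 1 + 1), 2 ^ (j + 1 + 2) * (n : ℝ) ^ (j + 1) *
        (n : ℝ) ^ (j + 1 - i) * p ^ (2 * (j + 3).choose 2 - (i + 2).choose 2 - 1) ≤
      ∑ i ∈ Finset.range (j + 1 + 1), 2 ^ (j + 3) * (meanSq n p j * (n * p ^ (j + 2))) := by
    refine Finset.sum_le_sum fun i hi => ?_
    rw [mul_assoc, mul_assoc]
    refine mul_le_mul_of_nonneg_left ?_ (by positivity)
    rw [← mul_assoc]
    rcases Nat.lt_or_ge i (j + 1) with hij | hij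
    · calc _ ≤ (n : ℝ) ^ (j + 1) * (n : ℝ) ^ (j + 1 - i) *
            p ^ (2 * (j + 3).choose 2 - (i + 2).choose 2 - 1) * (n * p ^ (j + 1)) ^ i :=
          le_mul_of_one_le_right (by positivity) (one_le_pow₀ hx)
        _ ≤ meanSq n p j * (n * p ^ (j + 2)) ^ 2 := overlap_term_succ_le h0 h1 (by omega)
        _ ≤ _ := by
          refine mul_le_mul_of_nonneg_left ?_ hQ
          exact pow_le_of_le_one hy0 hy (by norm_num)
    · obtain rfl : i = j + 1 := by have := Finset.mem_range.1 hi; omega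
      exact (le_mul_of_one_le_right (by positivity) (one_le_pow₀ hx)).trans
        (full_overlap_term_le h0 h1 j)
  refine h5.trans (le_of_eq ?_)
  rw [Finset.sum_const, Finset.card_range, nsmul_eq_mul]
  push_cast
  ring

end CliqueMomentBounds

section BettiVariance

variable {n : ℕ}

/-- The Betti number of dimension `j + 1` of the flag complex of the graph with edge set `S`. -/
noncomputable def flagBetti (n j : ℕ) (S : Finset (Sym2 (Fin n))) : ℝ :=
  (cliqueSets (j + 2) S).card - cliqueRank (j + 2) S - cliqueRank (j + 3) S

/-- The expected number of `(j + 2)`-cliques through an edge that is present. -/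
noncomputable def edgeMean (n : ℕ) (p : ℝ) (j : ℕ) : ℝ :=
  (n - 2).choose j * p ^ ((j + 2).choose 2 - 1)

theorem edgeMean_nonneg {p : ℝ} (h0 : 0 ≤ p) (j : ℕ) : 0 ≤ edgeMean n p j := by
  unfold edgeMean; positivity

theorem edgeMean_le {p : ℝ} (h0 : 0 ≤ p) (j : ℕ) :
    edgeMean n p j ≤ (n : ℝ) ^ j * p ^ ((j + 2).choose 2 - 1) := by
  refine mul_le_mul_of_nonneg_right ?_ (by positivity)
  exact_mod_cast (Nat.choose_le_pow _ _).trans (Nat.pow_le_pow_left (Nat.sub_le n 2) j)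

theorem ddiff_flagBetti_sub (m : ℝ) (j : ℕ) (e : Sym2 (Fin n)) (S : Finset (Sym2 (Fin n))) :
    ddiff (fun S => flagBetti n j S - m * S.card) e S =
      ((cliquesThrough (j + 2) e S).card - m) - ddiff (fun S => (cliqueRank (j + 2) S : ℝ)) e S -
        ddiff (fun S => (cliqueRank (j + 3) S : ℝ)) e S := by
  rw [← ddiff_card_cliqueSets]
  have h : ((insert e S).card : ℝ) = (S.erase e).card + 1 := by
    rw [show insert e S = insert e (S.erase e) by ext; simp; tauto, Finset.card_insert_of_notMem (Finset.notMem_erase e S)]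
    push_cast
    rfl
  simp only [ddiff, flagBetti, h]
  ring

/-- On average over the edges, adding an edge changes the rank of the boundary operator
only rarely. -/
theorem sum_bexp_ddiff_cliqueRank_le {p : ℝ} (h0 : 0 ≤ p) (h1 : p ≤ 1) (j : ℕ) :
    ∑ e ∈ allEdges n, p * bexp p (allEdges n) (ddiff (fun S => (cliqueRank (j + 2) S : ℝ)) e) ≤
      (j + 2).choose 2 * ((n : ℝ) ^ (j + 1) * p ^ (j + 1).choose 2) := by
  have h : ∀ e ∈ allEdges n,
      p * bexp p (allEdges n) (ddiff (fun S => (cliqueRank (j + 2) S : ℝ)) e) =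
      bexp p (allEdges n)
        (fun S => if e ∈ S then ddiff (fun S => (cliqueRank (j + 2) S : ℝ)) e S else 0) :=
    fun e he => (bexp_mem_mul he (ddiff_insert _ e)).symm
  rw [Finset.sum_congr rfl h, ← bexp_sum]
  calc _ ≤ bexp p (allEdges n)
        (fun S => ((j + 2).choose 2 : ℝ) * ((cliqueSets (j + 1) S).card : ℝ)) := by
        refine bexp_mono h0 h1 fun S hS => ?_
        rw [← Finset.sum_filter, Finset.filter_mem_eq_inter, Finset.inter_eq_right.2 hS]
        refine (sum_ddiff_cliqueRank_le (j + 2) S).trans ?_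
        refine mul_le_mul_of_nonneg_left ?_ (by positivity)
        exact_mod_cast cliqueRank_le_card S j
    _ ≤ _ := by
        rw [bexp_const_mul, bexp_cliqueSets]
        refine mul_le_mul_of_nonneg_left ?_ (by positivity)
        refine mul_le_mul_of_nonneg_right ?_ (by positivity)
        exact_mod_cast Nat.choose_le_pow n (j + 1)

theorem bexp_ddiff_flagBetti_sq_le {p : ℝ} (h0 : 0 ≤ p) (h1 : p ≤ 1) {j : ℕ}
    (hx : 1 ≤ n * p ^ (j + 1)) (hy : n * p ^ (j + 2) ≤ 1) {e : Sym2 (Fin n)}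
    (he : e ∈ allEdges n) :
    bexp p (allEdges n)
        (fun S => ddiff (fun S => flagBetti n j S - edgeMean n p j * S.card) e S ^ 2) ≤
      15 * ((j + 1) * 2 ^ (j + 2) * (meanSq n p j / (n * p ^ (j + 1)))) +
      3 * ((j + 2) * 2 ^ (j + 3) * (meanSq n p j * (n * p ^ (j + 2)))) +
      6 * edgeMean n p j *
        bexp p (allEdges n) (ddiff (fun S => (cliqueRank (j + 2) S : ℝ)) e) := by
  have hA := bexp_cliquesThrough_sub_mean_sq_le h0 h1 hx he
  have hB := bexp_cliquesThrough_succ_sq_le h0 h1 hx hy he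
  have hD := bexp_sq_le_of_le (E := allEdges n) (μ := edgeMean n p j) h0 h1
    (fun S _ => ddiff_cliqueRank_nonneg (j + 2) e S) (fun S _ => ddiff_cliqueRank_le (j + 2) e S)
  have hB' : bexp p (allEdges n)
      (fun S => ddiff (fun S => (cliqueRank (j + 3) S : ℝ)) e S ^ 2) ≤
      bexp p (allEdges n) (fun S => ((cliquesThrough (j + 3) e S).card : ℝ) ^ 2) :=
    bexp_mono h0 h1 fun S _ => pow_le_pow_left₀ (ddiff_cliqueRank_nonneg _ e S)
      (ddiff_cliqueRank_le _ e S) 2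
  have hS : bexp p (allEdges n)
        (fun S => ddiff (fun S => flagBetti n j S - edgeMean n p j * S.card) e S ^ 2) ≤
      bexp p (allEdges n) (fun S => 3 *
        (((((cliquesThrough (j + 2) e S).card : ℝ) - edgeMean n p j) ^ 2 +
          ddiff (fun S => (cliqueRank (j + 2) S : ℝ)) e S ^ 2) +
          ddiff (fun S => (cliqueRank (j + 3) S : ℝ)) e S ^ 2)) := by
    refine bexp_mono h0 h1 fun S _ => ?_
    rw [ddiff_flagBetti_sub]
    generalize ((cliquesThrough (j + 2) e S).card : ℝ) - edgeMean n p j = a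
    generalize ddiff (fun S => (cliqueRank (j + 2) S : ℝ)) e S = b
    generalize ddiff (fun S => (cliqueRank (j + 3) S : ℝ)) e S = c
    nlinarith [sq_nonneg (a + b), sq_nonneg (a + c), sq_nonneg (b - c)]
  rw [bexp_const_mul, bexp_add, bexp_add] at hS
  change bexp p (allEdges n) (fun S => (((cliquesThrough (j + 2) e S).card : ℝ) -
    edgeMean n p j) ^ 2) ≤ _ at hA
  change _ ≤ 2 * edgeMean n p j *
    bexp p (allEdges n) (ddiff (fun S => (cliqueRank (j + 2) S : ℝ)) e) + _ at hD
  linarith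

/-- The variance of the difference between the Betti number and its linear approximation. -/
theorem variance_flagBetti_sub_le {p : ℝ} (h0 : 0 ≤ p) (h1 : p ≤ 1) {j : ℕ}
    (hx : 1 ≤ n * p ^ (j + 1)) (hy : n * p ^ (j + 2) ≤ 1) :
    bexp p (allEdges n) (fun S => (flagBetti n j S - edgeMean n p j * S.card) ^ 2) -
        bexp p (allEdges n) (fun S => flagBetti n j S - edgeMean n p j * S.card) ^ 2 ≤
      ((n : ℝ) ^ 2 * p * meanSq n p j) *
        ((15 * ((j + 1) * 2 ^ (j + 2)) + 6 * (j + 2).choose 2) / (n * p ^ (j + 1)) +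
          3 * ((j + 2) * 2 ^ (j + 3)) * (n * p ^ (j + 2))) := by
  have hx0 : 0 < n * p ^ (j + 1) := by linarith
  have hn0 : (n : ℝ) ≠ 0 := fun h => by simp [h] at hx0
  have hp0 : p ≠ 0 := fun h => by simp [h] at hx0
  have hQ : 0 ≤ meanSq n p j := by unfold meanSq; positivity
  have hm := edgeMean_nonneg (n := n) h0 j
  refine (bexp_sq_sub_sq_le h0 h1 _ _).trans ?_
  set a := 15 * ((j + 1 : ℝ) * 2 ^ (j + 2) * (meanSq n p j / (n * p ^ (j + 1)))) +
      3 * ((j + 2) * 2 ^ (j + 3) * (meanSq n p j * (n * p ^ (j + 2)))) with ha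
  have ha0 : 0 ≤ a := by positivity
  have hN : ((allEdges n).card : ℝ) ≤ (n : ℝ) ^ 2 := by
    rw [card_allEdges]; exact_mod_cast Nat.choose_le_pow n 2
  have hsum : ∑ e ∈ allEdges n, p * (1 - p) * bexp p (allEdges n)
        (fun S => ddiff (fun S => flagBetti n j S - edgeMean n p j * S.card) e S ^ 2) ≤
      ∑ e ∈ allEdges n, (p * a + 6 * edgeMean n p j *
        (p * bexp p (allEdges n) (ddiff (fun S => (cliqueRank (j + 2) S : ℝ)) e))) := by
    refine Finset.sum_le_sum fun e he => ?_
    have hb := bexp_ddiff_flagBetti_sq_le h0 h1 hx hy he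
    have hb0 : 0 ≤ bexp p (allEdges n)
        (fun S => ddiff (fun S => flagBetti n j S - edgeMean n p j * S.card) e S ^ 2) :=
      bexp_nonneg h0 h1 fun S _ => sq_nonneg _
    have h3 := mul_le_mul_of_nonneg_left hb h0
    nlinarith [mul_nonneg (mul_nonneg h0 h0) hb0]
  refine hsum.trans ?_
  rw [Finset.sum_add_distrib, Finset.sum_const, nsmul_eq_mul, ← Finset.mul_sum]
  have h4 := mul_le_mul_of_nonneg_left (sum_bexp_ddiff_cliqueRank_le (n := n) h0 h1 j)
    (mul_nonneg (by norm_num : (0 : ℝ) ≤ 6) hm)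
  have h5 := mul_le_mul_of_nonneg_right hN (mul_nonneg h0 ha0)
  have h6 := mul_le_mul_of_nonneg_right (edgeMean_le (n := n) h0 j)
    (by positivity : 0 ≤ 6 * (((j + 2).choose 2 : ℝ) * ((n : ℝ) ^ (j + 1) * p ^ (j + 1).choose 2)))
  have h7 : (n : ℝ) ^ j * p ^ ((j + 2).choose 2 - 1) * ((n : ℝ) ^ (j + 1) * p ^ (j + 1).choose 2) =
      (n : ℝ) ^ 2 * p * meanSq n p j / (n * p ^ (j + 1)) := by
    rw [eq_div_iff hx0.ne', meanSq]
    have hc : (j + 2).choose 2 = (j + 1).choose 1 + (j + 1).choose 2 :=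
      Nat.choose_succ_succ' (j + 1) 1
    rw [Nat.choose_one_right] at hc
    rw [show (j + 2).choose 2 - 1 = j + (j + 1).choose 2 by omega]
    ring
  have h8 : ((n : ℝ) ^ 2 * p * meanSq n p j) *
        ((15 * ((j + 1) * 2 ^ (j + 2)) + 6 * (j + 2).choose 2) / (n * p ^ (j + 1)) +
          3 * ((j + 2) * 2 ^ (j + 3)) * (n * p ^ (j + 2))) =
      (n : ℝ) ^ 2 * (p * a) + 6 * (j + 2).choose 2 *
        ((n : ℝ) ^ 2 * p * meanSq n p j / (n * p ^ (j + 1))) := by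
    rw [ha]; field_simp; ring
  rw [h8, ← h7]
  linarith

end BettiVariance

section BernoulliCharFun

open Complex

theorem norm_pow_sub_pow_le {a b : ℂ} (ha : ‖a‖ ≤ 1) (hb : ‖b‖ ≤ 1) (N : ℕ) :
    ‖a ^ N - b ^ N‖ ≤ N * ‖a - b‖ := by
  induction N with
  | zero => simp
  | succ N ih =>
    calc ‖a ^ (N + 1) - b ^ (N + 1)‖ = ‖a * (a ^ N - b ^ N) + (a - b) * b ^ N‖ := by ring_nf
      _ ≤ ‖a‖ * ‖a ^ N - b ^ N‖ + ‖a - b‖ * ‖b‖ ^ N := by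
        refine (norm_add_le _ _).trans ?_
        rw [norm_mul, norm_mul, norm_pow]
      _ ≤ 1 * (N * ‖a - b‖) + ‖a - b‖ * 1 := by
        gcongr
        exact pow_le_one₀ (norm_nonneg b) hb
      _ = _ := by push_cast; ring

theorem norm_exp_mul_I_sub_exp_mul_I_le (x y : ℝ) :
    ‖cexp (x * I) - cexp (y * I)‖ ≤ |x - y| := by
  have h : cexp (x * I) - cexp (y * I) = cexp (y * I) * (cexp (I * ((x - y : ℝ) : ℂ)) - 1) := by
    rw [mul_sub, ← Complex.exp_add, mul_one]
    congr 2
    push_cast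
    ring
  rw [h, norm_mul, norm_exp_ofReal_mul_I, one_mul]
  exact Real.norm_exp_I_mul_ofReal_sub_one_le

theorem norm_exp_mul_I_taylor_le {y : ℝ} (hy : |y| ≤ 1) :
    ‖cexp (y * I) - (1 + y * I - y ^ 2 / 2)‖ ≤ 3 * |y| ^ 3 := by
  have h := Complex.norm_exp_sub_sum_le_norm_mul_exp (y * I) 3
  have h1 : ∑ m ∈ Finset.range 3, ((y : ℂ) * I) ^ m / (m.factorial : ℂ) =
      1 + y * I - y ^ 2 / 2 := by
    simp [Finset.sum_range_succ, mul_pow]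
    ring
  have h2 : ‖(y : ℂ) * I‖ = |y| := by simp
  rw [h1, h2] at h
  refine h.trans ?_
  rw [mul_comm]
  have h3 : Real.exp |y| ≤ 3 :=
    (Real.exp_le_exp.2 hy).trans (by linarith [Real.exp_one_lt_d9])
  exact mul_le_mul_of_nonneg_right h3 (by positivity)

variable {α : Type*} {p : ℝ} {E : Finset α}

/-- The characteristic function of `T S`, where `S` is the random subset of `E` containing each
element independently with probability `p`. -/
noncomputable def bchar (p : ℝ) (E : Finset α) (T : Finset α → ℝ) (θ : ℝ) : ℂ :=
  ∑ S ∈ E.powerset, ((p ^ S.card * (1 - p) ^ (E.card - S.card) : ℝ) : ℂ) * cexp (θ * T S * I)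

theorem norm_bchar_sub_le (h0 : 0 ≤ p) (h1 : p ≤ 1) (T U : Finset α → ℝ) (θ : ℝ) :
    ‖bchar p E T θ - bchar p E U θ‖ ≤ |θ| * √(bexp p E (fun S => (T S - U S) ^ 2)) := by
  have hq := sub_nonneg.2 h1
  have habs : bexp p E (fun S => |T S - U S|) ≤ √(bexp p E (fun S => (T S - U S) ^ 2)) := by
    refine Real.le_sqrt_of_sq_le ?_
    have h := bexp_sq_sub_mean (p := p) (E := E) (f := fun S => |T S - U S|)
    have h2 := bexp_nonneg (p := p) (E := E) h0 h1
      (fun S _ => sq_nonneg (|T S - U S| - bexp p E fun S => |T S - U S|))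
    simp only [sq_abs] at h
    linarith
  refine le_trans ?_ (mul_le_mul_of_nonneg_left habs (abs_nonneg θ))
  rw [← bexp_const_mul, bchar, bchar, ← Finset.sum_sub_distrib, bexp]
  refine (norm_sum_le _ _).trans (Finset.sum_le_sum fun S _ => ?_)
  have hw : 0 ≤ p ^ S.card * (1 - p) ^ (E.card - S.card) := by positivity
  rw [← mul_sub, norm_mul, Complex.norm_real, Real.norm_of_nonneg hw, mul_comm]
  refine mul_le_mul_of_nonneg_right ?_ hw
  have h := norm_exp_mul_I_sub_exp_mul_I_le (θ * T S) (θ * U S)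
  rw [← mul_sub, abs_mul] at h
  exact_mod_cast h

theorem bchar_centered_card (p : ℝ) (E : Finset α) (σ θ : ℝ) :
    bchar p E (fun S => (S.card - E.card * p) / σ) θ =
      ((1 - p : ℝ) * cexp ((-(p * (θ / σ)) : ℝ) * I) +
        p * cexp (((1 - p) * (θ / σ) : ℝ) * I)) ^ E.card := by
  rw [add_comm, ← Finset.sum_pow_mul_eq_add_pow, bchar]
  refine Finset.sum_congr rfl fun S hS => ?_
  obtain ⟨m, hm⟩ := Nat.exists_eq_add_of_le (Finset.card_le_card (Finset.mem_powerset.1 hS))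
  rw [hm, Nat.add_sub_cancel_left, mul_pow, mul_pow, ← Complex.exp_nat_mul, ← Complex.exp_nat_mul,
    mul_mul_mul_comm, ← Complex.exp_add]
  push_cast
  congr 2
  ring

/-- A quantitative central limit theorem for the characteristic function of a binomial. -/
theorem norm_bchar_centered_card_sub_le (h0 : 0 < p) (h1 : p < 1) {σ θ : ℝ} (hσ0 : 0 < σ)
    (hσ : σ ^ 2 = E.card * p * (1 - p)) (hθ : |θ| ≤ σ) :
    ‖bchar p E (fun S => (S.card - E.card * p) / σ) θ - cexp (-(θ ^ 2) / 2)‖ ≤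
      3 * |θ| ^ 3 / σ + θ ^ 4 / σ ^ 2 := by
  have hq : 0 < 1 - p := sub_pos.2 h1
  set u := θ / σ with hu
  have hu1 : |u| ≤ 1 := by
    rw [hu, abs_div, abs_of_pos hσ0]
    exact (div_le_one hσ0).2 hθ
  have hpq : p * (1 - p) ≤ 1 := by nlinarith
  have hN : 0 < (E.card : ℝ) := by
    by_contra h
    have : (E.card : ℝ) = 0 := le_antisymm (not_lt.1 h) (by positivity)
    rw [this] at hσ
    nlinarith
  have hσN : σ ^ 2 ≤ E.card := by rw [hσ, mul_assoc]; nlinarith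
  have hθN : θ ^ 2 ≤ E.card := (sq_le_sq' (neg_le_of_abs_le hθ) (le_of_abs_le hθ)).trans hσN
  have hNu : E.card * (p * (1 - p) * u ^ 2) = θ ^ 2 := by
    rw [hu, div_pow, hσ]
    field_simp
  set a : ℂ := (1 - p : ℝ) * cexp ((-(p * u) : ℝ) * I) + p * cexp (((1 - p) * u : ℝ) * I) with ha
  set b : ℂ := cexp ((-(θ ^ 2 / (2 * E.card)) : ℝ)) with hb
  have hbN : cexp (-(θ ^ 2) / 2) = b ^ E.card := by
    rw [hb, ← Complex.exp_nat_mul]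
    congr 1
    push_cast
    have : (E.card : ℂ) ≠ 0 := by exact_mod_cast hN.ne'
    field_simp
  have ha1 : ‖a‖ ≤ 1 := by
    refine (norm_add_le _ _).trans ?_
    rw [norm_mul, norm_mul, norm_exp_ofReal_mul_I, norm_exp_ofReal_mul_I, Complex.norm_real,
      Complex.norm_real, Real.norm_of_nonneg hq.le, Real.norm_of_nonneg h0.le]
    linarith
  have hb1 : ‖b‖ ≤ 1 := by
    rw [hb, ← Complex.ofReal_exp, Complex.norm_real, Real.norm_of_nonneg (Real.exp_pos _).le,
      Real.exp_le_one_iff]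
    have : 0 ≤ θ ^ 2 / (2 * E.card) := by positivity
    linarith
  have hbt : ‖b - (1 - p * (1 - p) * u ^ 2 / 2)‖ ≤ (θ ^ 2 / (2 * E.card)) ^ 2 := by
    have hx : ‖((-(θ ^ 2 / (2 * E.card)) : ℝ) : ℂ)‖ = θ ^ 2 / (2 * E.card) := by
      rw [Complex.norm_real, norm_neg, Real.norm_of_nonneg (by positivity)]
    have h := Complex.norm_exp_sub_one_sub_id_le (x := ((-(θ ^ 2 / (2 * E.card)) : ℝ) : ℂ)) (by
      rw [hx, div_le_one (by positivity)]
      linarith)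
    rw [hx] at h
    refine le_of_eq_of_le ?_ h
    congr 1
    have h5 : θ ^ 2 / (2 * E.card) = p * (1 - p) * u ^ 2 / 2 := by
      rw [← hNu]
      field_simp
    rw [hb, h5]
    push_cast
    ring
  have hat : ‖a - (1 - p * (1 - p) * u ^ 2 / 2)‖ ≤ 3 * (p * (1 - p) * |u| ^ 3) := by
    have hy1 : |-(p * u)| = p * |u| := by rw [abs_neg, abs_mul, abs_of_pos h0]
    have hy2 : |(1 - p) * u| = (1 - p) * |u| := by rw [abs_mul, abs_of_pos hq]
    have t1 := norm_exp_mul_I_taylor_le (y := -(p * u)) (by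
      rw [hy1]; nlinarith [abs_nonneg u])
    have t2 := norm_exp_mul_I_taylor_le (y := (1 - p) * u) (by
      rw [hy2]; nlinarith [abs_nonneg u])
    rw [hy1] at t1
    rw [hy2] at t2
    have hsplit : a - (1 - p * (1 - p) * u ^ 2 / 2) =
        (1 - p : ℝ) * (cexp ((-(p * u) : ℝ) * I) -
          (1 + (-(p * u) : ℝ) * I - ((-(p * u) : ℝ) : ℂ) ^ 2 / 2)) +
        p * (cexp (((1 - p) * u : ℝ) * I) -
          (1 + ((1 - p) * u : ℝ) * I - (((1 - p) * u : ℝ) : ℂ) ^ 2 / 2)) := by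
      rw [ha]
      push_cast
      ring
    rw [hsplit]
    refine (norm_add_le _ _).trans ?_
    rw [norm_mul, norm_mul, Complex.norm_real, Complex.norm_real, Real.norm_of_nonneg hq.le,
      Real.norm_of_nonneg h0.le]
    have s1 := mul_le_mul_of_nonneg_left t1 hq.le
    have s2 := mul_le_mul_of_nonneg_left t2 h0.le
    have hz : 0 ≤ |u| ^ 3 := by positivity
    have hpp : p ^ 2 + (1 - p) ^ 2 ≤ 1 := by nlinarith
    have := mul_le_mul_of_nonneg_left hpp (mul_nonneg (mul_nonneg h0.le hq.le) hz)
    nlinarith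
  rw [bchar_centered_card, hbN]
  refine (norm_pow_sub_pow_le ha1 hb1 _).trans ?_
  have hab : ‖a - b‖ ≤ 3 * (p * (1 - p) * |u| ^ 3) + (θ ^ 2 / (2 * E.card)) ^ 2 := by
    refine (norm_sub_le_norm_sub_add_norm_sub a (1 - p * (1 - p) * u ^ 2 / 2) b).trans ?_
    rw [norm_sub_rev _ b]
    exact add_le_add hat hbt
  refine (mul_le_mul_of_nonneg_left hab hN.le).trans ?_
  rw [mul_add]
  refine add_le_add (le_of_eq ?_) ?_
  · rw [hu, abs_div, abs_of_pos hσ0, div_pow]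
    have : (E.card : ℝ) * p * (1 - p) / σ ^ 2 = 1 := by
      rw [← hσ]; exact div_self (by positivity)
    calc _ = 3 * |θ| ^ 3 / σ * ((E.card : ℝ) * p * (1 - p) / σ ^ 2) := by field_simp
      _ = _ := by rw [this, mul_one]
  · calc _ = θ ^ 4 / (4 * E.card) := by field_simp; ring
      _ ≤ _ := by
        refine div_le_div_of_nonneg_left (by positivity) (by positivity) ?_
        linarith

end BernoulliCharFun

section BernoulliLaw

open MeasureTheory ProbabilityTheory

variable {α : Type*} {p : ℝ} {E : Finset α}

/-- The law of `T S`, where `S` is the random subset of `E` containing each element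
independently with probability `p`. -/
noncomputable def blaw (p : ℝ) (E : Finset α) (T : Finset α → ℝ) : Measure ℝ :=
  ∑ S ∈ E.powerset, ENNReal.ofReal (p ^ S.card * (1 - p) ^ (E.card - S.card)) •
    Measure.dirac (T S)

theorem bweight_nonneg (h0 : 0 ≤ p) (h1 : p ≤ 1) (S : Finset α) :
    0 ≤ p ^ S.card * (1 - p) ^ (E.card - S.card) := by
  have := sub_nonneg.2 h1
  positivity

theorem blaw_apply (h0 : 0 ≤ p) (h1 : p ≤ 1) (T : Finset α → ℝ) {A : Set ℝ}
    (hA : MeasurableSet A) [DecidablePred (· ∈ A)] :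
    blaw p E T A = ENNReal.ofReal (bexp p E (fun S => if T S ∈ A then 1 else 0)) := by
  rw [blaw, bexp, ENNReal.ofReal_sum_of_nonneg, Measure.finsetSum_apply]
  · refine Finset.sum_congr rfl fun S _ => ?_
    rw [Measure.smul_apply, Measure.dirac_apply' _ hA, smul_eq_mul]
    by_cases h : T S ∈ A <;> simp [h]
  · intro S _
    have := bweight_nonneg (E := E) h0 h1 S
    split_ifs <;> simp [this]

theorem isProbabilityMeasure_blaw (h0 : 0 ≤ p) (h1 : p ≤ 1) (T : Finset α → ℝ) :
    IsProbabilityMeasure (blaw p E T) := by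
  classical
  constructor
  rw [blaw_apply h0 h1 T MeasurableSet.univ]
  simp

theorem charFun_blaw (h0 : 0 ≤ p) (h1 : p ≤ 1) (T : Finset α → ℝ) (θ : ℝ) :
    charFun (blaw p E T) θ = bchar p E T θ := by
  rw [charFun_apply_real, blaw, integral_finsetSum_measure, bchar]
  · refine Finset.sum_congr rfl fun S _ => ?_
    rw [integral_smul_measure, integral_dirac, ENNReal.toReal_ofReal (bweight_nonneg h0 h1 S)]
    rfl
  · intro S _
    refine Integrable.smul_measure ?_ ENNReal.ofReal_ne_top
    exact integrable_dirac (by simp)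

theorem gaussianReal_Iic (t : ℝ) :
    gaussianReal 0 1 (Set.Iic t) = ENNReal.ofReal (stdNormalCDF t) := by
  rw [gaussianReal_apply_eq_integral 0 one_ne_zero, stdNormalCDF]
  congr 1
  simp only [gaussianPDFReal, integral_const_mul]
  simp [div_eq_inv_mul]

/-- **Lévy's continuity theorem** for functionals of Bernoulli random sets. -/
theorem tendsto_bexp_le_of_tendsto_bchar {α : ℕ → Type*} {p : ℕ → ℝ} {E : ∀ n, Finset (α n)}
    {T : ∀ n, Finset (α n) → ℝ} (hp : ∀ᶠ n in atTop, 0 ≤ p n ∧ p n ≤ 1)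
    (h : ∀ θ : ℝ, Tendsto (fun n => bchar (p n) (E n) (T n) θ) atTop
      (nhds (Complex.exp (-(θ ^ 2) / 2)))) (t : ℝ) :
    Tendsto (fun n => bexp (p n) (E n) (fun S => if T n S ≤ t then 1 else 0)) atTop
      (nhds (stdNormalCDF t)) := by
  classical
  let ν : ℕ → ProbabilityMeasure ℝ := fun n =>
    if hn : 0 ≤ p n ∧ p n ≤ 1 then
      ⟨blaw (p n) (E n) (T n), isProbabilityMeasure_blaw hn.1 hn.2 _⟩
    else ⟨Measure.dirac 0, inferInstance⟩
  have hν : ∀ᶠ n in atTop, (ν n : Measure ℝ) = blaw (p n) (E n) (T n) := by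
    filter_upwards [hp] with n hn
    simp [ν, hn]
  let γ : ProbabilityMeasure ℝ := ⟨gaussianReal 0 1, inferInstance⟩
  have hlim : Tendsto ν atTop (nhds γ) := by
    refine ProbabilityMeasure.tendsto_of_tendsto_charFun fun θ => ?_
    have hγ : charFun (γ : Measure ℝ) θ = Complex.exp (-(θ ^ 2) / 2) := by
      change charFun (gaussianReal 0 1) θ = _
      rw [charFun_gaussianReal]
      congr 1
      push_cast
      ring
    rw [hγ]
    refine (h θ).congr' ?_
    filter_upwards [hp, hν] with n hn hn'
    rw [hn', charFun_blaw hn.1 hn.2]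
  have hfr : (γ : Measure ℝ) (frontier (Set.Iic t)) = 0 := by
    rw [frontier_Iic]
    change gaussianReal 0 1 {t} = 0
    have := nullSingletonClass_gaussianReal (μ := 0) (v := 1) one_ne_zero
    exact measure_singleton t
  have hm := ProbabilityMeasure.tendsto_measure_of_null_frontier_of_tendsto' hlim hfr
  change Tendsto _ _ (nhds (gaussianReal 0 1 (Set.Iic t))) at hm
  rw [gaussianReal_Iic] at hm
  have hm' := (ENNReal.tendsto_toReal ENNReal.ofReal_ne_top).comp hm
  have hΦ : 0 ≤ stdNormalCDF t := by
    unfold stdNormalCDF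
    have : 0 ≤ ∫ x in Set.Iic t, Real.exp (-(x ^ 2) / 2) :=
      integral_nonneg fun x => (Real.exp_pos _).le
    positivity
  rw [ENNReal.toReal_ofReal hΦ] at hm'
  refine hm'.congr' ?_
  filter_upwards [hp, hν] with n hn hn'
  have h0 : 0 ≤ bexp (p n) (E n) (fun S => if T n S ≤ t then 1 else 0) :=
    bexp_nonneg hn.1 hn.2 fun S _ => by split_ifs <;> norm_num
  simp only [Function.comp, hn', blaw_apply hn.1 hn.2 _ measurableSet_Iic, Set.mem_Iic]
  exact ENNReal.toReal_ofReal h0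

end BernoulliLaw

section LinearApproximation

variable {α : Type*} {p : ℝ} {E : Finset α}

theorem bexp_card [DecidableEq α] : bexp p E (fun S => (S.card : ℝ)) = E.card * p := by
  induction E using Finset.induction_on with
  | empty => simp [bexp]
  | insert a E ha ih =>
    rw [bexp_insert ha, Finset.card_insert_of_notMem ha]
    have h : bexp p E (fun S => (1 - p) * (S.card : ℝ) + p * ((insert a S).card : ℝ)) =
        bexp p E (fun S => (S.card : ℝ) + p) := by
      refine bexp_congr fun S hS => ?_
      rw [Finset.card_insert_of_notMem fun h => ha (hS h)]
      push_cast
      ring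
    rw [h, bexp_add, ih, bexp_const]
    push_cast
    ring

theorem bexp_card_sub_sq [DecidableEq α] :
    bexp p E (fun S => ((S.card : ℝ) - E.card * p) ^ 2) = E.card * p * (1 - p) := by
  rw [bexp_sq_sub_const, bexp_card]
  have h : bexp p E (fun S => (S.card : ℝ) ^ 2) = (E.card * p) ^ 2 + E.card * p * (1 - p) := by
    induction E using Finset.induction_on with
    | empty => simp [bexp]
    | insert a E ha ih =>
      rw [bexp_insert ha, Finset.card_insert_of_notMem ha]
      have h : bexp p E (fun S => (1 - p) * (S.card : ℝ) ^ 2 + p * ((insert a S).card : ℝ) ^ 2) =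
          bexp p E (fun S => ((S.card : ℝ) ^ 2 + 2 * p * S.card) + p) := by
        refine bexp_congr fun S hS => ?_
        rw [Finset.card_insert_of_notMem fun h => ha (hS h)]
        push_cast
        ring
      rw [h, bexp_add, bexp_add, ih, bexp_const_mul, bexp_card, bexp_const]
      push_cast
      ring
  rw [h]
  ring

/-- If `f` is close in `L²` to a linear function of the number of elements, then so are the
standardized variables. -/
theorem bexp_standardized_sub_sq_le [DecidableEq α] (h0 : 0 ≤ p) (h1 : p ≤ 1)
    {f : Finset α → ℝ} {m σ V : ℝ} (hm : 0 < m) (hσ0 : 0 < σ)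
    (hσ : σ ^ 2 = E.card * p * (1 - p))
    (hV : bexp p E (fun S => (f S - m * S.card) ^ 2) -
      bexp p E (fun S => f S - m * S.card) ^ 2 ≤ V) (hVs : V ≤ (m * σ) ^ 2 / 4) :
    bexp p E (fun S => ((f S - bexp p E f) / √(bexp p E (fun S => (f S - bexp p E f) ^ 2)) -
      (S.card - E.card * p) / σ) ^ 2) ≤ 2 * (V / (m * σ) ^ 2) := by
  set v := bexp p E (fun S => (f S - bexp p E f) ^ 2) with hv
  set s := m * σ with hs
  have hs0 : 0 < s := mul_pos hm hσ0
  set W : Finset α → ℝ := fun S => f S - bexp p E f with hW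
  set U : Finset α → ℝ := fun S => (S.card - E.card * p) / σ with hU
  have hUU : bexp p E (fun S => U S ^ 2) = 1 := by
    have : (fun S => U S ^ 2) = fun S : Finset α =>
        (σ ^ 2)⁻¹ * ((S.card : ℝ) - E.card * p) ^ 2 := by
      funext S
      rw [hU, div_pow]
      field_simp
    rw [this, bexp_const_mul, bexp_card_sub_sq, ← hσ]
    exact inv_mul_cancel₀ (by positivity)
  have hR : bexp p E (fun S => (W S - s * U S) ^ 2) ≤ V := by
    rw [← bexp_sq_sub_mean] at hV
    refine le_of_eq_of_le (bexp_congr fun S _ => ?_) hV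
    rw [bexp_sub, bexp_const_mul, bexp_card]
    simp only [hW, hU, hs]
    field_simp
    ring
  have hR0 : 0 ≤ bexp p E (fun S => (W S - s * U S) ^ 2) :=
    bexp_nonneg h0 h1 fun S _ => sq_nonneg _
  have hvs : s ^ 2 / 4 ≤ v := by
    have : bexp p E (fun S => s ^ 2 * U S ^ 2) ≤
        bexp p E (fun S => 2 * W S ^ 2 + 2 * (W S - s * U S) ^ 2) :=
      bexp_mono h0 h1 fun S _ => by nlinarith [sq_nonneg (2 * W S - s * U S)]
    rw [bexp_add, bexp_const_mul, bexp_const_mul, bexp_const_mul, hUU] at this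
    change s ^ 2 * 1 ≤ 2 * v + _ at this
    linarith
  set d := √v with hd
  have hdv : d ^ 2 = v := Real.sq_sqrt (by nlinarith)
  have hds : s / 2 ≤ d := Real.le_sqrt_of_sq_le (by linarith [div_pow s 2 2])
  have hd0 : 0 < d := by linarith
  have hid : (fun S => (W S / d - U S) ^ 2) = fun S =>
      (s * d)⁻¹ * ((W S - s * U S) ^ 2 + ((s / d - 1) * W S ^ 2 + (s * d - s ^ 2) * U S ^ 2)) := by
    funext S
    field_simp
    ring
  rw [hid, bexp_const_mul, bexp_add, bexp_add, bexp_const_mul, bexp_const_mul, hUU]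
  change (s * d)⁻¹ * (_ + ((s / d - 1) * v + _)) ≤ _
  have h2 : (s / d - 1) * v = s * d - d ^ 2 := by
    rw [← hdv]
    field_simp
  rw [h2, inv_mul_eq_div, div_le_iff₀ (by positivity)]
  have h3 : V ≤ 2 * (V / s ^ 2) * (s * d) := by
    have hV0 : 0 ≤ V := hR0.trans hR
    calc V = 2 * (V / s ^ 2) * (s * (s / 2)) := by field_simp
      _ ≤ _ := by gcongr
  nlinarith [sq_nonneg (s - d)]

/-- A functional of a Bernoulli random set that is close in `L²` to a linear function of the
number of elements satisfies the central limit theorem. -/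
theorem clt_of_linear_approximation {α : ℕ → Type*} [∀ n, DecidableEq (α n)] {p : ℕ → ℝ}
    {E : ∀ n, Finset (α n)} {f : ∀ n, Finset (α n) → ℝ} {m V : ℕ → ℝ}
    (hp : ∀ᶠ n in atTop, 0 < p n ∧ p n < 1) (hm : ∀ᶠ n in atTop, 0 < m n)
    (hE : Tendsto (fun n => (E n).card * p n * (1 - p n)) atTop atTop)
    (hV : ∀ᶠ n in atTop, bexp (p n) (E n) (fun S => (f n S - m n * S.card) ^ 2) -
      bexp (p n) (E n) (fun S => f n S - m n * S.card) ^ 2 ≤ V n)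
    (hlim : Tendsto (fun n => V n / (m n ^ 2 * ((E n).card * p n * (1 - p n)))) atTop (nhds 0))
    (t : ℝ) :
    Tendsto (fun n => bexp (p n) (E n) (fun S =>
        if (f n S - bexp (p n) (E n) (f n)) / √(bexp (p n) (E n)
          (fun S => (f n S - bexp (p n) (E n) (f n)) ^ 2)) ≤ t then 1 else 0)) atTop
      (nhds (stdNormalCDF t)) := by
  refine tendsto_bexp_le_of_tendsto_bchar (hp.mono fun n hn => ⟨hn.1.le, hn.2.le⟩) (fun θ => ?_) t
  set σ : ℕ → ℝ := fun n => √((E n).card * p n * (1 - p n)) with hσ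
  have hσlim : Tendsto σ atTop atTop := Real.tendsto_sqrt_atTop.comp hE
  rw [tendsto_iff_norm_sub_tendsto_zero]
  have hbound : Tendsto (fun n =>
      |θ| * √(2 * (V n / (m n ^ 2 * ((E n).card * p n * (1 - p n))))) +
        (3 * |θ| ^ 3 / σ n + θ ^ 4 / σ n ^ 2)) atTop (nhds 0) := by
    have a := (Real.continuous_sqrt.tendsto _).comp (hlim.const_mul 2)
    have b := hσlim.const_div_atTop (3 * |θ| ^ 3)
    have c := ((tendsto_pow_atTop (two_ne_zero)).comp hσlim).const_div_atTop (θ ^ 4)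
    simpa using (a.const_mul |θ|).add (b.add c)
  refine squeeze_zero' (Eventually.of_forall fun n => norm_nonneg _) ?_ hbound
  filter_upwards [hp, hm, hV, hσlim.eventually_ge_atTop |θ|, hσlim.eventually_gt_atTop 0,
    hlim.eventually_le_const (by norm_num : (0 : ℝ) < 1 / 4)] with n hpn hmn hVn hθ hσ0 hle
  have hσ2 : σ n ^ 2 = (E n).card * p n * (1 - p n) :=
    Real.sq_sqrt (by
      have := sub_nonneg.2 hpn.2.le
      have := hpn.1.le
      positivity)
  rw [← hσ2, ← mul_pow] at hle ⊢
  have hle' : V n ≤ (m n * σ n) ^ 2 / 4 := by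
    rw [div_le_iff₀ (by positivity)] at hle
    linarith
  refine (norm_sub_le_norm_sub_add_norm_sub _ (bchar (p n) (E n)
    (fun S => (S.card - (E n).card * p n) / σ n) θ) _).trans (add_le_add ?_ ?_)
  · refine (norm_bchar_sub_le hpn.1.le hpn.2.le _ _ θ).trans ?_
    refine mul_le_mul_of_nonneg_left (Real.sqrt_le_sqrt ?_) (abs_nonneg θ)
    exact bexp_standardized_sub_sq_le hpn.1.le hpn.2.le hmn hσ0 hσ2 hVn hle'
  · exact norm_bchar_centered_card_sub_le hpn.1 hpn.2 hσ0 hσ2 hθ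

end LinearApproximation

section ErdosRenyi

theorem edgeSet_fromEdgeSet_eq {n : ℕ} {S : Finset (Sym2 (Fin n))} (hS : S ⊆ allEdges n) :
    (SimpleGraph.fromEdgeSet (S : Set (Sym2 (Fin n)))).edgeSet = S := by
  rw [SimpleGraph.edgeSet_fromEdgeSet]
  refine sdiff_eq_left.2 (Set.disjoint_left.2 fun e he hd => ?_)
  exact (mem_cliqueEdges.1 (hS he)).2 hd

theorem erExp_eq_bexp (n : ℕ) (p : ℝ) (f : SimpleGraph (Fin n) → ℝ) :
    erExp n p f = bexp p (allEdges n)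
      (fun S => f (SimpleGraph.fromEdgeSet (S : Set (Sym2 (Fin n))))) := by
  classical
  rw [erExp, bexp]
  symm
  refine Finset.sum_bij (fun S _ => SimpleGraph.fromEdgeSet (S : Set (Sym2 (Fin n))))
    (fun S _ => Finset.mem_univ _) ?_ ?_ ?_
  · intro S hS T hT h
    have h' := congrArg SimpleGraph.edgeSet h
    rw [edgeSet_fromEdgeSet_eq (Finset.mem_powerset.1 hS),
      edgeSet_fromEdgeSet_eq (Finset.mem_powerset.1 hT)] at h'
    exact Finset.coe_injective h'
  · intro G _
    refine ⟨G.edgeFinset, Finset.mem_powerset.2 fun e he => ?_, ?_⟩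
    · rw [SimpleGraph.mem_edgeFinset] at he
      exact mem_cliqueEdges.2 ⟨fun v _ => Finset.mem_univ v, G.not_isDiag_of_mem_edgeSet he⟩
    · rw [SimpleGraph.coe_edgeFinset, SimpleGraph.fromEdgeSet_edgeSet]
  · intro S hS
    rw [edgeSet_fromEdgeSet_eq (Finset.mem_powerset.1 hS), Set.ncard_coe_finset, card_allEdges]

theorem erProb_eq_bexp (n : ℕ) (p : ℝ) (A : SimpleGraph (Fin n) → Prop) [DecidablePred A] :
    erProb n p A = bexp p (allEdges n)
      (fun S => if A (SimpleGraph.fromEdgeSet (S : Set (Sym2 (Fin n)))) then 1 else 0) := by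
  rw [← erExp_eq_bexp n p fun G => if A G then 1 else 0, erProb, erExp]
  refine Finset.sum_congr rfl fun G _ => ?_
  by_cases h : A G <;> simp [h]

end ErdosRenyi

section Asymptotics

variable {j : ℕ} {p : ℕ → ℝ}

theorem natCast_mul_pow_eq {n : ℕ} {p : ℝ} {i : ℕ} (hi : i ≠ 0) :
    n * p ^ i = (p * (n : ℝ) ^ ((1 : ℝ) / i)) ^ i := by
  rw [mul_pow, ← Real.rpow_mul_natCast (Nat.cast_nonneg n), one_div,
    inv_mul_cancel₀ (by exact_mod_cast hi), Real.rpow_one, mul_comm]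

theorem pow_le_mul_choose {n : ℕ} (hn : 2 * j + 2 ≤ n) :
    (n : ℝ) ^ j ≤ 2 ^ j * j.factorial * (n - 2).choose j := by
  have h1 : n ≤ 2 * (n - 2 + 1 - j) := by omega
  have h2 : n ^ j ≤ 2 ^ j * (n - 2 + 1 - j) ^ j := by
    rw [← mul_pow]; exact Nat.pow_le_pow_left h1 j
  have h3 : ((n - 2 + 1 - j : ℕ) ^ j : ℝ) ≤ j.factorial * (n - 2).choose j := by
    have := Nat.pow_le_choose (α := ℝ) j (n - 2)
    rwa [div_le_iff₀' (by positivity)] at this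
  calc (n : ℝ) ^ j ≤ 2 ^ j * ((n - 2 + 1 - j : ℕ) ^ j : ℝ) := by exact_mod_cast h2
    _ ≤ 2 ^ j * (j.factorial * (n - 2).choose j) := by gcongr
    _ = _ := by ring

theorem sq_le_mul_choose_two {n : ℕ} (hn : 2 ≤ n) : (n : ℝ) ^ 2 ≤ 4 * n.choose 2 := by
  have h2 : (2 : ℝ) ≤ n := by exact_mod_cast hn
  rw [Nat.cast_choose_two]
  nlinarith

theorem meanSq_le_mul_edgeMean_sq {n : ℕ} {p : ℝ} (h0 : 0 ≤ p) (hn : 2 * j + 2 ≤ n) :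
    meanSq n p j ≤ (2 ^ j * j.factorial) ^ 2 * edgeMean n p j ^ 2 := by
  have h : (n : ℝ) ^ j * p ^ ((j + 2).choose 2 - 1) ≤ 2 ^ j * j.factorial * edgeMean n p j := by
    rw [edgeMean, ← mul_assoc]
    exact mul_le_mul_of_nonneg_right (pow_le_mul_choose hn) (by positivity)
  have := pow_le_pow_left₀ (by positivity) h 2
  rw [← mul_pow]
  refine le_of_eq_of_le ?_ this
  rw [meanSq, mul_pow, ← pow_mul, ← pow_mul, mul_comm j 2, mul_comm _ 2]

/-- The central limit theorem for the Betti number, in terms of random edge sets. -/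
theorem tendsto_bexp_flagBetti (hp : ∀ᶠ n in atTop, 0 < p n) (hp0 : Tendsto p atTop (nhds 0))
    (hx : Tendsto (fun n : ℕ => n * p n ^ (j + 1)) atTop atTop)
    (hy : Tendsto (fun n : ℕ => n * p n ^ (j + 2)) atTop (nhds 0)) (t : ℝ) :
    Tendsto (fun n => bexp (p n) (allEdges n) (fun S =>
        if (flagBetti n j S - bexp (p n) (allEdges n) (flagBetti n j)) /
          √(bexp (p n) (allEdges n)
            (fun S => (flagBetti n j S - bexp (p n) (allEdges n) (flagBetti n j)) ^ 2)) ≤ t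
        then 1 else 0)) atTop (nhds (stdNormalCDF t)) := by
  have hhalf : ∀ᶠ n in atTop, p n ≤ 1 / 2 := hp0.eventually_le_const (by norm_num)
  have hVar : ∀ᶠ n : ℕ in atTop, (n : ℝ) ^ 2 * p n ≤ 8 * ((allEdges n).card * p n * (1 - p n)) := by
    filter_upwards [hp, hhalf, eventually_ge_atTop 2] with n h0 h1 hn
    rw [card_allEdges]
    have h3 := sq_le_mul_choose_two hn
    have h4 : (n.choose 2 : ℝ) * p n * (1 / 2) ≤ n.choose 2 * p n * (1 - p n) :=
      mul_le_mul_of_nonneg_left (by linarith) (by positivity)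
    nlinarith [mul_le_mul_of_nonneg_right h3 h0.le]
  set a : ℝ := 15 * ((j + 1) * 2 ^ (j + 2)) + 6 * (j + 2).choose 2 with ha
  set b : ℝ := 3 * ((j + 2) * 2 ^ (j + 3)) with hb
  refine clt_of_linear_approximation (m := fun n => edgeMean n (p n) j)
    (V := fun n => ((n : ℝ) ^ 2 * p n * meanSq n (p n) j) *
      (a / (n * p n ^ (j + 1)) + b * (n * p n ^ (j + 2)))) ?_ ?_ ?_ ?_ ?_ t
  · filter_upwards [hp, hhalf] with n h0 h1
    exact ⟨h0, by linarith⟩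
  · filter_upwards [hp, eventually_ge_atTop (j + 2)] with n h0 hn
    have : 0 < (n - 2).choose j := Nat.choose_pos (by omega)
    unfold edgeMean
    positivity
  · refine tendsto_atTop_mono' _ ?_ (hx.atTop_div_const (by norm_num : (0 : ℝ) < 8))
    filter_upwards [hp, hhalf, hVar, eventually_ge_atTop 1] with n h0 h1 h2 hn
    have hn1 : (1 : ℝ) ≤ n := by exact_mod_cast hn
    have h3 : p n ^ (j + 1) ≤ p n := pow_le_of_le_one h0.le (by linarith) (by omega)
    have h4 : n * p n ^ (j + 1) ≤ (n : ℝ) ^ 2 * p n := by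
      calc n * p n ^ (j + 1) ≤ n * p n := by gcongr
        _ ≤ n * (n * p n) := le_mul_of_one_le_left (by positivity) hn1
        _ = _ := by ring
    linarith
  · filter_upwards [hp, hhalf, hx.eventually_ge_atTop 1,
      hy.eventually_le_const (by norm_num : (0 : ℝ) < 1)] with n h0 h1 h2 h3
    exact variance_flagBetti_sub_le h0.le (by linarith) h2 h3
  · have hlim : Tendsto (fun n : ℕ => 8 * (2 ^ j * (j.factorial : ℝ)) ^ 2 *
        (a / (n * p n ^ (j + 1)) + b * (n * p n ^ (j + 2)))) atTop (nhds 0) := by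
      simpa using ((hx.const_div_atTop a).add (hy.const_mul b)).const_mul
        (8 * (2 ^ j * (j.factorial : ℝ)) ^ 2)
    refine squeeze_zero' ?_ ?_ hlim
    · filter_upwards [hp, hhalf] with n h0 h1
      have : 0 ≤ 1 - p n := by linarith
      have hQ : 0 ≤ meanSq n (p n) j := by unfold meanSq; positivity
      positivity
    · filter_upwards [hp, hhalf, hVar, eventually_ge_atTop (2 * j + 2)] with n h0 h1 h2 hn
      have hQ := meanSq_le_mul_edgeMean_sq (j := j) h0.le hn
      have hQ0 : 0 ≤ meanSq n (p n) j := by unfold meanSq; positivity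
      have hc : 0 ≤ a / (n * p n ^ (j + 1)) + b * (n * p n ^ (j + 2)) := by positivity
      have h3 : 0 < edgeMean n (p n) j := by
        have : 0 < (n - 2).choose j := Nat.choose_pos (by omega)
        unfold edgeMean
        positivity
      have hn0 : 0 < (n : ℝ) := by exact_mod_cast (by omega : 0 < n)
      have h4 : 0 < (allEdges n).card * p n * (1 - p n) := by
        have : 0 < (n : ℝ) ^ 2 * p n := by positivity
        linarith
      rw [div_le_iff₀ (by positivity), mul_right_comm (8 * (2 ^ j * (j.factorial : ℝ)) ^ 2)]
      refine mul_le_mul_of_nonneg_right ?_ hc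
      calc (n : ℝ) ^ 2 * p n * meanSq n (p n) j ≤
          8 * ((allEdges n).card * p n * (1 - p n)) *
            ((2 ^ j * j.factorial) ^ 2 * edgeMean n (p n) j ^ 2) := by gcongr
        _ = _ := by ring

end Asymptotics

theorem random_flag_complex_betti_clt (k : ℕ) (hk : 1 ≤ k) (p : ℕ → ℝ)
    (hlow : Tendsto (fun n : ℕ => p n * (n : ℝ) ^ ((1 : ℝ) / k)) atTop atTop)
    (hhigh : Tendsto (fun n : ℕ => p n * (n : ℝ) ^ ((1 : ℝ) / (k + 1))) atTop (nhds 0)) :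
    ∀ t : ℝ,
      Tendsto (fun n : ℕ =>
          erProb n (p n) (fun G =>
            ((bettiNumber (flagComplex G) k : ℝ) -
                erExp n (p n) (fun H => (bettiNumber (flagComplex H) k : ℝ))) /
              Real.sqrt (erExp n (p n) (fun H =>
                ((bettiNumber (flagComplex H) k : ℝ) -
                  erExp n (p n) (fun H' => (bettiNumber (flagComplex H') k : ℝ))) ^ 2)) ≤ t))
        atTop (nhds (stdNormalCDF t)) := by
  intro t
  obtain ⟨j, rfl⟩ := Nat.exists_eq_add_of_le' hk
  have hp : ∀ᶠ n in atTop, 0 < p n := by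
    filter_upwards [hlow.eventually_gt_atTop 0] with n hn
    exact pos_of_mul_pos_left hn (by positivity)
  have hp0 : Tendsto p atTop (nhds 0) := by
    refine squeeze_zero' (hp.mono fun n hn => hn.le) ?_ hhigh
    filter_upwards [hp, eventually_ge_atTop 1] with n hn h1
    exact le_mul_of_one_le_right hn.le
      (Real.one_le_rpow (by exact_mod_cast h1) (by positivity))
  have hx : Tendsto (fun n : ℕ => n * p n ^ (j + 1)) atTop atTop := by
    simp_rw [natCast_mul_pow_eq (Nat.succ_ne_zero j)]
    exact (tendsto_pow_atTop (Nat.succ_ne_zero j)).comp hlow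
  have hy : Tendsto (fun n : ℕ => n * p n ^ (j + 2)) atTop (nhds 0) := by
    simp_rw [natCast_mul_pow_eq (Nat.succ_ne_zero (j + 1))]
    have := hhigh.pow (j + 2)
    rw [zero_pow (Nat.succ_ne_zero (j + 1))] at this
    exact_mod_cast this
  refine (tendsto_bexp_flagBetti hp hp0 hx hy t).congr fun n => ?_
  classical
  simp only [erProb_eq_bexp, erExp_eq_bexp, bettiNumber_flagComplex hk]
  rfl
end
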